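/- Let q be a power of an odd prime, F_q a finite field with q elements, J ∈ M_{2n}(F_q) an invertible symmetric matrix, and G = GO(J) = {g ∈ GL(2n, F_q) : gᵀ J g = μ(g) J for some μ(g) ∈ F_q^×} the corresponding orthogonal similitude group. If χ is the character of an irreducible finite-dimensional complex representation of G and χ is real-valued, then ε(χ) = 1, i.e. (1/|G|) Σ_{g∈G} χ(g²) = 1. -/

import Mathlib

open Matrix CategoryTheory
open scoped Classical

noncomputable section

/-- The Frobenius–Schur indicator of a complex-valued function on a finite group. -/
def fsIndicator (G : Type*) [Group G] [Fintype G] (χ : G → ℂ) : ℂ :=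
  (Fintype.card G : ℂ)⁻¹ * ∑ g : G, χ (g * g)

/-- The twisted Frobenius–Schur indicator of a complex-valued function on a finite group,
with respect to a map `σ`. -/
def twistedFSIndicator (G : Type*) [Group G] [Fintype G] (σ : G → G) (χ : G → ℂ) : ℂ :=
  (Fintype.card G : ℂ)⁻¹ * ∑ g : G, χ (g * σ g)

/-- A complex-valued function is real-valued if all its values are real. -/
def IsRealValued {G : Type*} (χ : G → ℂ) : Prop := ∀ g : G, ∃ r : ℝ, χ g = (r : ℂ)

/-- The Gaussian binomial coefficient `binom(m,k)_q` as a real number. -/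
def gbinom (m k : ℕ) (q : ℝ) : ℝ := ∏ i ∈ Finset.Icc 1 k, (q ^ (m - k + i) - 1) / (q ^ i - 1)

section Groups

variable {N F : Type*} [Fintype N] [DecidableEq N] [Field F]

theorem sim_one (J : Matrix N N F) :
    ((1 : GL N F) : Matrix N N F)ᵀ * J * ((1 : GL N F) : Matrix N N F) = ((1 : Fˣ) : F) • J := by
  simp

theorem sim_mul {J : Matrix N N F} (a b : GL N F) (c d : Fˣ)
    (hc : (a : Matrix N N F)ᵀ * J * (a : Matrix N N F) = (c : F) • J)
    (hd : (b : Matrix N N F)ᵀ * J * (b : Matrix N N F) = (d : F) • J) :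
    ((a * b : GL N F) : Matrix N N F)ᵀ * J * ((a * b : GL N F) : Matrix N N F)
      = ((c * d : Fˣ) : F) • J := by
  calc ((a * b : GL N F) : Matrix N N F)ᵀ * J * ((a * b : GL N F) : Matrix N N F)
      = (b : Matrix N N F)ᵀ * ((a : Matrix N N F)ᵀ * J * (a : Matrix N N F)) *
          (b : Matrix N N F) := by
        rw [show ((a * b : GL N F) : Matrix N N F) = (a : Matrix N N F) * b from rfl,
          transpose_mul]
        simp only [Matrix.mul_assoc]
    _ = (b : Matrix N N F)ᵀ * ((c : F) • J) * (b : Matrix N N F) := by rw [hc]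
    _ = (c : F) • ((b : Matrix N N F)ᵀ * J * (b : Matrix N N F)) := by
        rw [Matrix.mul_smul, Matrix.smul_mul]
    _ = (c : F) • ((d : F) • J) := by rw [hd]
    _ = ((c * d : Fˣ) : F) • J := by rw [smul_smul, Units.val_mul]

theorem sim_inv {J : Matrix N N F} (a : GL N F) (c : Fˣ)
    (hc : (a : Matrix N N F)ᵀ * J * (a : Matrix N N F) = (c : F) • J) :
    ((a⁻¹ : GL N F) : Matrix N N F)ᵀ * J * ((a⁻¹ : GL N F) : Matrix N N F)
      = ((c⁻¹ : Fˣ) : F) • J := by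
  have ht : ((a⁻¹ : GL N F) : Matrix N N F)ᵀ * (a : Matrix N N F)ᵀ = 1 := by
    rw [← transpose_mul, a.mul_inv, transpose_one]
  have key : ((a⁻¹ : GL N F) : Matrix N N F)ᵀ * ((a : Matrix N N F)ᵀ * J * (a : Matrix N N F)) *
      ((a⁻¹ : GL N F) : Matrix N N F) = J := by
    calc ((a⁻¹ : GL N F) : Matrix N N F)ᵀ * ((a : Matrix N N F)ᵀ * J * (a : Matrix N N F)) *
        ((a⁻¹ : GL N F) : Matrix N N F)
        = (((a⁻¹ : GL N F) : Matrix N N F)ᵀ * (a : Matrix N N F)ᵀ) * J *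
          ((a : Matrix N N F) * ((a⁻¹ : GL N F) : Matrix N N F)) := by
          simp only [Matrix.mul_assoc]
      _ = J := by rw [ht, a.mul_inv, Matrix.one_mul, Matrix.mul_one]
  have key2 : ((a⁻¹ : GL N F) : Matrix N N F)ᵀ * ((c : F) • J) * ((a⁻¹ : GL N F) : Matrix N N F)
      = (c : F) • (((a⁻¹ : GL N F) : Matrix N N F)ᵀ * J * ((a⁻¹ : GL N F) : Matrix N N F)) := by
    rw [Matrix.mul_smul, Matrix.smul_mul]
  have h3 : (c : F) • (((a⁻¹ : GL N F) : Matrix N N F)ᵀ * J *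
      ((a⁻¹ : GL N F) : Matrix N N F)) = J := by rw [← key2, ← hc, key]
  calc ((a⁻¹ : GL N F) : Matrix N N F)ᵀ * J * ((a⁻¹ : GL N F) : Matrix N N F)
      = ((c⁻¹ : Fˣ) : F) • ((c : F) • (((a⁻¹ : GL N F) : Matrix N N F)ᵀ * J *
          ((a⁻¹ : GL N F) : Matrix N N F))) := by
        rw [smul_smul, ← Units.val_mul, inv_mul_cancel, Units.val_one, one_smul]
    _ = ((c⁻¹ : Fˣ) : F) • J := by rw [h3]

/-- The similitude group of the bilinear form given by the matrix `J`:  all invertible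
matrices `g` with `gᵀ * J * g = c • J` for some nonzero scalar `c` (the similitude of `g`). -/
def similitudeGroup (J : Matrix N N F) : Subgroup (GL N F) where
  carrier := {g | ∃ c : Fˣ, (g : Matrix N N F)ᵀ * J * (g : Matrix N N F) = (c : F) • J}
  one_mem' := ⟨1, sim_one J⟩
  mul_mem' := by rintro a b ⟨c, hc⟩ ⟨d, hd⟩; exact ⟨c * d, sim_mul a b c d hc hd⟩
  inv_mem' := by rintro a ⟨c, hc⟩; exact ⟨c⁻¹, sim_inv a c hc⟩

/-- The isometry group of the bilinear form given by the matrix `J`:  all invertible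
matrices `g` with `gᵀ * J * g = J`. -/
def fixGroup (J : Matrix N N F) : Subgroup (GL N F) where
  carrier := {g | (g : Matrix N N F)ᵀ * J * (g : Matrix N N F) = J}
  one_mem' := by simp
  mul_mem' := by
    intro a b ha hb
    have := sim_mul (J := J) a b 1 1 (by simpa using ha) (by simpa using hb)
    simpa using this
  inv_mem' := by
    intro a ha
    have := sim_inv (J := J) a 1 (by simpa using ha)
    simpa using this

/-- The group of isometries of determinant one of the bilinear form given by the matrix `J`. -/
def specialFixGroup (J : Matrix N N F) : Subgroup (GL N F) where
  carrier := {g | (g : Matrix N N F)ᵀ * J * (g : Matrix N N F) = J ∧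
    ((g : Matrix N N F)).det = 1}
  one_mem' := ⟨by simp, by simp⟩
  mul_mem' := by
    rintro a b ⟨ha1, ha2⟩ ⟨hb1, hb2⟩
    refine ⟨(fixGroup J).mul_mem ha1 hb1, ?_⟩
    rw [show ((a * b : GL N F) : Matrix N N F) = (a : Matrix N N F) * b from rfl,
      Matrix.det_mul, ha2, hb2, one_mul]
  inv_mem' := by
    rintro a ⟨ha1, ha2⟩
    refine ⟨(fixGroup J).inv_mem ha1, ?_⟩
    have h := congrArg Matrix.det a.mul_inv
    rw [Matrix.det_mul, ha2, one_mul, Matrix.det_one] at h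
    exact h

/-- The connected component of the similitude group of the symmetric bilinear form on a
`2 * m`-dimensional space given by the matrix `J`:  all similitudes `g`, with similitude
character `μ`, such that `det g = μ(g) ^ m`. -/
def connSimilitudeGroup (J : Matrix N N F) (m : ℕ) : Subgroup (GL N F) where
  carrier := {g | ∃ c : Fˣ, (g : Matrix N N F)ᵀ * J * (g : Matrix N N F) = (c : F) • J ∧
    ((g : Matrix N N F)).det = (c : F) ^ m}
  one_mem' := ⟨1, sim_one J, by simp⟩
  mul_mem' := by
    rintro a b ⟨c, hc1, hc2⟩ ⟨d, hd1, hd2⟩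
    refine ⟨c * d, sim_mul a b c d hc1 hd1, ?_⟩
    rw [show ((a * b : GL N F) : Matrix N N F) = (a : Matrix N N F) * b from rfl,
      Matrix.det_mul, hc2, hd2, Units.val_mul, mul_pow]
  inv_mem' := by
    rintro a ⟨c, hc1, hc2⟩
    refine ⟨c⁻¹, sim_inv a c hc1, ?_⟩
    have h := congrArg Matrix.det a.mul_inv
    rw [Matrix.det_mul, hc2, Matrix.det_one] at h
    have hc : ((c : F) ^ m)⁻¹ = ((c⁻¹ : Fˣ) : F) ^ m := by
      rw [← inv_pow]
      norm_cast
    rw [← hc]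
    exact (inv_eq_of_mul_eq_one_right h).symm

theorem neg_one_mem_similitudeGroup (J : Matrix N N F) : (-1 : GL N F) ∈ similitudeGroup J := by
  refine ⟨1, ?_⟩
  have h : ((-1 : GL N F) : Matrix N N F) = -1 := by simp
  rw [h]
  simp

/-- The standard symplectic form matrix `[[0, I], [-I, 0]]`. -/
def Jsp (n : ℕ) (F : Type*) [Field F] : Matrix (Fin n ⊕ Fin n) (Fin n ⊕ Fin n) F :=
  Matrix.fromBlocks 0 1 (-1) 0

/-- The standard split symmetric form matrix `[[0, I], [I, 0]]`. -/
def Jsplit (n : ℕ) (F : Type*) [Field F] : Matrix (Fin n ⊕ Fin n) (Fin n ⊕ Fin n) F :=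
  Matrix.fromBlocks 0 1 1 0

/-- A symmetric matrix `J` of size `2n` is split if it is congruent to `[[0, I], [I, 0]]`. -/
def IsSplit {n : ℕ} (J : Matrix (Fin n ⊕ Fin n) (Fin n ⊕ Fin n) F) : Prop :=
  ∃ P : GL (Fin n ⊕ Fin n) F,
    (P : Matrix (Fin n ⊕ Fin n) (Fin n ⊕ Fin n) F)ᵀ * J * P = Jsplit n F

/-- The symplectic similitude group `GSp(2n, F)`. -/
def GSp (n : ℕ) (F : Type*) [Field F] : Subgroup (GL (Fin n ⊕ Fin n) F) :=
  similitudeGroup (Jsp n F)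

/-- The symplectic group `Sp(2n, F)`. -/
def Sp (n : ℕ) (F : Type*) [Field F] : Subgroup (GL (Fin n ⊕ Fin n) F) :=
  fixGroup (Jsp n F)


/-- The underlying matrix of an element of a matrix subgroup. -/
def matOf {S : Subgroup (GL N F)} (g : ↥S) : Matrix N N F := ((g : GL N F) : Matrix N N F)

end Groups

noncomputable instance subgroupFintype {G : Type*} [Group G] [Finite G] (S : Subgroup G) :
    Fintype S := Fintype.ofFinite _

namespace OrthSim

open Representation

section Basic

variable {G : Type} [Group G] {V : Type} [AddCommGroup V] [Module ℂ V] {ρ : Representation ℂ G V}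

/-- A bilinear form is invariant under a representation. -/
def InvForm (ρ : Representation ℂ G V) (B : LinearMap.BilinForm ℂ V) : Prop :=
  ∀ g v w, B (ρ g v) (ρ g w) = B v w

/-- No irreducible complex representation of `G` carries a nonzero invariant alternating form. -/
def NoAlt (G : Type) [Group G] : Prop :=
  ∀ (V : Type) [AddCommGroup V] [Module ℂ V] [FiniteDimensional ℂ V] (ρ : Representation ℂ G V),
    IsIrreducible ρ → ∀ B : LinearMap.BilinForm ℂ V, InvForm ρ B → B.IsAlt → B = 0

/-- Every element of `G` is conjugate to its inverse. -/
def AllReal (G : Type) [Group G] : Prop := ∀ g : G, ∃ h : G, h * g * h⁻¹ = g⁻¹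

theorem isIrreducible_mk [Nontrivial V]
    (h : ∀ U : Submodule ℂ V, (∀ g, ∀ u ∈ U, ρ g u ∈ U) → U = ⊥ ∨ U = ⊤) : IsIrreducible ρ where
  exists_pair_ne := ⟨⊥, ⊤, fun e => bot_ne_top (α := Submodule ℂ V)
    (congrArg Subrepresentation.toSubmodule e)⟩
  eq_bot_or_eq_top U := (h U.toSubmodule fun g _ hu => U.apply_mem_toSubmodule g hu).imp
    (fun e => Subrepresentation.toSubmodule_injective e)
    (fun e => Subrepresentation.toSubmodule_injective e)

theorem IsIrreducible.cases (h : IsIrreducible ρ) (U : Submodule ℂ V)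
    (hU : ∀ g, ∀ u ∈ U, ρ g u ∈ U) : U = ⊥ ∨ U = ⊤ :=
  (h.eq_bot_or_eq_top ⟨U, fun g _ hu => hU g _ hu⟩).imp
    (fun e => congrArg Subrepresentation.toSubmodule e)
    (fun e => congrArg Subrepresentation.toSubmodule e)

theorem IsIrreducible.nontrivial (h : IsIrreducible ρ) : Nontrivial V := by
  by_contra hV
  rw [not_nontrivial_iff_subsingleton] at hV
  obtain ⟨a, b, hab⟩ := h.exists_pair_ne
  exact hab (Subrepresentation.toSubmodule_injective (Subsingleton.elim _ _))

theorem IsIrreducible.schur [FiniteDimensional ℂ V] (h : IsIrreducible ρ) (T : V →ₗ[ℂ] V)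
    (hT : ∀ g v, T (ρ g v) = ρ g (T v)) : ∃ c : ℂ, ∀ v, T v = c • v := by
  have := IsIrreducible.nontrivial h
  obtain ⟨c, hc⟩ := Module.End.exists_eigenvalue T
  refine ⟨c, fun v => ?_⟩
  have := (IsIrreducible.cases h (Module.End.eigenspace T c) ?_).resolve_left hc
  · exact Module.End.mem_eigenspace_iff.1 (this ▸ Submodule.mem_top)
  · intro g u hu
    rw [Module.End.mem_eigenspace_iff] at hu ⊢
    rw [hT, hu, map_smul]

theorem IsIrreducible.injective {W : Type} [AddCommGroup W] [Module ℂ W]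
    {σ : Representation ℂ G W} (h : IsIrreducible ρ) (T : V →ₗ[ℂ] W)
    (hT : ∀ g v, T (ρ g v) = σ g (T v)) (h0 : T ≠ 0) : Function.Injective T := by
  rw [← LinearMap.ker_eq_bot]
  refine (IsIrreducible.cases h T.ker fun g u hu => ?_).resolve_right
    fun e => h0 (LinearMap.ker_eq_top.1 e)
  rw [LinearMap.mem_ker] at hu ⊢
  rw [hT, hu, map_zero]

@[simp] theorem Subrepresentation.coe_toRepresentation (U : Subrepresentation ρ) (g : G)
    (u : U.toSubmodule) : (U.toRepresentation g u : V) = ρ g u := rfl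

theorem exists_irreducible_le [FiniteDimensional ℂ V] (U : Subrepresentation ρ)
    (hU : U.toSubmodule ≠ ⊥) : ∃ W : Subrepresentation ρ, W.toSubmodule ≤ U.toSubmodule ∧
      IsIrreducible W.toRepresentation ∧ W.toSubmodule ≠ ⊥ := by
  obtain ⟨W, ⟨hWU, hW⟩, hmin⟩ := WellFounded.has_min
    (InvImage.wf (fun W : Subrepresentation ρ => Module.finrank ℂ W.toSubmodule) wellFounded_lt)
    {W | W.toSubmodule ≤ U.toSubmodule ∧ W.toSubmodule ≠ ⊥} ⟨U, le_rfl, hU⟩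
  refine ⟨W, hWU, ?_, hW⟩
  have : Nontrivial W.toSubmodule := Submodule.nontrivial_iff_ne_bot.2 hW
  refine isIrreducible_mk fun X hX => ?_
  by_contra! hne
  let Y : Subrepresentation ρ := ⟨X.map W.toSubmodule.subtype, by
    rintro g _ ⟨u, hu, rfl⟩
    exact ⟨_, hX g u hu, rfl⟩⟩
  refine hmin Y ⟨le_trans (Submodule.map_subtype_le _ _) hWU, fun e => hne.1 ?_⟩ ?_
  · refine (Submodule.eq_bot_iff _).2 fun x hx => Subtype.ext ?_
    exact (Submodule.mem_bot ℂ).1 (e ▸ Submodule.mem_map_of_mem hx : (x : V) ∈ (⊥ : Submodule ℂ V))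
  · change Module.finrank ℂ (X.map W.toSubmodule.subtype) < Module.finrank ℂ W.toSubmodule
    rw [Submodule.finrank_map_subtype_eq]
    exact Submodule.finrank_lt hne.2

theorem InvForm.apply_left {B : LinearMap.BilinForm ℂ V} (hB : InvForm ρ B) (g : G) (v w : V) :
    B (ρ g v) w = B v (ρ g⁻¹ w) := by
  rw [← hB g v, Representation.self_inv_apply]

theorem InvForm.apply_right {B : LinearMap.BilinForm ℂ V} (hB : InvForm ρ B) (g : G) (v w : V) :
    B v (ρ g w) = B (ρ g⁻¹ v) w := by
  rw [hB.apply_left, inv_inv]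

theorem InvForm.flip {B : LinearMap.BilinForm ℂ V} (hB : InvForm ρ B) : InvForm ρ B.flip :=
  fun g v w => hB g w v

theorem InvForm.restrict {B : LinearMap.BilinForm ℂ V} (hB : InvForm ρ B)
    (U : Subrepresentation ρ) : InvForm U.toRepresentation (B.restrict U.toSubmodule) :=
  fun g v w => hB g v w

theorem InvForm.eq_zero_of_left (h : IsIrreducible ρ) {B : LinearMap.BilinForm ℂ V}
    (hB : InvForm ρ B) (h0 : B ≠ 0) {v : V} (hv : ∀ w, B v w = 0) : v = 0 := by
  have := (IsIrreducible.cases h (LinearMap.ker B) ?_).resolve_right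
    fun e => h0 (LinearMap.ker_eq_top.1 e)
  · have hv' : v ∈ LinearMap.ker B := by
      rw [LinearMap.mem_ker]; ext w; exact hv w
    rwa [this, Submodule.mem_bot] at hv'
  · intro g u hu
    rw [LinearMap.mem_ker] at hu ⊢
    ext w
    rw [hB.apply_left, hu]; rfl

theorem InvForm.eq_zero_of_right (h : IsIrreducible ρ) {B : LinearMap.BilinForm ℂ V}
    (hB : InvForm ρ B) (h0 : B ≠ 0) {v : V} (hv : ∀ w, B w v = 0) : v = 0 := by
  refine hB.flip.eq_zero_of_left h (fun e => h0 ?_) hv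
  ext v w
  exact LinearMap.congr_fun₂ e w v

/-- A nonzero invariant form on an irreducible representation represents every functional. -/
theorem InvForm.exists_repr [FiniteDimensional ℂ V] (h : IsIrreducible ρ)
    {B : LinearMap.BilinForm ℂ V} (hB : InvForm ρ B) (h0 : B ≠ 0) :
    Function.Bijective B := by
  have hinj : Function.Injective B := by
    rw [← LinearMap.ker_eq_bot, LinearMap.ker_eq_bot']
    exact fun v hv => hB.eq_zero_of_left h h0 fun w => by rw [hv]; rfl
  exact ⟨hinj, (LinearMap.injective_iff_surjective_of_finrank_eq_finrank
    (Subspace.dual_finrank_eq).symm).1 hinj⟩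

theorem InvForm.eq_smul [FiniteDimensional ℂ V] (h : IsIrreducible ρ)
    {Q : LinearMap.BilinForm ℂ V} (hQ : InvForm ρ Q) (h0 : Q ≠ 0) {B : LinearMap.BilinForm ℂ V}
    (hB : InvForm ρ B) : ∃ c : ℂ, ∀ v w, B v w = c * Q v w := by
  let e := LinearEquiv.ofBijective Q (hQ.exists_repr h h0)
  have he : ∀ v w, Q (e.symm (B v)) w = B v w := fun v w =>
    LinearMap.congr_fun (e.apply_symm_apply (B v)) w
  obtain ⟨c, hc⟩ := IsIrreducible.schur h (e.symm.toLinearMap ∘ₗ B) fun g v => by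
    apply e.injective
    change e (e.symm (B (ρ g v))) = Q (ρ g (e.symm (B v)))
    rw [LinearEquiv.apply_symm_apply]
    ext w
    rw [hQ.apply_left, he, hB.apply_left]
  refine ⟨c, fun v w => ?_⟩
  rw [← he, show e.symm (B v) = c • v from hc v, map_smul]
  rfl

end Basic

section Average

variable {G : Type} [Group G] {V : Type} [AddCommGroup V] [Module ℂ V]
  (ρ : Representation ℂ G V)

theorem avg_form_apply [Fintype G] (β : LinearMap.BilinForm ℂ V) (v w : V) :
    (∑ g : G, β.compl₁₂ (ρ g) (ρ g)) v w = ∑ g : G, β (ρ g v) (ρ g w) := by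
  simp [LinearMap.sum_apply]

theorem avg_form_inv [Fintype G] (β : LinearMap.BilinForm ℂ V) :
    InvForm ρ (∑ g : G, β.compl₁₂ (ρ g) (ρ g)) := by
  intro h v w
  rw [avg_form_apply, avg_form_apply]
  refine Fintype.sum_equiv (Equiv.mulRight h) _ _ fun g => ?_
  simp [map_mul]

theorem trace_eq_sum_coord {ι : Type} [Fintype ι] (b : Module.Basis ι ℂ V) (T : V →ₗ[ℂ] V) :
    LinearMap.trace ℂ V T = ∑ i, b.coord i (T (b i)) := by
  rw [LinearMap.trace_eq_matrix_trace ℂ b, Matrix.trace]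
  simp [LinearMap.toMatrix_apply]

/-- The form `v, w ↦ vᵢ wⱼ` in coordinates. -/
def coordForm {ι : Type} (b : Module.Basis ι ℂ V) (i j : ι) : LinearMap.BilinForm ℂ V :=
  (LinearMap.mul ℂ ℂ).compl₁₂ (b.coord i) (b.coord j)

@[simp] theorem coordForm_apply {ι : Type} (b : Module.Basis ι ℂ V) (i j : ι) (v w : V) :
    coordForm b i j v w = b.coord i v * b.coord j w := rfl

variable [FiniteDimensional ℂ V]

theorem exists_inv_form [Fintype G] (h : ∑ g, ρ.character g * ρ.character g ≠ 0) :
    ∃ Q : LinearMap.BilinForm ℂ V, InvForm ρ Q ∧ Q ≠ 0 := by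
  by_contra! hQ
  apply h
  let b := Module.finBasis ℂ V
  have key : ∀ i j, ∑ g, b.coord i (ρ g (b i)) * b.coord j (ρ g (b j)) = 0 := fun i j => by
    have := avg_form_apply ρ (coordForm b i j) (b i) (b j)
    rw [hQ _ (avg_form_inv ρ _)] at this
    exact this.symm
  simp_rw [Representation.character, trace_eq_sum_coord b, Finset.sum_mul_sum]
  rw [Finset.sum_comm]
  refine Finset.sum_eq_zero fun i _ => ?_
  rw [Finset.sum_comm]
  exact Finset.sum_eq_zero fun j _ => key i j

theorem sum_char_sq [Fintype G] (h : ∀ B : LinearMap.BilinForm ℂ V, InvForm ρ B → B.IsAlt → B = 0) :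
    ∑ g, ρ.character (g * g) = ∑ g, ρ.character g * ρ.character g := by
  let b := Module.finBasis ℂ V
  have key : ∀ i j, ∑ g, (b.coord i (ρ g (b i)) * b.coord j (ρ g (b j)) -
      b.coord j (ρ g (b i)) * b.coord i (ρ g (b j))) = 0 := fun i j => by
    have := avg_form_apply ρ (coordForm b i j - coordForm b j i) (b i) (b j)
    rw [h _ (avg_form_inv ρ _)] at this
    · simpa using this.symm
    · intro v
      rw [avg_form_apply]
      exact Finset.sum_eq_zero fun g _ => by simp [mul_comm]
  have hsq : ∀ g, ρ.character (g * g) =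
      ∑ i, ∑ j, b.coord j (ρ g (b i)) * b.coord i (ρ g (b j)) := fun g => by
    rw [Representation.character, map_mul, LinearMap.trace_eq_matrix_trace ℂ b,
      LinearMap.toMatrix_mul, Matrix.trace]
    simp [Matrix.mul_apply, LinearMap.toMatrix_apply, mul_comm]
  have hmul : ∀ g, ρ.character g * ρ.character g =
      ∑ i, ∑ j, b.coord i (ρ g (b i)) * b.coord j (ρ g (b j)) := fun g => by
    rw [Representation.character, trace_eq_sum_coord b, Finset.sum_mul_sum]
  rw [eq_comm, ← sub_eq_zero, ← Finset.sum_sub_distrib]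
  simp_rw [hsq, hmul, ← Finset.sum_sub_distrib]
  rw [Finset.sum_comm]
  refine Finset.sum_eq_zero fun i _ => ?_
  rw [Finset.sum_comm]
  exact Finset.sum_eq_zero fun j _ => key i j

variable {ρ}

theorem IsIrreducible.sum_char_mul_char_inv [Fintype G] (h : IsIrreducible ρ) :
    ∑ g, ρ.character g * ρ.character g⁻¹ = Nat.card G := by
  have hc : (Nat.card G : ℂ) ≠ 0 := Nat.cast_ne_zero.2 Nat.card_pos.ne'
  have := invertibleOfNonzero hc
  have := Representation.char_orthonormal ρ ρ
  rw [if_pos ⟨Representation.Equiv.refl ρ⟩, inv_mul_eq_iff_eq_mul₀ hc, mul_one] at this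
  exact this

theorem IsIrreducible.exists_inv_form [Finite G] (h : IsIrreducible ρ)
    (hr : ∀ g, ρ.character g⁻¹ = ρ.character g) :
    ∃ Q : LinearMap.BilinForm ℂ V, InvForm ρ Q ∧ Q ≠ 0 := by
  have := Fintype.ofFinite G
  apply OrthSim.exists_inv_form
  have := IsIrreducible.sum_char_mul_char_inv h
  simp_rw [hr] at this
  rw [this]
  exact Nat.cast_ne_zero.2 Nat.card_pos.ne'

theorem AllReal.exists_inv_form [Finite G] (hG : AllReal G) (h : IsIrreducible ρ) :
    ∃ Q : LinearMap.BilinForm ℂ V, InvForm ρ Q ∧ Q ≠ 0 :=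
  IsIrreducible.exists_inv_form h fun g => by
    obtain ⟨k, hk⟩ := hG g
    rw [← hk, Representation.char_conj]

end Average

section IndexTwo

variable {N H : Type} [Group N] [Group H] {V : Type} [AddCommGroup V] [Module ℂ V]

theorem conj_mem_range_of_index_two {f : N →* H} {k : H}
    (hk : ∀ g, g ∈ f.range ∨ k⁻¹ * g ∈ f.range) {r : H} (hr : r ∈ f.range) :
    k⁻¹ * r * k ∈ f.range := by
  by_cases hkR : k ∈ f.range
  · exact mul_mem (mul_mem (inv_mem hkR) hr) hkR
  have hk2 : k * k ∈ f.range := (hk (k * k)).resolve_right (by simpa using hkR)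
  refine (hk (k⁻¹ * r * k)).resolve_right fun h => hkR ?_
  have h1 := mul_mem (inv_mem hr) (mul_mem hk2 h)
  have h2 : r⁻¹ * (k * k * (k⁻¹ * (k⁻¹ * r * k))) = k := by group
  rwa [h2] at h1

theorem sq_mem_range_of_index_two {f : N →* H} {k : H}
    (hk : ∀ g, g ∈ f.range ∨ k⁻¹ * g ∈ f.range) : k * k ∈ f.range := by
  rcases hk (k * k) with h | h
  · exact h
  · have : k ∈ f.range := by simpa using h
    exact mul_mem this this

/-- Clifford theory for a subgroup of index at most two: an irreducible representation with a
nonzero invariant alternating form restricts to a representation having an irreducible constituent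
which either carries such a form or carries no nonzero invariant form at all. -/
theorem isAlt_eq_zero_of_index_two [FiniteDimensional ℂ V] (f : N →* H) (k : H)
    (hk : ∀ g, g ∈ f.range ∨ k⁻¹ * g ∈ f.range) (ρ : Representation ℂ H V)
    (hρ : IsIrreducible ρ) (B : LinearMap.BilinForm ℂ V) (hB : InvForm ρ B) (hBalt : B.IsAlt)
    (h : ∀ W : Subrepresentation (ρ.comp f : Representation ℂ N V),
      IsIrreducible W.toRepresentation →
      (∀ B', InvForm W.toRepresentation B' → B'.IsAlt → B' = 0) ∧
      ∃ Q, InvForm W.toRepresentation Q ∧ Q ≠ 0) : B = 0 := by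
  by_contra hB0
  have := IsIrreducible.nontrivial hρ
  obtain ⟨W, -, hW, hW0⟩ := exists_irreducible_le (ρ := (ρ.comp f : Representation ℂ N V))
    ⟨⊤, fun _ _ _ => Submodule.mem_top⟩ (by simp)
  obtain ⟨hWalt, Q, hQ, hQ0⟩ := h W hW
  have hBW : ∀ w ∈ W.toSubmodule, ∀ w' ∈ W.toSubmodule, B w w' = 0 := fun w hw w' hw' =>
    LinearMap.congr_fun₂ (hWalt (B.restrict W.toSubmodule) (fun n v v' => hB (f n) v v')
      fun v => hBalt v) ⟨w, hw⟩ ⟨w', hw'⟩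
  have hNW : ∀ r ∈ f.range, ∀ w ∈ W.toSubmodule, ρ r w ∈ W.toSubmodule := by
    rintro _ ⟨n, rfl⟩ w hw
    exact W.apply_mem_toSubmodule n hw
  set U : Submodule ℂ V := W.toSubmodule.map (ρ k) with hU
  have hNU : ∀ r ∈ f.range, ∀ u ∈ U, ρ r u ∈ U := by
    rintro r hr _ ⟨w, hw, rfl⟩
    refine ⟨ρ (k⁻¹ * r * k) w, hNW _ (conj_mem_range_of_index_two hk hr) w hw, ?_⟩
    simp only [← Module.End.mul_apply, ← map_mul]
    congr 2; group
  have hkU : ∀ u ∈ U, ρ k u ∈ W.toSubmodule := by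
    rintro _ ⟨w, hw, rfl⟩
    have := hNW _ (sq_mem_range_of_index_two hk) w hw
    rwa [map_mul, Module.End.mul_apply] at this
  have hkU' : ∀ u ∈ U, ρ k⁻¹ u ∈ W.toSubmodule := by
    rintro _ ⟨w, hw, rfl⟩
    rwa [Representation.inv_self_apply]
  have hkW' : ∀ w ∈ W.toSubmodule, ρ k⁻¹ w ∈ U := by
    intro w hw
    refine ⟨ρ (k * k)⁻¹ w, hNW _ (inv_mem (sq_mem_range_of_index_two hk)) w hw, ?_⟩
    simp only [← Module.End.mul_apply, ← map_mul]
    congr 2; group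
  have hBU : ∀ u ∈ U, ∀ u' ∈ U, B u u' = 0 := by
    rintro _ ⟨w, hw, rfl⟩ _ ⟨w', hw', rfl⟩
    rw [hB]; exact hBW w hw w' hw'
  have hsup : W.toSubmodule ⊔ U = ⊤ := by
    refine (IsIrreducible.cases hρ _ fun g v hv => ?_).resolve_left
      fun e => hW0 (le_bot_iff.1 (e ▸ le_sup_left))
    have hR : ∀ r ∈ f.range, ∀ v ∈ W.toSubmodule ⊔ U, ρ r v ∈ W.toSubmodule ⊔ U := by
      intro r hr v hv
      obtain ⟨w, hw, u, hu, rfl⟩ := Submodule.mem_sup.1 hv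
      rw [map_add]
      exact Submodule.add_mem_sup (hNW r hr w hw) (hNU r hr u hu)
    rcases hk g with hg | hg
    · exact hR g hg v hv
    · have h1 := hR _ hg v hv
      obtain ⟨w, hw, u, hu, h2⟩ := Submodule.mem_sup.1 h1
      have h3 : ρ g v = ρ k (ρ (k⁻¹ * g) v) := by
        rw [← Module.End.mul_apply, ← map_mul, mul_inv_cancel_left]
      rw [h3, ← h2, map_add, add_comm]
      exact Submodule.add_mem_sup (hkU u hu) ⟨w, hw, rfl⟩
  have hinf : W.toSubmodule ⊓ U = ⊥ := by
    have h1 := IsIrreducible.cases hW (U.comap W.toSubmodule.subtype)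
      fun n u hu => hNU _ ⟨n, rfl⟩ _ hu
    rcases h1 with h1 | h1
    · refine (Submodule.eq_bot_iff _).2 fun x hx => ?_
      have : (⟨x, hx.1⟩ : W.toSubmodule) ∈ U.comap W.toSubmodule.subtype := hx.2
      rw [h1, Submodule.mem_bot] at this
      exact congrArg Subtype.val this
    · exfalso
      have hWU : W.toSubmodule ≤ U := fun w hw => by
        have : (⟨w, hw⟩ : W.toSubmodule) ∈ U.comap W.toSubmodule.subtype := h1 ▸ Submodule.mem_top
        exact this
      rw [sup_eq_right.2 hWU] at hsup
      apply hB0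
      ext v v'
      exact hBU v (hsup ▸ Submodule.mem_top) v' (hsup ▸ Submodule.mem_top)
  have hdec : ∀ v, ∃ w ∈ W.toSubmodule, ∃ u ∈ U, w + u = v := fun v =>
    Submodule.mem_sup.1 (hsup ▸ Submodule.mem_top)
  have hpair : ∀ u ∈ U, (∀ w ∈ W.toSubmodule, B w u = 0) → u = 0 := by
    intro u hu hw
    refine hB.eq_zero_of_right hρ hB0 fun v => ?_
    obtain ⟨w, hw', u', hu', rfl⟩ := hdec v
    rw [map_add, LinearMap.add_apply, hw w hw', hBU u' hu' u hu, add_zero]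
  let P : W.toSubmodule →ₗ[ℂ] Module.Dual ℂ W.toSubmodule :=
    (B.flip.compl₁₂ ((ρ k).comp W.toSubmodule.subtype) W.toSubmodule.subtype)
  have hP : ∀ w'' w, P w'' w = B w (ρ k w'') := fun _ _ => rfl
  have hPinj : Function.Injective P := by
    rw [← LinearMap.ker_eq_bot, LinearMap.ker_eq_bot']
    intro w'' h0
    have h1 := hpair (ρ k w'') ⟨w'', w''.2, rfl⟩ fun w hw => by
      rw [← hP w'' ⟨w, hw⟩, h0]; rfl
    apply Subtype.ext
    rw [← Representation.inv_self_apply ρ k (w'' : V), h1, map_zero]; rfl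
  let e := LinearEquiv.ofBijective P ⟨hPinj,
    (LinearMap.injective_iff_surjective_of_finrank_eq_finrank
    (Subspace.dual_finrank_eq).symm).1 hPinj⟩
  let α : W.toSubmodule →ₗ[ℂ] V := (ρ k).comp (W.toSubmodule.subtype.comp
    (e.symm.toLinearMap ∘ₗ Q.flip))
  have hαU : ∀ w, α w ∈ U := fun w => ⟨_, Subtype.coe_prop _, rfl⟩
  have hα : ∀ w w' : W.toSubmodule, B w (α w') = Q w w' := fun w w' =>
    LinearMap.congr_fun (e.apply_symm_apply (Q.flip w')) w
  have hαeq : ∀ n w, α (W.toRepresentation n w) = ρ (f n) (α w) := by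
    intro n w
    rw [← sub_eq_zero]
    refine hpair _ (Submodule.sub_mem _ (hαU _) (hNU _ ⟨n, rfl⟩ _ (hαU _))) fun w' hw' => ?_
    have h1 := hα ⟨w', hw'⟩ (W.toRepresentation n w)
    have h2 := hα (W.toRepresentation n⁻¹ ⟨w', hw'⟩) w
    rw [hQ.apply_right] at h1
    rw [map_sub, hB.apply_right, sub_eq_zero, ← map_inv]
    exact h1.trans h2.symm
  have hcompl : IsCompl W.toSubmodule U := ⟨disjoint_iff.2 hinf, codisjoint_iff.2 hsup⟩
  let ν : V →ₗ[ℂ] V := α ∘ₗ LinearMap.fst ℂ _ _ ∘ₗ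
    (Submodule.prodEquivOfIsCompl _ _ hcompl).symm.toLinearMap
  have hνW : ∀ w : W.toSubmodule, ν w = α w := fun w => by
    simp [ν]
  have hνU : ∀ u ∈ U, ν u = 0 := fun u hu => by
    have := Submodule.prodEquivOfIsCompl_symm_apply_right _ _ hcompl ⟨u, hu⟩
    show α ((Submodule.prodEquivOfIsCompl _ _ hcompl).symm u).1 = 0
    rw [this]
    exact map_zero α
  have hνN : ∀ r ∈ f.range, ∀ v, ν (ρ r v) = ρ r (ν v) := by
    rintro _ ⟨n, rfl⟩ v
    obtain ⟨w, hw, u, hu, rfl⟩ := hdec v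
    rw [map_add, map_add, map_add, hνU u hu, hνU _ (hNU _ ⟨n, rfl⟩ u hu), add_zero, add_zero,
      hνW ⟨w, hw⟩, ← hαeq, ← hνW]
    rfl
  let φ : V →ₗ[ℂ] V := ν + ρ k ∘ₗ ν ∘ₗ ρ k⁻¹
  have hφ : ∀ v, φ v = ν v + ρ k (ν (ρ k⁻¹ v)) := fun _ => rfl
  have hmul : ∀ a b v, ρ a (ρ b v) = ρ (a * b) v := fun a b v => by
    rw [map_mul, Module.End.mul_apply]
  have hφN : ∀ r ∈ f.range, ∀ v, φ (ρ r v) = ρ r (φ v) := by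
    intro r hr v
    have h1 : ρ k⁻¹ (ρ r v) = ρ (k⁻¹ * r * k) (ρ k⁻¹ v) := by
      rw [hmul, hmul]; congr 2; group
    rw [hφ, hφ, hνN r hr, h1, hνN _ (conj_mem_range_of_index_two hk hr), map_add, hmul, hmul,
      show k * (k⁻¹ * r * k) = r * k by group]
  have hφk : ∀ v, φ (ρ k v) = ρ k (φ v) := by
    intro v
    have h1 : ρ k v = ρ (k * k) (ρ k⁻¹ v) := by
      rw [hmul]; congr 2; group
    rw [hφ, hφ, Representation.inv_self_apply, map_add, h1,
      hνN _ (sq_mem_range_of_index_two hk), hmul, add_comm]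
  obtain ⟨c, hc⟩ := IsIrreducible.schur hρ φ fun g v => by
    rcases hk g with hg | hg
    · exact hφN g hg v
    · have h1 : ∀ v, ρ g v = ρ k (ρ (k⁻¹ * g) v) := fun v => by
        rw [hmul, mul_inv_cancel_left]
      rw [h1, hφk, hφN _ hg, ← h1]
  have hα0 : ∀ w, α w = 0 := by
    intro w
    have h1 := hc w
    rw [hφ, hνU _ (hkW' w w.2), map_zero, add_zero, hνW] at h1
    have h2 : α w ∈ W.toSubmodule ⊓ U := ⟨h1 ▸ W.toSubmodule.smul_mem c w.2, hαU w⟩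
    rwa [hinf, Submodule.mem_bot] at h2
  apply hQ0
  ext w w'
  rw [← hα, hα0, map_zero]; rfl

theorem NoAlt.of_index_two [Finite N] (hN : NoAlt N) (hNr : AllReal N) (f : N →* H) (k : H)
    (hk : ∀ g, g ∈ f.range ∨ k⁻¹ * g ∈ f.range) : NoAlt H := fun _ _ _ _ ρ hρ B hB hBalt =>
  isAlt_eq_zero_of_index_two f k hk ρ hρ B hB hBalt fun _ hW =>
    ⟨fun B' h1 h2 => hN _ _ hW B' h1 h2, AllReal.exists_inv_form hNr hW⟩

end IndexTwo

section Product

variable {G₁ G₂ N : Type} [Group G₁] [Group G₂] [Group N]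

theorem NoAlt.of_product [Finite G₁] (h₁ : NoAlt G₁) (hr : AllReal G₁) (h₂ : NoAlt G₂)
    (i₁ : G₁ →* N) (i₂ : G₂ →* N) (hcomm : ∀ a b, i₁ a * i₂ b = i₂ b * i₁ a)
    (hsurj : ∀ n, ∃ a b, n = i₁ a * i₂ b) : NoAlt N := by
  intro V _ _ _ ρ hρ B hB hBalt
  have := IsIrreducible.nontrivial hρ
  have hcomm' : ∀ a b v, ρ (i₁ a) (ρ (i₂ b) v) = ρ (i₂ b) (ρ (i₁ a) v) := fun a b v => by
    rw [← Module.End.mul_apply, ← Module.End.mul_apply, ← map_mul, ← map_mul, hcomm]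
  obtain ⟨W, -, hW, hW0⟩ := exists_irreducible_le (ρ := (ρ.comp i₁ : Representation ℂ G₁ V))
    ⟨⊤, fun _ _ _ => Submodule.mem_top⟩ (by simp)
  obtain ⟨Q, hQ, hQ0⟩ := AllReal.exists_inv_form hr hW
  obtain ⟨w₀, hw₀⟩ : ∃ w, Q w w ≠ 0 := by
    by_contra! h
    exact hQ0 (h₁ _ _ hW Q hQ h)
  let τ : Representation ℂ G₂ (W.toSubmodule →ₗ[ℂ] V) :=
    { toFun b := LinearMap.compRight ℂ (ρ (i₂ b))
      map_one' := by ext; simp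
      map_mul' x y := by ext; simp }
  have hτ : ∀ b m w, τ b m w = ρ (i₂ b) (m w) := fun _ _ _ => rfl
  let M : Subrepresentation τ :=
    { toSubmodule :=
        { carrier := {m | ∀ a w, m (W.toRepresentation a w) = ρ (i₁ a) (m w)}
          add_mem' := fun hm hm' a w => by simp [hm a w, hm' a w]
          zero_mem' := fun a w => by simp
          smul_mem' := fun c m hm a w => by simp [hm a w] }
      apply_mem_toSubmodule := fun b m hm a w => by rw [hτ, hτ, hm a w, hcomm'] }
  have hM0 : M.toSubmodule ≠ ⊥ := by
    intro e
    have h1 : W.toSubmodule.subtype ∈ M.toSubmodule := fun a w => rfl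
    rw [e, Submodule.mem_bot] at h1
    exact hW0 ((Submodule.eq_bot_iff _).2 fun w hw => LinearMap.congr_fun h1 ⟨w, hw⟩)
  obtain ⟨M', hM'M, hM', hM'0⟩ := exists_irreducible_le M hM0
  let β : LinearMap.BilinForm ℂ M'.toSubmodule :=
    B.compl₁₂ (LinearMap.applyₗ w₀ ∘ₗ M'.toSubmodule.subtype)
      (LinearMap.applyₗ w₀ ∘ₗ M'.toSubmodule.subtype)
  have hβ : ∀ m m', β m m' = B (m.1 w₀) (m'.1 w₀) := fun _ _ => rfl
  have hβ0 : β = 0 := h₂ _ _ hM' β (fun b m m' => hB (i₂ b) _ _) fun m => hBalt _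
  have hzero : ∀ m ∈ M'.toSubmodule, ∀ m' ∈ M'.toSubmodule, ∀ w w', B (m w) (m' w') = 0 := by
    intro m hm m' hm' w w'
    obtain ⟨c, hc⟩ := hQ.eq_smul hW hQ0 (B := B.compl₁₂ m m') fun a v v' => by
      simp only [LinearMap.compl₁₂_apply]
      rw [hM'M hm a v, hM'M hm' a v', hB]
    have h1 := hc w₀ w₀
    rw [LinearMap.compl₁₂_apply, ← hβ ⟨m, hm⟩ ⟨m', hm'⟩, hβ0, LinearMap.zero_apply,
      LinearMap.zero_apply, eq_comm, mul_eq_zero, or_iff_left hw₀] at h1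
    rw [← LinearMap.compl₁₂_apply, hc, h1, zero_mul]
  have htop : Submodule.span ℂ {v | ∃ m ∈ M'.toSubmodule, ∃ w, m w = v} = ⊤ := by
    refine (IsIrreducible.cases hρ _ fun g v hv => ?_).resolve_left fun e => ?_
    · obtain ⟨a, b, rfl⟩ := hsurj g
      induction hv using Submodule.span_induction with
      | mem v hv =>
        obtain ⟨m, hm, w, rfl⟩ := hv
        refine Submodule.subset_span ⟨τ b m, M'.apply_mem_toSubmodule b hm,
          W.toRepresentation a w, ?_⟩
        rw [hτ, hM'M hm a w, map_mul, Module.End.mul_apply, hcomm']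
      | zero => simp
      | add x y _ _ hx hy => rw [map_add]; exact add_mem hx hy
      | smul c x _ hx => rw [map_smul]; exact Submodule.smul_mem _ _ hx
    · refine hM'0 ((Submodule.eq_bot_iff _).2 fun m hm => LinearMap.ext fun w => ?_)
      have : m w ∈ Submodule.span ℂ {v | ∃ m ∈ M'.toSubmodule, ∃ w, m w = v} :=
        Submodule.subset_span ⟨m, hm, w, rfl⟩
      rwa [e, Submodule.mem_bot] at this
  ext v v'
  rw [LinearMap.zero_apply, LinearMap.zero_apply]
  have hv : v ∈ Submodule.span ℂ {v | ∃ m ∈ M'.toSubmodule, ∃ w, m w = v} :=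
    htop ▸ Submodule.mem_top
  have hv' : v' ∈ Submodule.span ℂ {v | ∃ m ∈ M'.toSubmodule, ∃ w, m w = v} :=
    htop ▸ Submodule.mem_top
  induction hv, hv' using Submodule.span_induction₂ with
  | mem_mem x y hx hy =>
    obtain ⟨m, hm, w, rfl⟩ := hx
    obtain ⟨m', hm', w', rfl⟩ := hy
    exact hzero m hm m' hm' w w'
  | zero_left => simp
  | zero_right => simp
  | add_left _ _ _ _ _ _ h1 h2 => simp [h1, h2]
  | add_right _ _ _ _ _ _ h1 h2 => simp [h1, h2]
  | smul_left _ _ _ _ _ h => simp [h]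
  | smul_right _ _ _ _ _ h => simp [h]

theorem AllReal.of_product (h₁ : AllReal G₁) (h₂ : AllReal G₂)
    (i₁ : G₁ →* N) (i₂ : G₂ →* N) (hcomm : ∀ a b, i₁ a * i₂ b = i₂ b * i₁ a)
    (hsurj : ∀ n, ∃ a b, n = i₁ a * i₂ b) : AllReal N := by
  intro n
  obtain ⟨a, b, rfl⟩ := hsurj n
  obtain ⟨s, hs⟩ := h₁ a
  obtain ⟨t, ht⟩ := h₂ b
  refine ⟨i₁ s * i₂ t, ?_⟩
  calc i₁ s * i₂ t * (i₁ a * i₂ b) * (i₁ s * i₂ t)⁻¹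
      = i₁ s * (i₂ t * i₁ a) * i₂ b * (i₂ t)⁻¹ * (i₁ s)⁻¹ := by group
    _ = i₁ s * i₁ a * i₂ (t * b * t⁻¹) * i₁ s⁻¹ := by
      rw [← hcomm]; simp only [map_mul, map_inv]; group
    _ = i₁ (s * a * s⁻¹) * i₂ (t * b * t⁻¹) := by
      rw [mul_assoc, ← hcomm]; simp only [map_mul, map_inv]; group
    _ = (i₁ a * i₂ b)⁻¹ := by
      rw [hs, ht, hcomm, map_inv, map_inv, _root_.mul_inv_rev]

end Product

section Dihedral

variable {D : Type} [Group D] (K : Subgroup D) (h : D)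

theorem NoAlt.of_dihedral (hK : ∀ a ∈ K, ∀ b ∈ K, a * b = b * a) (hD : ∀ g, g ∈ K ∨ h⁻¹ * g ∈ K)
    (h2 : h * h = 1) (hinv : ∀ a ∈ K, h * a * h⁻¹ = a⁻¹) : NoAlt D := by
  intro V _ _ _ ρ hρ B hB hBalt
  have := IsIrreducible.nontrivial hρ
  have : IsMulCommutative K := ⟨⟨fun a b => Subtype.ext (hK a a.2 b b.2)⟩⟩
  obtain ⟨W, -, hW, hW0⟩ := exists_irreducible_le (ρ := (ρ.comp K.subtype : Representation ℂ K V))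
    ⟨⊤, fun _ _ _ => Submodule.mem_top⟩ (by simp)
  have hdim := Representation.IsIrreducible.finrank_eq_one_of_isMulCommutative W.toRepresentation
  obtain ⟨v, hv, hv0⟩ := Submodule.exists_mem_ne_zero_of_ne_bot hW0
  have hKv : ∀ a ∈ K, ∃ c : ℂ, ρ a v = c • v := by
    intro a ha
    obtain ⟨c, hc⟩ := (finrank_eq_one_iff_of_nonzero' (⟨v, hv⟩ : W.toSubmodule)
      (fun e => hv0 (congrArg Subtype.val e))).1 hdim (W.toRepresentation ⟨a, ha⟩ ⟨v, hv⟩)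
    exact ⟨c, (congrArg Subtype.val hc).symm⟩
  have hKh : ∀ a ∈ K, ∃ c : ℂ, ρ a (ρ h v) = c • ρ h v := by
    intro a ha
    obtain ⟨c, hc⟩ := hKv a⁻¹ (inv_mem ha)
    refine ⟨c, ?_⟩
    rw [← map_smul, ← hc, ← hinv a ha, ← Module.End.mul_apply, ← Module.End.mul_apply, ← map_mul,
      ← map_mul]
    congr 2
    rw [← mul_assoc, ← mul_assoc, h2, inv_eq_of_mul_eq_one_left h2, one_mul]
  have hhh : ρ h (ρ h v) = v := by
    rw [← Module.End.mul_apply, ← map_mul, h2, map_one]; rfl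
  have hBv : B v (ρ h v) = 0 := by
    have h1 := hB h v (ρ h v)
    rw [hhh, ← hBalt.neg_eq] at h1
    exact self_eq_neg.1 h1.symm
  have hBv' : B (ρ h v) v = 0 := by rw [← hBalt.neg_eq, hBv, neg_zero]
  have htop : Submodule.span ℂ {v, ρ h v} = ⊤ := by
    refine (IsIrreducible.cases hρ _ fun g u hu => ?_).resolve_left fun e => ?_
    · obtain ⟨x, y, rfl⟩ := Submodule.mem_span_pair.1 hu
      have hKspan : ∀ a ∈ K, ∀ x y : ℂ, ρ a (x • v + y • ρ h v) ∈ Submodule.span ℂ {v, ρ h v} := by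
        intro a ha x y
        obtain ⟨c, hc⟩ := hKv a ha
        obtain ⟨d, hd⟩ := hKh a ha
        refine Submodule.mem_span_pair.2 ⟨x * c, y * d, ?_⟩
        rw [map_add, map_smul, map_smul, hc, hd, smul_smul, smul_smul]
      rcases hD g with hg | hg
      · exact hKspan g hg x y
      · obtain ⟨x', y', h1⟩ := Submodule.mem_span_pair.1 (hKspan _ hg x y)
        refine Submodule.mem_span_pair.2 ⟨y', x', ?_⟩
        have h3 : ρ g (x • v + y • ρ h v) = ρ h (ρ (h⁻¹ * g) (x • v + y • ρ h v)) := by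
          rw [← Module.End.mul_apply, ← map_mul, mul_inv_cancel_left]
        rw [h3, ← h1, map_add, map_smul, map_smul, hhh, add_comm]
    · have : v ∈ Submodule.span ℂ {v, ρ h v} := Submodule.subset_span (by simp)
      rw [e, Submodule.mem_bot] at this
      exact hv0 this
  ext u u'
  obtain ⟨x, y, rfl⟩ := Submodule.mem_span_pair.1 (htop ▸ Submodule.mem_top :
    u ∈ Submodule.span ℂ {v, ρ h v})
  obtain ⟨x', y', rfl⟩ := Submodule.mem_span_pair.1 (htop ▸ Submodule.mem_top :
    u' ∈ Submodule.span ℂ {v, ρ h v})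
  simp [hBv, hBv', hBalt v, hBalt (ρ h v)]

theorem AllReal.of_dihedral (hD : ∀ g, g ∈ K ∨ h⁻¹ * g ∈ K)
    (h2 : h * h = 1) (hinv : ∀ a ∈ K, h * a * h⁻¹ = a⁻¹) : AllReal D := by
  intro g
  rcases hD g with hg | hg
  · exact ⟨h, hinv g hg⟩
  · refine ⟨1, ?_⟩
    have h1 := hinv _ hg
    rw [mul_inv_cancel_left, _root_.mul_inv_rev, inv_inv, inv_eq_of_mul_eq_one_left h2] at h1
    rw [one_mul, inv_one, mul_one]
    calc g = g * h * h := by rw [mul_assoc, h2, mul_one]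
      _ = g⁻¹ := by rw [h1, mul_assoc, h2, mul_one]

end Dihedral

section Lagrangian

variable {H : Type} [Group H] {V : Type} [AddCommGroup V] [Module ℂ V]
  [FiniteDimensional ℂ V]

theorem char_eq_add_of_isCompl {ρ : Representation ℂ H V} {L C : Subrepresentation ρ}
    (h : IsCompl L.toSubmodule C.toSubmodule) (g : H) :
    ρ.character g = L.toRepresentation.character g + C.toRepresentation.character g := by
  unfold Representation.character
  rw [← LinearMap.trace_prodMap', ← LinearMap.trace_conj' _ (Submodule.prodEquivOfIsCompl _ _ h)]
  congr 1
  ext v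
  obtain ⟨p, rfl⟩ := (Submodule.prodEquivOfIsCompl _ _ h).surjective v
  simp [LinearEquiv.conj_apply]

/-- If no irreducible representation of `H` carries a nonzero invariant alternating form, then a
representation with a nondegenerate invariant alternating form has an invariant Lagrangian. -/
theorem NoAlt.exists_half_char [Finite H] (hH : NoAlt H) (ρ : Representation ℂ H V)
    (B : LinearMap.BilinForm ℂ V) (hB : InvForm ρ B) (hBalt : B.IsAlt)
    (hnd : ∀ v, (∀ w, B w v = 0) → v = 0) :
    ∃ L : Subrepresentation ρ, ∀ g, ρ.character g =
      L.toRepresentation.character g + L.toRepresentation.character g⁻¹ := by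
  have : NeZero (Nat.card H : ℂ) := ⟨Nat.cast_ne_zero.2 Nat.card_pos.ne'⟩
  let S : Set (Subrepresentation ρ) := {L | ∀ u ∈ L.toSubmodule, ∀ v ∈ L.toSubmodule, B u v = 0}
  obtain ⟨L, hL, hmax⟩ : ∃ L ∈ S, ∀ L' ∈ S,
      Module.finrank ℂ L'.toSubmodule ≤ Module.finrank ℂ L.toSubmodule := by
    let f : Subrepresentation ρ → ℕ := fun L => Module.finrank ℂ L.toSubmodule
    have hfin : (f '' S).Finite := (Set.finite_le_nat (Module.finrank ℂ V)).subset (by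
      rintro _ ⟨L, -, rfl⟩
      exact Submodule.finrank_le _)
    have hne : (f '' S).Nonempty := ⟨_, ⊥, fun u hu v hv => by
      rw [(Submodule.mem_bot ℂ).1 hu, map_zero]; rfl, rfl⟩
    obtain ⟨_, ⟨L, hL, rfl⟩, h⟩ := Set.exists_max_image (f '' S) id hfin hne
    exact ⟨L, hL, fun L' hL' => h _ ⟨L', hL', rfl⟩⟩
  obtain ⟨C, hC⟩ := exists_isCompl L
  have hinf : L.toSubmodule ⊓ C.toSubmodule = ⊥ :=
    congrArg Subrepresentation.toSubmodule hC.inf_eq_bot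
  have hsup : L.toSubmodule ⊔ C.toSubmodule = ⊤ :=
    congrArg Subrepresentation.toSubmodule hC.sup_eq_top
  let P : Subrepresentation ρ :=
    { toSubmodule :=
        { carrier := {v | ∀ u ∈ L.toSubmodule, B u v = 0}
          add_mem' := fun hm hm' u hu => by simp [hm u hu, hm' u hu]
          zero_mem' := fun a w => by simp
          smul_mem' := fun c m hm u hu => by simp [hm u hu] }
      apply_mem_toSubmodule := fun g v hv u hu => by
        rw [hB.apply_right]
        exact hv _ (L.apply_mem_toSubmodule _ hu) }
  have hCP : C.toSubmodule ⊓ P.toSubmodule = ⊥ := by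
    by_contra hne
    obtain ⟨W, hWle, hW, hW0⟩ := exists_irreducible_le (C ⊓ P) hne
    have hWC : W.toSubmodule ≤ C.toSubmodule := fun w hw => (hWle hw).1
    have hWP : W.toSubmodule ≤ P.toSubmodule := fun w hw => (hWle hw).2
    have hBW : ∀ w ∈ W.toSubmodule, ∀ w' ∈ W.toSubmodule, B w w' = 0 := fun w hw w' hw' =>
      LinearMap.congr_fun₂ (hH _ _ hW (B.restrict W.toSubmodule) (hB.restrict W)
        fun v => hBalt v) ⟨w, hw⟩ ⟨w', hw'⟩
    have hLW := hmax (L ⊔ W) fun u hu v hv => by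
      obtain ⟨l, hl, w, hw, rfl⟩ := Submodule.mem_sup.1 hu
      obtain ⟨l', hl', w', hw', rfl⟩ := Submodule.mem_sup.1 hv
      have h1 : B w l' = 0 := by rw [← hBalt.neg_eq, hWP hw l' hl', neg_zero]
      simp [hL l hl l' hl', hWP hw' l hl, hBW w hw w' hw', h1]
    have h2 := Submodule.finrank_sup_add_finrank_inf_eq L.toSubmodule W.toSubmodule
    have h3 : L.toSubmodule ⊓ W.toSubmodule = ⊥ :=
      le_bot_iff.1 (hinf ▸ inf_le_inf_left _ hWC)
    rw [h3, finrank_bot, add_zero] at h2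
    have h4 : 0 < Module.finrank ℂ W.toSubmodule := by
      rw [Module.finrank_pos_iff, Submodule.nontrivial_iff_ne_bot]; exact hW0
    rw [Subrepresentation.toSubmodule_sup] at hLW
    omega
  have hdec : ∀ v, ∃ w ∈ L.toSubmodule, ∃ u ∈ C.toSubmodule, w + u = v := fun v =>
    Submodule.mem_sup.1 (hsup ▸ Submodule.mem_top)
  let Φ : C.toSubmodule →ₗ[ℂ] Module.Dual ℂ L.toSubmodule :=
    B.compl₁₂ C.toSubmodule.subtype L.toSubmodule.subtype
  have hΦ : Function.Injective Φ := by
    rw [← LinearMap.ker_eq_bot, LinearMap.ker_eq_bot']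
    intro c hc
    have h1 : (c : V) ∈ C.toSubmodule ⊓ P.toSubmodule := ⟨c.2, fun l hl => by
      rw [← hBalt.neg_eq]
      have := LinearMap.congr_fun hc ⟨l, hl⟩
      exact neg_eq_zero.2 this⟩
    rw [hCP, Submodule.mem_bot] at h1
    exact Subtype.ext h1
  have hΦ' : Function.Injective Φ.flip := by
    rw [← LinearMap.ker_eq_bot, LinearMap.ker_eq_bot']
    intro l hl
    refine Subtype.ext (hnd l fun v => ?_)
    obtain ⟨l', hl', c, hc, rfl⟩ := hdec v
    have := LinearMap.congr_fun hl ⟨c, hc⟩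
    rw [map_add, LinearMap.add_apply, hL l' hl' l l.2, zero_add]
    exact this
  have hdim : Module.finrank ℂ C.toSubmodule =
      Module.finrank ℂ (Module.Dual ℂ L.toSubmodule) := by
    have h1 := LinearMap.finrank_le_finrank_of_injective hΦ
    have h2 := LinearMap.finrank_le_finrank_of_injective hΦ'
    rw [Subspace.dual_finrank_eq] at h1 h2 ⊢
    omega
  let e := LinearEquiv.ofBijective Φ
    ⟨hΦ, (LinearMap.injective_iff_surjective_of_finrank_eq_finrank hdim).1 hΦ⟩
  refine ⟨L, fun g => ?_⟩
  rw [char_eq_add_of_isCompl ⟨disjoint_iff.2 hinf, codisjoint_iff.2 hsup⟩ g]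
  congr 1
  rw [← Representation.char_dual]
  unfold Representation.character
  rw [← LinearMap.trace_conj' _ e]
  congr 1
  ext f l
  obtain ⟨c, rfl⟩ := e.surjective f
  rw [LinearEquiv.conj_apply_apply, LinearEquiv.symm_apply_apply]
  exact hB.apply_left g c l

end Lagrangian

section Integrality

/-- Complex numbers that become algebraic integers after multiplication by an odd integer. -/
def TwoIntegral (z : ℂ) : Prop := ∃ k : ℕ, Odd k ∧ IsIntegral ℤ ((k : ℂ) * z)

theorem IsIntegral.twoIntegral {z : ℂ} (h : IsIntegral ℤ z) : TwoIntegral z :=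
  ⟨1, odd_one, by simpa using h⟩

theorem isIntegral_natCast (k : ℕ) : IsIntegral ℤ (k : ℂ) := by
  simpa using (isIntegral_algebraMap : IsIntegral ℤ (algebraMap ℤ ℂ k))

theorem TwoIntegral.add {z w : ℂ} (hz : TwoIntegral z) (hw : TwoIntegral w) :
    TwoIntegral (z + w) := by
  obtain ⟨k, hk, hkz⟩ := hz
  obtain ⟨l, hl, hlw⟩ := hw
  refine ⟨k * l, hk.mul hl, ?_⟩
  have := ((isIntegral_natCast l).mul hkz).add ((isIntegral_natCast k).mul hlw)
  have e : ((k * l : ℕ) : ℂ) * (z + w) = l * (k * z) + k * (l * w) := by push_cast; ring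
  rwa [e]

theorem TwoIntegral.div_odd {z : ℂ} (hz : TwoIntegral z) {r : ℕ} (hr : Odd r) :
    TwoIntegral (z / r) := by
  obtain ⟨k, hk, hkz⟩ := hz
  refine ⟨k * r, hk.mul hr, ?_⟩
  have : (r : ℂ) ≠ 0 := Nat.cast_ne_zero.2 hr.pos.ne'
  convert hkz using 1
  push_cast; field_simp

theorem TwoIntegral.sum {ι : Type} (s : Finset ι) (f : ι → ℂ) (h : ∀ i ∈ s, TwoIntegral (f i)) :
    TwoIntegral (∑ i ∈ s, f i) := by
  induction s using Finset.induction_on with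
  | empty => exact IsIntegral.twoIntegral (by simpa using isIntegral_zero)
  | insert a s ha ih =>
    rw [Finset.sum_insert ha]
    exact (h a (by simp)).add (ih fun i hi => h i (by simp [hi]))

theorem not_twoIntegral_half : ¬ TwoIntegral (1 / 2) := by
  rintro ⟨k, hk, h⟩
  have h1 : IsIntegral ℤ ((k : ℚ) * (1 / 2)) := by
    rw [← isIntegral_algebraMap_iff (algebraMap ℚ ℂ).injective]
    simpa using h
  obtain ⟨m, hm⟩ := IsIntegrallyClosed.isIntegral_iff.1 h1
  rw [algebraMap_int_eq, eq_intCast] at hm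
  have h2 : (2 * m : ℤ) = k := by
    have : (2 * m : ℚ) = k := by rw [hm]; ring
    exact_mod_cast this
  obtain ⟨j, rfl⟩ := hk
  push_cast at h2
  omega

variable {V : Type} [AddCommGroup V] [Module ℂ V] [FiniteDimensional ℂ V]

theorem isIntegral_trace_of_pow_eq {f : V →ₗ[ℂ] V} {k : ℕ} (hk : 0 < k) (h : f ^ (k + 1) = f) :
    IsIntegral ℤ (LinearMap.trace ℂ V f) := by
  rw [Module.End.trace_eq_sum_roots_charpoly_of_splits (IsAlgClosed.splits _)]
  refine IsIntegral.multiset_sum fun c hc => ?_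
  have hc' : Module.End.HasEigenvalue f c := by
    rw [Module.End.hasEigenvalue_iff_isRoot_charpoly]
    exact (Polynomial.mem_roots'.1 hc).2
  obtain ⟨v, hv⟩ := hc'.exists_hasEigenvector
  have h1 := hv.pow_apply (k + 1)
  rw [h, hv.apply_eq_smul, ← sub_eq_zero, ← sub_smul, smul_eq_zero, or_iff_left hv.2,
    sub_eq_zero] at h1
  refine ⟨Polynomial.X ^ (k + 1) - Polynomial.X, ?_, by simp [← h1]⟩
  apply Polynomial.monic_X_pow_sub
  rw [Polynomial.degree_X]
  exact_mod_cast Nat.succ_lt_succ hk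

end Integrality

section CharLike

variable {Γ : Type} [Group Γ]

/-- `f` is the character of a finite-dimensional representation. -/
def CharLike (f : Γ → ℂ) : Prop :=
  ∃ (V : Type) (_ : AddCommGroup V) (_ : Module ℂ V) (_ : FiniteDimensional ℂ V)
    (ρ : Representation ℂ Γ V), f = ρ.character

theorem CharLike.character {V : Type} [AddCommGroup V] [Module ℂ V] [FiniteDimensional ℂ V]
    (ρ : Representation ℂ Γ V) : CharLike ρ.character := ⟨V, _, _, ‹_›, ρ, rfl⟩

theorem CharLike.mul {f f' : Γ → ℂ} (h : CharLike f) (h' : CharLike f') : CharLike (f * f') := by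
  obtain ⟨V, _, _, _, ρ, rfl⟩ := h
  obtain ⟨V', _, _, _, ρ', rfl⟩ := h'
  rw [← Representation.char_tensor]
  exact .character _

theorem CharLike.inv {f : Γ → ℂ} (h : CharLike f) : CharLike fun g => f g⁻¹ := by
  obtain ⟨V, _, _, _, ρ, rfl⟩ := h
  simp_rw [← Representation.char_dual]
  exact .character ρ.dual

theorem CharLike.one : CharLike (1 : Γ → ℂ) := by
  convert CharLike.character (Representation.trivial ℂ Γ ℂ)
  ext g
  simp [Representation.character, Representation.trivial]

theorem CharLike.pow {f : Γ → ℂ} (h : CharLike f) (n : ℕ) : CharLike (f ^ n) := by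
  induction n with
  | zero => simpa using CharLike.one
  | succ n ih => rw [pow_succ]; exact ih.mul h

theorem CharLike.comp {Δ : Type} [Group Δ] {f : Γ → ℂ} (h : CharLike f) (φ : Δ →* Γ) :
    CharLike fun d => f (φ d) := by
  obtain ⟨V, _, _, _, ρ, rfl⟩ := h
  exact .character (ρ.comp φ : Representation ℂ Δ V)

theorem CharLike.fixedPoints (X : Type) [Finite X] [MulAction Γ X] :
    CharLike fun g : Γ => (Nat.card {x : X // g • x = x} : ℂ) := by
  have := Fintype.ofFinite X
  let σ : Representation ℂ Γ (X → ℂ) :=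
    { toFun g := LinearMap.funLeft ℂ ℂ (g⁻¹ • · : X → X)
      map_one' := by ext; simp [LinearMap.funLeft]
      map_mul' g h := by ext; simp [LinearMap.funLeft, mul_smul] }
  convert CharLike.character σ using 1
  ext g
  rw [Representation.character, trace_eq_sum_coord (Pi.basisFun ℂ X)]
  have : ∀ x, (Pi.basisFun ℂ X).coord x (σ g (Pi.basisFun ℂ X x)) = if g • x = x then 1 else 0 := by
    intro x
    have h1 : g⁻¹ • x = x ↔ g • x = x := by rw [inv_smul_eq_iff, eq_comm]
    simp [σ, LinearMap.funLeft, Pi.single_apply, h1]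
  rw [Finset.sum_congr rfl fun x _ => this x, Finset.sum_boole, Nat.card_eq_fintype_card,
    Fintype.card_subtype]

theorem CharLike.isIntegral [Finite Γ] {f : Γ → ℂ} (h : CharLike f) (g : Γ) :
    IsIntegral ℤ (f g) := by
  obtain ⟨V, _, _, _, ρ, rfl⟩ := h
  refine isIntegral_trace_of_pow_eq (k := Nat.card Γ) Nat.card_pos ?_
  rw [← map_pow, pow_succ, pow_card_eq_one', one_mul]

/-- The average of a character over a coset of a subgroup centralizing the representative is an
algebraic integer. -/
theorem CharLike.isIntegral_average [Finite Γ] {f : Γ → ℂ} (h : CharLike f) {T : Type} [Group T]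
    [Fintype T] (j : T →* Γ) (x : Γ) (hx : ∀ t, x * j t = j t * x) :
    IsIntegral ℤ ((∑ t, f (x * j t)) / Nat.card T) := by
  obtain ⟨V, _, _, _, ρ, rfl⟩ := h
  have hT : (Nat.card T : ℂ) ≠ 0 := Nat.cast_ne_zero.2 Nat.card_pos.ne'
  let e : V →ₗ[ℂ] V := (Nat.card T : ℂ)⁻¹ • ∑ t, ρ (j t)
  have h1 : ∀ t, ρ (j t) * e = e := fun t => by
    simp only [e, mul_smul_comm, Finset.mul_sum, ← map_mul]
    congr 1
    exact Fintype.sum_equiv (Equiv.mulLeft t) _ _ fun _ => rfl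
  have hee : e * e = e := by
    conv_lhs => enter [1]; unfold e
    rw [smul_mul_assoc, Finset.sum_mul, Finset.sum_congr rfl fun t _ => h1 t, Finset.sum_const,
      Finset.card_univ, ← Nat.card_eq_fintype_card, ← Nat.cast_smul_eq_nsmul ℂ, smul_smul,
      inv_mul_cancel₀ hT, one_smul]
  have hxe : Commute (ρ x) e := by
    simp only [Commute, SemiconjBy, e, mul_smul_comm, smul_mul_assoc, Finset.mul_sum,
      Finset.sum_mul, ← map_mul, hx]
  have hpow : ∀ n, e ^ (n + 1) = e := fun n => by
    induction n with
    | zero => simp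
    | succ n ih => rw [pow_succ, ih, hee]
  have key : (∑ t, ρ.character (x * j t)) / Nat.card T = LinearMap.trace ℂ V (ρ x * e) := by
    simp only [e, mul_smul_comm, Finset.mul_sum, map_smul, map_sum, Representation.character,
      map_mul, smul_eq_mul]
    rw [div_eq_inv_mul, Finset.mul_sum]
  rw [key]
  refine isIntegral_trace_of_pow_eq (k := Nat.card Γ) Nat.card_pos ?_
  rw [hxe.mul_pow, hpow, ← map_pow, pow_succ x, pow_card_eq_one', one_mul]

end CharLike

section SylowFix

variable {C : Type} [Group C]

/-- The number of Sylow 2-subgroups normalized by `c`. -/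
def sylowFix (c : C) : ℕ := Nat.card {Q : Sylow 2 C // c • Q = Q}

theorem isPGroup_zpowers {y : C} {a : ℕ} (hy : y ^ 2 ^ a = 1) :
    IsPGroup 2 (Subgroup.zpowers y) := by
  rintro ⟨_, k, rfl⟩
  refine ⟨a, Subtype.ext ?_⟩
  simp only [Subgroup.coe_pow, Subgroup.coe_one]
  rw [← zpow_natCast, ← _root_.zpow_mul, mul_comm, _root_.zpow_mul, zpow_natCast, hy,
    _root_.one_zpow]

theorem smul_sylow_eq_iff_mem {y : C} {a : ℕ} (hy : y ^ 2 ^ a = 1) (Q : Sylow 2 C) :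
    y • Q = Q ↔ y ∈ Q := by
  rw [Sylow.smul_eq_iff_mem_normalizer]
  refine ⟨fun h => ?_, fun h => Subgroup.le_normalizer h⟩
  have h1 : y ∈ Subgroup.zpowers y ⊓ Subgroup.normalizer Q := ⟨Subgroup.mem_zpowers y, h⟩
  rw [(isPGroup_zpowers hy).inf_normalizer_sylow Q] at h1
  exact h1.2

theorem odd_sylowFix [Finite C] {y : C} {a : ℕ} (hy : y ^ 2 ^ a = 1) : Odd (sylowFix y) := by
  have : Fact (Nat.Prime 2) := ⟨Nat.prime_two⟩
  have h1 := (isPGroup_zpowers hy).card_modEq_card_fixedPoints (Sylow 2 C)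
  have h2 := card_sylow_modEq_one 2 C
  have h3 : Nat.card (MulAction.fixedPoints (Subgroup.zpowers y) (Sylow 2 C)) = sylowFix y := by
    refine Nat.card_congr (Equiv.subtypeEquivRight fun Q => ?_)
    rw [(isPGroup_zpowers hy).sylow_mem_fixedPoints_iff, smul_sylow_eq_iff_mem hy,
      Subgroup.zpowers_le]
    rfl
  rw [← h3, Nat.odd_iff]
  exact h1.symm.trans h2

theorem sylowFix_map (α : MulAut C) (y : C) : sylowFix (α y) = sylowFix y := by
  symm
  refine Nat.card_congr (Equiv.subtypeEquiv (MulAction.toPerm α) fun Q => ?_)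
  have : α y • α • Q = α • y • Q := by
    rw [Sylow.smul_def, Sylow.smul_def, ← mul_smul, ← mul_smul]
    congr 1
    ext c
    simp
  rw [MulAction.toPerm_apply, this, smul_left_cancel_iff]

theorem sylowFix_inv (y : C) : sylowFix y⁻¹ = sylowFix y :=
  Nat.card_congr (Equiv.subtypeEquivRight fun Q => by rw [inv_smul_eq_iff, eq_comm])

theorem sylowFix_central_mul {x : C} (hx : ∀ c, x * c = c * x) (y : C) :
    sylowFix (x * y) = sylowFix y := by
  refine Nat.card_congr (Equiv.subtypeEquivRight fun Q => ?_)
  have : ∀ Q : Sylow 2 C, x • Q = Q := fun Q => by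
    rw [Sylow.smul_def]
    have : MulAut.conj x = 1 := by ext c; simp [hx]
    rw [this, one_smul]
  rw [mul_smul, this]

theorem isIntegral_sum_of_sylow [Finite C] [Fintype C] (T : Sylow 2 C) {a : ℕ} (ha
    : Nat.card T ∣ 2 ^ a)
    (f : C → ℂ) (hf : ∀ c y, f (c * y * c⁻¹) = f y) (hInt : ∀ y, IsIntegral ℤ (f y))
    (hT : ∀ n : ℕ, IsIntegral ℤ
      ((∑ t : (T : Subgroup C), (sylowFix (t : C) : ℂ) ^ n * f t) / (2 * Nat.card T : ℕ))) :
    IsIntegral ℤ ((∑ y with y ^ 2 ^ a = 1, f y) / (2 * Nat.card T : ℕ)) := by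
  have : Fact (Nat.Prime 2) := ⟨Nat.prime_two⟩
  have := Fintype.ofFinite (Sylow 2 C)
  set d := 2 * Nat.card T with hd
  have hd0 : 0 < d := by have := Nat.card_pos (α := T); omega
  have hdC : (d : ℂ) ≠ 0 := Nat.cast_ne_zero.2 hd0.ne'
  obtain ⟨n, hn⟩ : ∃ n, d.totient = n + 1 := Nat.exists_eq_succ_of_ne_zero
    (Nat.totient_pos.2 hd0).ne'
  have hmem : ∀ Q : Sylow 2 C, ∀ y ∈ Q, y ^ 2 ^ a = 1 := by
    intro Q y hy
    have h1 : y ^ Nat.card Q = 1 := by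
      have := pow_card_eq_one' (x := (⟨y, hy⟩ : Q))
      exact congrArg Subtype.val this
    have h2 : Nat.card Q = Nat.card T := Nat.card_congr (Q.equiv T).toEquiv
    obtain ⟨k, hk⟩ := ha
    rw [hk, pow_mul, ← h2, h1, one_pow]
  have hcong : ∀ y : C, y ^ 2 ^ a = 1 → ∃ z : ℤ, (sylowFix y : ℂ) ^ (n + 1) - 1 = d * z := by
    intro y hy
    have hodd := odd_sylowFix hy
    obtain ⟨b, hb⟩ := IsPGroup.iff_card.1 T.isPGroup'
    have hcop : (sylowFix y).Coprime d := by
      rw [hd, hb, ← pow_succ']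
      exact (Nat.coprime_two_right.2 hodd).pow_right _
    have h1 := (Nat.ModEq.pow_totient hcop)
    rw [hn] at h1
    obtain ⟨z, hz⟩ := (Nat.modEq_iff_dvd.1 h1.symm)
    refine ⟨z, ?_⟩
    have := congrArg (Int.cast (R := ℂ)) hz
    push_cast at this
    exact this
  have hfib : ∀ Q : Sylow 2 C, ∑ y with y ∈ Q, (sylowFix y : ℂ) ^ n * f y =
      ∑ t : (T : Subgroup C), (sylowFix (t : C) : ℂ) ^ n * f t := by
    intro Q
    obtain ⟨c, rfl⟩ := MulAction.exists_smul_eq C T Q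
    have h1 : ∑ t : (T : Subgroup C), (sylowFix (t : C) : ℂ) ^ n * f t =
        ∑ y with y ∈ T, (sylowFix y : ℂ) ^ n * f y := by
      exact (Finset.sum_subtype (p := (· ∈ (T : Subgroup C))) (Finset.univ.filter (· ∈ T))
        (fun y => Finset.mem_filter.trans (and_iff_right (Finset.mem_univ y)))
        fun y => (sylowFix y : ℂ) ^ n * f y).symm
    rw [h1]
    symm
    refine Finset.sum_equiv (MulAut.conj c).toEquiv (fun y => ?_) fun y _ => ?_
    · simp only [Finset.mem_filter, Finset.mem_univ, true_and]
      exact (Subgroup.smul_mem_pointwise_smul_iff (a := MulAut.conj c) (S := (T : Subgroup C))).symm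
    · show _ = (sylowFix (MulAut.conj c y) : ℂ) ^ n * f (MulAut.conj c y)
      rw [sylowFix_map, MulAut.conj_apply, hf]
  have hmain : ∑ y with y ^ 2 ^ a = 1, (sylowFix y : ℂ) ^ (n + 1) * f y =
      Fintype.card (Sylow 2 C) * ∑ t : (T : Subgroup C), (sylowFix (t : C) : ℂ) ^ n * f t := by
    calc ∑ y with y ^ 2 ^ a = 1, (sylowFix y : ℂ) ^ (n + 1) * f y
        = ∑ y with y ^ 2 ^ a = 1, ∑ Q : Sylow 2 C,
            if y ∈ Q then (sylowFix y : ℂ) ^ n * f y else 0 := by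
          refine Finset.sum_congr rfl fun y hy => ?_
          rw [← Finset.sum_filter, Finset.sum_const, nsmul_eq_mul, ← mul_assoc, pow_succ']
          congr 3
          rw [sylowFix, Nat.card_eq_fintype_card, Fintype.card_subtype]
          congr 1
          ext Q
          simp [smul_sylow_eq_iff_mem (Finset.mem_filter.1 hy).2]
      _ = ∑ Q : Sylow 2 C, ∑ y with y ∈ Q, (sylowFix y : ℂ) ^ n * f y := by
          rw [Finset.sum_comm]
          refine Finset.sum_congr rfl fun Q _ => ?_
          rw [← Finset.sum_filter, Finset.filter_filter]
          refine Finset.sum_congr ?_ fun _ _ => rfl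
          ext y
          simp only [Finset.mem_filter, Finset.mem_univ, true_and, and_iff_right_iff_imp]
          exact hmem Q y
      _ = _ := by
          rw [Finset.sum_congr rfl fun Q _ => hfib Q, Finset.sum_const, nsmul_eq_mul,
            Finset.card_univ]
  choose! z hz using hcong
  have key : (∑ y with y ^ 2 ^ a = 1, f y) / (d : ℂ) =
      Fintype.card (Sylow 2 C) * ((∑ t : (T : Subgroup C), (sylowFix (t : C) : ℂ) ^ n * f t) / d) -
        ∑ y with y ^ 2 ^ a = 1, z y * f y := by
    rw [← mul_div_assoc, ← hmain, div_eq_iff hdC, sub_mul, div_mul_cancel₀ _ hdC, Finset.sum_mul,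
      ← Finset.sum_sub_distrib]
    refine Finset.sum_congr rfl fun y hy => ?_
    linear_combination -f y * hz y (Finset.mem_filter.1 hy).2
  rw [key]
  refine ((isIntegral_natCast _).mul (hT n)).sub (IsIntegral.sum _ fun y _ => ?_)
  refine IsIntegral.mul ?_ (hInt y)
  simpa using (isIntegral_algebraMap : IsIntegral ℤ (algebraMap ℤ ℂ (z y)))

end SylowFix

section Twist

variable {G : Type} [Group G]

theorem conj_commute_of_conj_eq_inv {x s c : G} (hsx : s * x * s⁻¹ = x⁻¹) (hc : x * c = c * x) :
    x * (s * c * s⁻¹) = s * c * s⁻¹ * x := by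
  have h1 : s * x⁻¹ * s⁻¹ = x := by
    simpa [mul_assoc] using congrArg (·⁻¹) hsx
  have h2 : x⁻¹ * c = c * x⁻¹ := by rw [inv_mul_eq_iff_eq_mul, ← mul_assoc, hc]; group
  calc x * (s * c * s⁻¹) = (s * x⁻¹ * s⁻¹) * (s * c * s⁻¹) := by rw [h1]
    _ = s * (x⁻¹ * c) * s⁻¹ := by group
    _ = s * c * s⁻¹ * (s * x⁻¹ * s⁻¹) := by rw [h2]; group
    _ = _ := by rw [h1]

theorem inv_conj_eq_inv {x s : G} (hsx : s * x * s⁻¹ = x⁻¹) : s⁻¹ * x * s⁻¹⁻¹ = x⁻¹ := by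
  rw [mul_assoc, inv_inv, eq_inv_iff_mul_eq_one]
  calc s⁻¹ * (x * s) * x = s⁻¹ * (x * (s * x * s⁻¹)) * s := by group
    _ = 1 := by rw [hsx]; group

theorem isIntegral_sylow_sum [Finite G] {H : Subgroup G} {x s : G} (hx : x ∈ H) (hs : s ∈ H)
    (hsx : s * x * s⁻¹ = x⁻¹) {C : Subgroup G} (hC : ∀ c, c ∈ C ↔ x * c = c * x) (T : Sylow 2 C)
    (hTH : ∀ t ∈ T, (t : G) ∈ H) (hsT : ∀ t ∈ T, ∃ t' ∈ T, s * t * s⁻¹ = t')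
    {φ : H → ℂ} (hφ : CharLike φ) (hφc : ∀ h g, φ (h * g * h⁻¹) = φ g) {F : G → ℂ}
    (hF : ∀ h : H, F h = (φ h + φ h⁻¹) ^ 2) (n : ℕ) [Fintype (T : Subgroup C)] :
    IsIntegral ℤ ((∑ t : (T : Subgroup C), (sylowFix (t : C) : ℂ) ^ n * F (x * t)) /
      (2 * Nat.card T : ℕ)) := by
  have hcx : ∀ c : C, x * c = c * x := fun c => (hC c).1 c.2
  have hxC : x ∈ C := (hC x).2 rfl
  let Γ : Subgroup G := H ⊓ C
  let xΓ : Γ := ⟨x, hx, hxC⟩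
  let ia : Γ →* H := Subgroup.inclusion inf_le_left
  let ib : Γ →* C := Subgroup.inclusion inf_le_right
  let j : ↥(T : Subgroup C) →* Γ :=
    { toFun t := ⟨t.1.1, hTH t.1 t.2, t.1.2⟩
      map_one' := rfl
      map_mul' _ _ := rfl }
  have hxj : ∀ t, xΓ * j t = j t * xΓ := fun t => Subtype.ext (hcx t.1)
  have hπ : ∀ t, sylowFix (ib (xΓ * j t)) = sylowFix (t : C) := fun t => by
    rw [map_mul]
    exact sylowFix_central_mul (x := ib xΓ) (fun c => Subtype.ext (hcx c)) _
  have hcl : CharLike fun g : Γ => (sylowFix (ib g) : ℂ) :=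
    (CharLike.fixedPoints (Γ := C) (Sylow 2 C)).comp ib
  have hcφ : CharLike fun g : Γ => φ (ia g) := hφ.comp ia
  let α : MulAut C :=
    { toFun c := ⟨s * c * s⁻¹, (hC _).2 (conj_commute_of_conj_eq_inv hsx (hcx c))⟩
      invFun c := ⟨s⁻¹ * c * s⁻¹⁻¹,
        (hC _).2 (conj_commute_of_conj_eq_inv (inv_conj_eq_inv hsx) (hcx c))⟩
      left_inv c := Subtype.ext (by simp [mul_assoc])
      right_inv c := Subtype.ext (by simp [mul_assoc])
      map_mul' c d := Subtype.ext (by simp [mul_assoc]) }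
  let τ : ↥(T : Subgroup C) → ↥(T : Subgroup C) := fun t => ⟨α (t : C)⁻¹, by
    obtain ⟨t', ht', h⟩ := hsT _ (inv_mem t.2)
    have : α (t : C)⁻¹ = t' := Subtype.ext h
    rwa [this]⟩
  have hτ : Function.Bijective τ := by
    refine Function.Injective.bijective_of_finite fun t t' h => ?_
    have := α.injective (congrArg Subtype.val h)
    exact Subtype.ext (inv_injective this)
  have hAA : ∑ t : (T : Subgroup C), (sylowFix (t : C) : ℂ) ^ n * φ (ia (xΓ * j t)) ^ 2 =
      ∑ t : (T : Subgroup C), (sylowFix (t : C) : ℂ) ^ n * φ (ia (xΓ * j t))⁻¹ ^ 2 := by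
    rw [← hτ.sum_comp]
    refine Finset.sum_congr rfl fun t _ => ?_
    have h1 : sylowFix (τ t : C) = sylowFix (t : C) := by
      rw [← sylowFix_inv (t : C)]
      exact sylowFix_map α _
    have h2 : ia (xΓ * j (τ t)) = ⟨s, hs⟩ * (ia (xΓ * j t))⁻¹ * ⟨s, hs⟩⁻¹ := by
      rw [hxj t]
      refine Subtype.ext ?_
      show x * (s * (t : G)⁻¹ * s⁻¹) = s * ((t : G) * x)⁻¹ * s⁻¹
      rw [_root_.mul_inv_rev, ← hsx]
      have h3 : s * x⁻¹ * s⁻¹ = x := by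
        simpa [mul_assoc] using congrArg (·⁻¹) hsx
      conv_lhs => rw [← h3]
      rw [hsx]
      group
    rw [h1, h2, hφc]
  have h1 : IsIntegral ℤ ((∑ t : (T : Subgroup C), (sylowFix (t : C) : ℂ) ^ n *
      φ (ia (xΓ * j t)) ^ 2) / Nat.card T) := by
    simp_rw [← hπ]
    exact ((hcl.pow n).mul (hcφ.pow 2)).isIntegral_average j xΓ hxj
  have h2 : IsIntegral ℤ ((∑ t : (T : Subgroup C), (sylowFix (t : C) : ℂ) ^ n *
      (φ (ia (xΓ * j t)) * φ (ia (xΓ * j t)⁻¹))) / Nat.card T) := by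
    simp_rw [← hπ]
    exact ((hcl.pow n).mul (hcφ.mul hcφ.inv)).isIntegral_average j xΓ hxj
  have h3 := h1.add h2
  rw [← add_div] at h3
  refine Eq.subst (motive := fun z : ℂ => IsIntegral ℤ z) ?_ h3
  have hT0 : (Nat.card T : ℂ) ≠ 0 := Nat.cast_ne_zero.2 Nat.card_pos.ne'
  rw [div_eq_div_iff hT0 (by push_cast; simp)]
  have hFt : ∀ t : T, F (x * t) = (φ (ia (xΓ * j t)) + φ (ia (xΓ * j t))⁻¹) ^ 2 := fun t =>
    hF (ia (xΓ * j t))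
  have : ∑ t : (T : Subgroup C), (sylowFix (t : C) : ℂ) ^ n * F (x * t) =
      2 * (∑ t : (T : Subgroup C), (sylowFix (t : C) : ℂ) ^ n * φ (ia (xΓ * j t)) ^ 2 +
        ∑ t : (T : Subgroup C), (sylowFix (t : C) : ℂ) ^ n *
          (φ (ia (xΓ * j t)) * φ (ia (xΓ * j t)⁻¹))) := by
    conv_rhs => rw [mul_add, two_mul]; enter [1, 2]; rw [hAA]
    rw [Finset.mul_sum, ← Finset.sum_add_distrib, ← Finset.sum_add_distrib]
    refine Finset.sum_congr rfl fun t _ => ?_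
    rw [hFt, map_inv]
    ring
  rw [this]
  push_cast
  ring

end Twist

variable {G : Type} [Group G]

theorem card_isConj_mul_card_centralizer [Finite G] (x : G) :
    Nat.card {y // ConjClasses.mk y = ConjClasses.mk x} * Nat.card (Subgroup.centralizer {x}) =
      Nat.card G := by
  have h1 := Nat.card_congr (MulAction.orbitProdStabilizerEquivGroup (ConjAct G) x)
  rw [Nat.card_prod, ← Subgroup.nat_card_centralizer_nat_card_stabilizer,
    ConjAct.orbit_eq_carrier_conjClasses] at h1
  refine Eq.trans ?_ h1
  congr 1
  exact Nat.card_congr (Equiv.subtypeEquivRight fun y => ConjClasses.mem_carrier_iff_mk_eq.symm)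

/-- A local criterion for the absence of irreducible representations of symplectic type. -/
theorem NoAlt.of_local [Finite G]
    (h : ∀ x : G, Odd (orderOf x) → ∃ (H C : Subgroup G) (T : Sylow 2 C) (s : G),
      (∀ c, c ∈ C ↔ x * c = c * x) ∧ NoAlt H ∧ x ∈ H ∧ s ∈ H ∧ s * x * s⁻¹ = x⁻¹ ∧
      (∀ t ∈ T, (t : G) ∈ H) ∧ ∀ t ∈ T, ∃ t' ∈ T, s * t * s⁻¹ = (t' : G)) : NoAlt G := by
  intro V _ _ _ ρ hρ B hB hBalt
  by_contra hB0
  have := Fintype.ofFinite G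
  have : Fact (Nat.Prime 2) := ⟨Nat.prime_two⟩
  have hcl : CharLike ρ.character := .character ρ
  let F : G → ℂ := fun g => ρ.character g * ρ.character g⁻¹
  have hFint : ∀ g, IsIntegral ℤ (F g) := fun g => (hcl.isIntegral g).mul (hcl.isIntegral _)
  have hFc : ∀ c g, F (c * g * c⁻¹) = F g := fun c g => by
    have h1 : (c * g * c⁻¹)⁻¹ = c * g⁻¹ * c⁻¹ := by group
    simp only [F, h1, Representation.char_conj]
  have hG0 : (Nat.card G : ℂ) ≠ 0 := Nat.cast_ne_zero.2 Nat.card_pos.ne'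
  obtain ⟨a, m, hm, ham⟩ := Nat.exists_eq_two_pow_mul_odd (n := Nat.card G) Nat.card_pos.ne'
  obtain ⟨e, he1, he2⟩ := Nat.chineseRemainder ((Nat.coprime_two_right.2 hm).pow_right a) 1 0
  have hpe1 : ∀ y : G, y ^ m = 1 → y ^ e = y := fun y hy => by
    conv_rhs => rw [← pow_one y]
    exact pow_eq_pow_of_modEq he1 hy
  have hpe2 : ∀ y : G, y ^ 2 ^ a = 1 → y ^ e = 1 := fun y hy => by
    rw [← pow_zero y]
    exact pow_eq_pow_of_modEq he2 hy
  have hpm : ∀ g : G, (g ^ e) ^ m = 1 := fun g => by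
    obtain ⟨k, hk⟩ := (Nat.modEq_zero_iff_dvd.1 he2)
    rw [← pow_mul, hk, mul_right_comm, ← ham, pow_mul, pow_card_eq_one', one_pow]
  have hp2 : ∀ g : G, ((g ^ e)⁻¹ * g) ^ 2 ^ a = 1 := fun g => by
    have h1 : Commute (g ^ e)⁻¹ g := (Commute.refl g).pow_left e |>.inv_left
    rw [h1.mul_pow, inv_pow, inv_mul_eq_one, ← pow_mul]
    refine pow_eq_pow_of_modEq (n := Nat.card G) ?_ pow_card_eq_one'
    rw [ham, mul_comm e]
    simpa using he1.mul_left' (2 ^ a)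
  let b : G → ℂ := fun x => ∑ g with g ^ e = x, F g
  have hbc : ∀ c x, b (c * x * c⁻¹) = b x := fun c x => by
    symm
    refine Finset.sum_equiv (MulAut.conj c).toEquiv (fun g => ?_) fun g _ => (hFc c g).symm
    simp [conj_pow]
  have hb : ∀ x, TwoIntegral (b x / (2 * Nat.card (Subgroup.centralizer {x}) : ℕ)) := by
    intro x
    by_cases hx : x ^ m = 1
    · obtain ⟨H, C, T, s, hC, hH, hxH, hsH, hsx, hTH, hsT⟩ :=
        h x (Odd.of_dvd_nat hm (orderOf_dvd_of_pow_eq_one hx))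
      obtain rfl : C = Subgroup.centralizer {x} := by
        ext c
        rw [hC, Subgroup.mem_centralizer_singleton_iff, eq_comm]
      have hbx : b x = ∑ y : Subgroup.centralizer {x} with y ^ 2 ^ a = 1, F (x * y) := by
        symm
        refine Finset.sum_bij (fun y _ => x * y) ?_ ?_ ?_ fun _ _ => rfl
        · intro y hy
          have hc : Commute x y := (hC y).1 y.2
          have hy' : (y : G) ^ 2 ^ a = 1 := by
            simpa using congrArg Subtype.val (Finset.mem_filter.1 hy).2
          simp [hc.mul_pow, hpe1 x hx, hpe2 _ hy']
        · intro y _ y' _ hyy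
          exact Subtype.ext (mul_left_cancel hyy)
        · intro g hg
          have hg' : g ^ e = x := (Finset.mem_filter.1 hg).2
          refine ⟨⟨x⁻¹ * g, (hC _).2 ?_⟩, ?_, mul_inv_cancel_left x g⟩
          · rw [← hg']
            group
          · rw [Finset.mem_filter]
            refine ⟨Finset.mem_univ _, Subtype.ext ?_⟩
            have h1 := hp2 g
            rw [hg'] at h1
            exact h1
      obtain ⟨L, hL⟩ := hH.exists_half_char (ρ.comp H.subtype : Representation ℂ H V) B
        (fun g => hB g) hBalt fun v hv => hB.eq_zero_of_right hρ hB0 hv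
      have hχ : ∀ g : H, ρ.character g =
          L.toRepresentation.character g + L.toRepresentation.character g⁻¹ := hL
      have hTa : Nat.card T ∣ 2 ^ a := by
        obtain ⟨k, hk⟩ := IsPGroup.iff_card.1 T.isPGroup'
        rw [hk]
        refine Nat.Coprime.dvd_of_dvd_mul_right (((Nat.coprime_two_right.2 hm).pow_right k).symm) ?_
        rw [← ham, ← hk]
        exact (Subgroup.card_subgroup_dvd_card _).trans (Subgroup.card_subgroup_dvd_card _)
      have key := isIntegral_sum_of_sylow T hTa (fun y => F (x * y)) (fun c y => by
          rw [← hFc c (x * y)]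
          congr 1
          push_cast
          rw [← mul_assoc, ← mul_assoc, (hC c).1 c.2, mul_assoc (c : G)]) (fun y => hFint _)
        (fun n => isIntegral_sylow_sum hxH hsH hsx hC T hTH hsT (.character L.toRepresentation)
          (fun h g => Representation.char_conj _ _ _) (F := F) (fun g => by
            have := hχ g⁻¹
            simp only [F]
            rw [hχ, ← H.coe_inv, this, inv_inv]
            ring) n)
      replace key : IsIntegral ℤ (b x / (2 * Nat.card T : ℕ)) := by
        rw [hbx]
        convert key
      have hodd : Odd (T : Subgroup (Subgroup.centralizer {x})).index :=
        Nat.not_even_iff_odd.1 fun h2 => T.not_dvd_index h2.two_dvd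
      have h3 := (IsIntegral.twoIntegral key).div_odd hodd
      rw [div_div, ← Nat.cast_mul, mul_assoc, Subgroup.card_mul_index] at h3
      exact h3
    · have : b x = 0 := Finset.sum_eq_zero fun g hg => by
        refine absurd ?_ hx
        rw [← (Finset.mem_filter.1 hg).2]
        exact hpm g
      rw [this, zero_div]
      exact IsIntegral.twoIntegral isIntegral_zero
  have hclass : ∀ c : ConjClasses G, TwoIntegral ((∑ x with ConjClasses.mk x = c, b x) /
      (2 * Nat.card G : ℕ)) := by
    intro c
    obtain ⟨x, rfl⟩ := ConjClasses.exists_rep c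
    have h1 : ∑ y with ConjClasses.mk y = ConjClasses.mk x, b y =
        Nat.card {y // ConjClasses.mk y = ConjClasses.mk x} * b x := by
      rw [Finset.sum_congr rfl (g := fun _ => b x) fun y hy => ?_, Finset.sum_const, nsmul_eq_mul,
        Nat.card_eq_fintype_card, Fintype.card_subtype]
      obtain ⟨c, hc⟩ := isConj_iff.1 (ConjClasses.mk_eq_mk_iff_isConj.1 (Finset.mem_filter.1 hy).2)
      rw [← hc, hbc]
    rw [h1, ← card_isConj_mul_card_centralizer x, mul_left_comm, Nat.cast_mul, mul_div_mul_left]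
    · exact hb x
    · have : Nonempty {y // ConjClasses.mk y = ConjClasses.mk x} := ⟨x, rfl⟩
      exact Nat.cast_ne_zero.2 Nat.card_pos.ne'
  have hsum : ∑ c : ConjClasses G, ∑ x with ConjClasses.mk x = c, b x = Nat.card G := by
    rw [Finset.sum_fiberwise]
    refine Eq.trans ?_ (Eq.trans (Finset.sum_fiberwise Finset.univ (fun g => g ^ e) F) ?_)
    · congr!
    exact IsIrreducible.sum_char_mul_char_inv hρ
  apply not_twoIntegral_half
  have := TwoIntegral.sum Finset.univ _ fun c _ => hclass c
  rw [← Finset.sum_div, hsum] at this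
  convert this using 1
  push_cast
  field_simp

end OrthSim

namespace OrthSim

section TwoGroup

variable {P : Type} [Group P]

/-- A normal subgroup of a `2`-group which is not contained in the normal subgroup `C` contains an
element that becomes a central involution modulo `C`. -/
theorem exists_central_involution_mod [Finite P] (hP : IsPGroup 2 P) (C D : Subgroup P) [C.Normal]
    [D.Normal] {d₀ : P} (hd₀ : d₀ ∈ D) (hd₀C : d₀ ∉ C) :
    ∃ d ∈ D, d ∉ C ∧ d * d ∈ C ∧ ∀ s, d⁻¹ * (s * d * s⁻¹) ∈ C := by
  have : Fact (Nat.Prime 2) := ⟨Nat.prime_two⟩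
  let D' : Subgroup (P ⧸ C) := D.map (QuotientGroup.mk' C)
  have hD' : D'.Normal := Subgroup.Normal.map inferInstance _ (QuotientGroup.mk'_surjective C)
  have hQ : IsPGroup 2 (P ⧸ C) := hP.to_quotient C
  have hne : Nontrivial D' := by
    refine ⟨⟨(d₀ : P ⧸ C), d₀, hd₀, rfl⟩, 1, fun h => hd₀C ?_⟩
    exact (QuotientGroup.eq_one_iff d₀).1 (congrArg Subtype.val h)
  have hdvd : 2 ∣ Nat.card D' := by
    obtain ⟨n, hn, h⟩ := (hQ.to_subgroup D').nontrivial_iff_card.1 hne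
    rw [h]
    exact dvd_pow_self 2 hn.ne'
  have h1 : (1 : D') ∈ MulAction.fixedPoints (ConjAct (P ⧸ C)) D' := fun g => smul_one g
  have hQ' : IsPGroup 2 (ConjAct (P ⧸ C)) := hQ
  obtain ⟨b, hb, hb1⟩ := hQ'.exists_fixed_point_of_prime_dvd_card_of_fixed_point D' hdvd h1
  obtain ⟨k, hk⟩ := hQ (b : P ⧸ C)
  have hb1' : (b : P ⧸ C) ≠ 1 := fun h => hb1 (Subtype.ext h.symm)
  have hcen : ∀ g : P ⧸ C, g * b * g⁻¹ = b := fun g => congrArg Subtype.val (hb (ConjAct.toConjAct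
    g))
  have hex : ∃ k, (b : P ⧸ C) ^ 2 ^ k = 1 := ⟨k, hk⟩
  obtain ⟨j, hj⟩ : ∃ j, Nat.find hex = j + 1 := Nat.exists_eq_succ_of_ne_zero fun h => hb1' (by
    simpa [h] using Nat.find_spec hex)
  have hmem : (b : P ⧸ C) ^ 2 ^ j ∈ D' := pow_mem b.2 _
  obtain ⟨d, hd, hdb⟩ := hmem
  replace hdb : (d : P ⧸ C) = (b : P ⧸ C) ^ 2 ^ j := hdb
  refine ⟨d, hd, fun h => ?_, ?_, fun s => ?_⟩
  · have := Nat.find_min hex (m := j) (by omega)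
    exact this (hdb ▸ (QuotientGroup.eq_one_iff d).2 h)
  · rw [← QuotientGroup.eq_one_iff, QuotientGroup.mk_mul, hdb, ← pow_add, ← two_mul, ← pow_succ',
      ← hj]
    exact Nat.find_spec hex
  · rw [← QuotientGroup.eq_one_iff, QuotientGroup.mk_mul, QuotientGroup.mk_mul,
      QuotientGroup.mk_mul,
      QuotientGroup.mk_inv, QuotientGroup.mk_inv, hdb, ← conj_pow, hcen, inv_mul_cancel]

end TwoGroup

section TwoGroup

variable {P : Type} [Group P]

theorem zpow_eq_one_iff_two_pow_dvd {c : P} {k : ℕ} (hk : orderOf c = 2 ^ k) (n : ℤ) :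
    c ^ n = 1 ↔ (2 : ℤ) ^ k ∣ n := by
  rw [← orderOf_dvd_iff_zpow_eq_one, hk]
  simp

theorem eq_one_or_eq_of_mem_zpowers {c z g : P} {k : ℕ} (hk : orderOf c = 2 ^ k)
    (hz : z ∈ Subgroup.zpowers c) (hz2 : z * z = 1) (hz1 : z ≠ 1) (hg : g ∈ Subgroup.zpowers c)
    (hg2 : g * g = 1) : g = 1 ∨ g = z := by
  obtain ⟨r, rfl⟩ := Subgroup.mem_zpowers_iff.1 hg
  obtain ⟨m, rfl⟩ := Subgroup.mem_zpowers_iff.1 hz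
  have hrm : c ^ r = c ^ m ↔ (2 : ℤ) ^ k ∣ r - m := by
    rw [← zpow_eq_one_iff_two_pow_dvd hk, _root_.zpow_sub, mul_inv_eq_one]
  rw [← _root_.zpow_add, zpow_eq_one_iff_two_pow_dvd hk] at hz2 hg2
  rw [Ne, zpow_eq_one_iff_two_pow_dvd hk] at hz1
  rw [zpow_eq_one_iff_two_pow_dvd hk, hrm]
  obtain _ | k := k
  · simp
  have key : ∀ n : ℤ, (2 : ℤ) ^ (k + 1) ∣ n + n → ∃ n', n = 2 ^ k * n' := by
    rintro n ⟨n', hn'⟩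
    exact ⟨n', by rw [pow_succ] at hn'; linarith⟩
  obtain ⟨r, rfl⟩ := key r hg2
  obtain ⟨m, rfl⟩ := key m hz2
  have h0 : (2 : ℤ) ^ k ≠ 0 := pow_ne_zero _ two_ne_zero
  rw [pow_succ, ← mul_sub, mul_dvd_mul_iff_left h0, mul_dvd_mul_iff_left h0]
  rw [pow_succ, mul_dvd_mul_iff_left h0] at hz1
  omega

theorem exists_involution_in_coset {c z w : P} {k : ℕ} (hk : orderOf c = 2 ^ k)
    (hz : z ∈ Subgroup.zpowers c) (hz2 : z * z = 1) (hz1 : z ≠ 1) {a j : ℤ}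
    (ha : w⁻¹ * c * w = c ^ (4 * a + 1)) (hj : w * w = c ^ (2 * j)) :
    ∃ l : ℤ, w * c ^ l * (w * c ^ l) = 1 ∧ ∀ g ∈ Subgroup.zpowers c,
      w * c ^ l * g * (w * c ^ l * g) = 1 → g = 1 ∨ g = z := by
  have hsq : ∀ l : ℤ, w * c ^ l * (w * c ^ l) = c ^ (2 * (j + (2 * a + 1) * l)) := fun l => by
    have h1 : w⁻¹ * c ^ l * w = c ^ ((4 * a + 1) * l) := by
      rw [_root_.zpow_mul, ← ha]
      have := conj_zpow (a := w⁻¹) (b := c) (i := l)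
      rw [inv_inv] at this
      rw [this]
    calc w * c ^ l * (w * c ^ l) = w * w * (w⁻¹ * c ^ l * w) * c ^ l := by group
      _ = _ := by
        rw [h1, hj, ← _root_.zpow_add, ← _root_.zpow_add]
        congr 1
        ring
  have hcop : IsCoprime (2 * a + 1) ((2 : ℤ) ^ k) :=
    IsCoprime.pow_right ⟨1, -a, by ring⟩
  obtain ⟨p, q, hpq⟩ := hcop
  have hl : w * c ^ (-j * p) * (w * c ^ (-j * p)) = 1 := by
    rw [hsq, zpow_eq_one_iff_two_pow_dvd hk]
    exact ⟨2 * j * q, by linear_combination (2 * j) * (-hpq)⟩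
  refine ⟨-j * p, hl, fun g hg hg2 => eq_one_or_eq_of_mem_zpowers hk hz hz2 hz1 hg ?_⟩
  obtain ⟨r, rfl⟩ := Subgroup.mem_zpowers_iff.1 hg
  rw [mul_assoc w, ← _root_.zpow_add, hsq] at hg2
  rw [hsq] at hl
  have h3 : c ^ (2 * ((2 * a + 1) * r)) = 1 := by
    have : 2 * ((2 * a + 1) * r) = 2 * (j + (2 * a + 1) * (-j * p + r)) -
      2 * (j + (2 * a + 1) * (-j * p)) := by ring
    rw [this, _root_.zpow_sub, hg2, hl, inv_one, mul_one]
  rw [← _root_.zpow_add, zpow_eq_one_iff_two_pow_dvd hk]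
  rw [zpow_eq_one_iff_two_pow_dvd hk] at h3
  refine IsCoprime.dvd_of_dvd_mul_left (x := (2 : ℤ) ^ k) (y := 2 * a + 1) ⟨q, p, by linarith⟩ ?_
  have h4 : (2 * a + 1) * (r + r) = 2 * ((2 * a + 1) * r) := by ring
  rw [h4]
  exact h3

theorem zpowers_normal {c : P} (h : ∀ s, s * c * s⁻¹ ∈ Subgroup.zpowers c) :
    (Subgroup.zpowers c).Normal := by
  refine ⟨fun n hn g => ?_⟩
  obtain ⟨i, rfl⟩ := Subgroup.mem_zpowers_iff.1 hn
  rw [← conj_zpow]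
  exact zpow_mem (h g) i

/-- The structure of a normal subgroup `T` of a `2`-group such that the only involutions of `T` that
are central modulo `⟨z⟩` are those of `⟨z⟩`. -/
theorem exists_cyclic_of_central_involutions [Finite P] (hP : IsPGroup 2 P) (T : Subgroup P)
    [T.Normal] {z : P} (hzT : z ∈ T) (hz : ∀ s, s * z = z * s) (hz2 : z * z = 1) (hz1 : z ≠ 1)
    (hT : ∀ t ∈ T, t * t = 1 → (∀ s, s * t * s⁻¹ = t ∨ s * t * s⁻¹ = t * z) → t = 1 ∨ t = z) :
    ∃ c ∈ T, (Subgroup.zpowers c).Normal ∧ ∃ w ∈ T,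
      (∀ t ∈ T, t ∈ Subgroup.zpowers c ∨ w⁻¹ * t ∈ Subgroup.zpowers c) ∧
      w * w ∈ Subgroup.zpowers c ∧ ∀ s, w⁻¹ * (s * w * s⁻¹) ∈ Subgroup.zpowers c := by
  have : Fact (Nat.Prime 2) := ⟨Nat.prime_two⟩
  obtain ⟨c, ⟨hcT, hzc, hcN⟩, hmax⟩ := Set.exists_max_image
    {c | c ∈ T ∧ z ∈ Subgroup.zpowers c ∧ (Subgroup.zpowers c).Normal} orderOf (Set.toFinite _)
    ⟨z, hzT, Subgroup.mem_zpowers z, zpowers_normal fun s => by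
      rw [hz, mul_inv_cancel_right]; exact Subgroup.mem_zpowers z⟩
  refine ⟨c, hcT, hcN, ?_⟩
  obtain ⟨k, hk⟩ := IsPGroup.iff_orderOf.1 hP c
  have hCT : Subgroup.zpowers c ≤ T := by simpa using hcT
  have hk0 : k ≠ 0 := by
    rintro rfl
    rw [pow_zero, orderOf_eq_one_iff] at hk
    rw [hk] at hzc
    exact hz1 (by simpa using hzc)
  have hact : ∀ t : P, ∃ b : ℤ, t⁻¹ * c * t = c ^ (2 * b + 1) := by
    intro t
    have h1 := hcN.conj_mem c (Subgroup.mem_zpowers c) t⁻¹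
    rw [inv_inv] at h1
    obtain ⟨b, hb⟩ := Subgroup.mem_zpowers_iff.1 h1
    rcases Int.even_or_odd b with ⟨b', rfl⟩ | ⟨b', rfl⟩
    · exfalso
      obtain ⟨k, rfl⟩ := Nat.exists_eq_succ_of_ne_zero hk0
      have h2 : t⁻¹ * c ^ ((2 : ℤ) ^ k) * t = 1 := by
        have := conj_zpow (a := t⁻¹) (b := c) (i := (2 : ℤ) ^ k)
        rw [inv_inv] at this
        rw [← this, ← hb, ← _root_.zpow_mul, zpow_eq_one_iff_two_pow_dvd hk]
        exact ⟨b', by rw [Nat.succ_eq_add_one, pow_succ]; ring⟩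
      have h3 : c ^ ((2 : ℤ) ^ k) = 1 := by
        calc c ^ ((2 : ℤ) ^ k) = t * (t⁻¹ * c ^ ((2 : ℤ) ^ k) * t) * t⁻¹ := by group
          _ = 1 := by rw [h2]; group
      rw [zpow_eq_one_iff_two_pow_dvd hk, Nat.succ_eq_add_one, pow_succ] at h3
      have := Int.le_of_dvd (by positivity) h3
      have : (0 : ℤ) < 2 ^ k := by positivity
      linarith
    · exact ⟨b', hb.symm⟩
  have hkey : ∀ w ∈ T, w ∉ Subgroup.zpowers c → w * w ∈ Subgroup.zpowers c →
      (∀ s, w⁻¹ * (s * w * s⁻¹) ∈ Subgroup.zpowers c) → ∀ a : ℤ,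
      w⁻¹ * c * w = c ^ (4 * a + 1) → False := by
    intro w hwT hwC hw2 hws a ha
    obtain ⟨j, hj⟩ := Subgroup.mem_zpowers_iff.1 hw2
    rcases Int.even_or_odd' j with ⟨j, rfl | rfl⟩
    · obtain ⟨l, hl, hl'⟩ := exists_involution_in_coset hk hzc hz2 hz1 ha hj.symm
      have hcl : c ^ l ∈ Subgroup.zpowers c := Subgroup.zpow_mem_zpowers c l
      have h1 : w * c ^ l ∈ Subgroup.zpowers c := by
        refine (hT _ (mul_mem hwT (hCT hcl)) hl fun s => ?_).elim (fun h => h ▸ one_mem _)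
          fun h => h ▸ hzc
        have hg : (w * c ^ l)⁻¹ * (s * (w * c ^ l) * s⁻¹) ∈ Subgroup.zpowers c := by
          have : (w * c ^ l)⁻¹ * (s * (w * c ^ l) * s⁻¹) =
            (c ^ l)⁻¹ * (w⁻¹ * (s * w * s⁻¹)) * (s * c ^ l * s⁻¹) := by group
          rw [this]
          exact mul_mem (mul_mem (inv_mem hcl) (hws s)) (hcN.conj_mem _ hcl s)
        have h2 := hl' _ hg
        rw [mul_inv_cancel_left] at h2
        have h3 : s * (w * c ^ l) * s⁻¹ * (s * (w * c ^ l) * s⁻¹) =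
            s * (w * c ^ l * (w * c ^ l)) * s⁻¹ := by group
        rw [h3, hl, mul_one, mul_inv_cancel, inv_mul_eq_one, inv_mul_eq_iff_eq_mul] at h2
        exact (h2 rfl).imp Eq.symm id
      exact hwC ((Subgroup.mul_mem_cancel_right _ hcl).1 h1)
    · obtain ⟨p, q, hpq⟩ : IsCoprime (2 * j + 1) ((2 : ℤ) ^ k) :=
        IsCoprime.pow_right ⟨1, -j, by ring⟩
      have hcw : c ∈ Subgroup.zpowers w := by
        refine Subgroup.mem_zpowers_iff.2 ⟨2 * p, ?_⟩
        rw [_root_.zpow_mul, zpow_two, ← hj, ← _root_.zpow_mul]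
        conv_rhs => rw [← zpow_one c]
        rw [← mul_inv_eq_one, ← _root_.zpow_neg, ← _root_.zpow_add, zpow_eq_one_iff_two_pow_dvd hk]
        exact ⟨-q, by linear_combination hpq⟩
      have hCw : Subgroup.zpowers c ≤ Subgroup.zpowers w := by simpa using hcw
      have hw : w ∈ {c | c ∈ T ∧ z ∈ Subgroup.zpowers c ∧ (Subgroup.zpowers c).Normal} :=
        ⟨hwT, hCw hzc, zpowers_normal fun s => (Subgroup.mul_mem_cancel_left _
          (inv_mem (Subgroup.mem_zpowers w))).1 (hCw (hws s))⟩
      have := Subgroup.eq_of_le_of_card_ge hCw (by simpa only [Nat.card_zpowers] using hmax w hw)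
      exact hwC (this ▸ Subgroup.mem_zpowers w)
  have hcent : ∀ D : Subgroup P, D.Normal → D ≤ T →
      (∀ d ∈ D, ∃ a : ℤ, d⁻¹ * c * d = c ^ (4 * a + 1)) → D ≤ Subgroup.zpowers c := by
    intro D hD hDT hDa d₀ hd₀
    by_contra hd₀C
    obtain ⟨d, hd, hdC, hd2, hds⟩ := exists_central_involution_mod hP _ D hd₀ hd₀C
    obtain ⟨a, ha⟩ := hDa d hd
    exact hkey d (hDT hd) hdC hd2 hds a ha
  by_cases hTC : T ≤ Subgroup.zpowers c
  · exact ⟨1, one_mem _, fun t ht => Or.inl (hTC ht), by simp, by simp⟩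
  obtain ⟨k, rfl⟩ : ∃ k', k = k' + 2 := by
    refine ⟨k - 2, ?_⟩
    by_contra hk2
    obtain rfl : k = 1 := by omega
    refine hTC (hcent T inferInstance le_rfl fun d _ => ⟨0, ?_⟩)
    have hcc : c * c = 1 := by
      rw [← pow_two]
      exact orderOf_dvd_iff_pow_eq_one.1 (by simp [hk])
    have hc1 : c ≠ 1 := fun h => by simp [h] at hk
    rcases eq_one_or_eq_of_mem_zpowers hk hzc hz2 hz1 (Subgroup.mem_zpowers c) hcc with h | h
    · exact absurd h hc1
    · rw [h, mul_assoc, ← hz, inv_mul_cancel_left, mul_zero, zero_add, zpow_one]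
  have hi : ∀ t : P, ∀ b : ℤ, t⁻¹ * c * t = c ^ b →
      t⁻¹ * c ^ (2 : ℤ) ^ k * t = c ^ (b * 2 ^ k) := by
    intro t b hb
    rw [_root_.zpow_mul, ← hb]
    have := conj_zpow (a := t⁻¹) (b := c) (i := (2 : ℤ) ^ k)
    rw [inv_inv] at this
    rw [this]
  have hpow : ∀ n m : ℤ, c ^ (n * 2 ^ k) = c ^ (m * 2 ^ k) ↔ 4 ∣ n - m := by
    intro n m
    rw [← mul_inv_eq_one, ← _root_.zpow_neg, ← _root_.zpow_add, zpow_eq_one_iff_two_pow_dvd hk,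
      ← neg_mul, ← add_mul, pow_add, mul_comm, mul_dvd_mul_iff_right (pow_ne_zero _ two_ne_zero),
      ← sub_eq_add_neg]
    norm_num
  set i := c ^ (2 : ℤ) ^ k with hidef
  have hi1 : i = c ^ (1 * (2 : ℤ) ^ k) := by rw [one_mul]
  have hiN : (Subgroup.zpowers i).Normal := zpowers_normal fun s => by
    obtain ⟨b, hb⟩ := hact s⁻¹
    have := hi _ _ hb
    rw [inv_inv] at this
    rw [this, mul_comm, _root_.zpow_mul]
    exact Subgroup.zpow_mem_zpowers i _
  have hDC := hcent (T ⊓ Subgroup.centralizer (Subgroup.zpowers i)) inferInstance inf_le_left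
    fun d hd => by
      obtain ⟨b, hb⟩ := hact d
      have h1 := hi _ _ hb
      have h2 : i * d = d * i := Subgroup.mem_centralizer_iff.1 hd.2 i (Subgroup.mem_zpowers i)
      rw [mul_assoc, h2, inv_mul_cancel_left, hi1, hpow] at h1
      obtain ⟨a, ha⟩ := h1
      exact ⟨-a, by rw [hb]; congr 1; linarith⟩
  have hcomm : ∀ t ∈ T, i * t = t * i → t ∈ Subgroup.zpowers c := fun t ht hti => hDC ⟨ht, by
    refine Subgroup.mem_centralizer_iff.2 fun y hy => ?_
    obtain ⟨n, rfl⟩ := Subgroup.mem_zpowers_iff.1 hy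
    exact (Commute.zpow_left hti n).eq⟩
  have hinv : ∀ t ∈ T, t ∉ Subgroup.zpowers c → t⁻¹ * i * t = i⁻¹ := by
    intro t ht htC
    obtain ⟨b, hb⟩ := hact t
    have h1 := hi _ _ hb
    rcases Int.even_or_odd' b with ⟨b, rfl | rfl⟩
    · refine absurd (hcomm t ht ?_) htC
      rw [← inv_mul_eq_iff_eq_mul, ← mul_assoc, h1, hi1, hpow]
      exact ⟨b, by ring⟩
    · rw [h1, hidef, ← _root_.zpow_neg, ← neg_one_mul, hpow]
      exact ⟨b + 1, by ring⟩
  obtain ⟨w, hwT, hwC⟩ := SetLike.not_le_iff_exists.1 hTC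
  have hcos : ∀ u ∈ T, u ∉ Subgroup.zpowers c → ∀ t ∈ T, t ∉ Subgroup.zpowers c →
      u⁻¹ * t ∈ Subgroup.zpowers c := by
    intro u hu huC t ht htC
    refine hcomm _ (mul_mem (inv_mem hu) ht) ?_
    have h1 := hinv _ (inv_mem hu) (fun h => huC (by simpa using inv_mem h))
    have h2 := hinv t ht htC
    rw [inv_inv] at h1
    have h3 : t⁻¹ * i⁻¹ * t = i := by
      have : t⁻¹ * i⁻¹ * t = (t⁻¹ * i * t)⁻¹ := by group
      rw [this, h2, inv_inv]
    calc i * (u⁻¹ * t) = u⁻¹ * (u * i * u⁻¹) * t := by group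
      _ = u⁻¹ * t * (t⁻¹ * i⁻¹ * t) := by rw [h1]; group
      _ = _ := by rw [h3]
  refine ⟨w, hwT, fun t ht => ?_, ?_, fun s => ?_⟩
  · by_cases htC : t ∈ Subgroup.zpowers c
    · exact Or.inl htC
    · exact Or.inr (hcos w hwT hwC t ht htC)
  · have := hcos w⁻¹ (inv_mem hwT) (fun h => hwC (by simpa using inv_mem h)) w hwT hwC
    rwa [inv_inv] at this
  · refine hcos w hwT hwC _ (Subgroup.Normal.conj_mem inferInstance w hwT s) fun h => hwC ?_
    have := hcN.conj_mem _ h s⁻¹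
    have h1 : s⁻¹ * (s * w * s⁻¹) * s⁻¹⁻¹ = w := by group
    rwa [h1] at this

end TwoGroup

section Local

variable {Γ : Type} [Group Γ]

/-- The subgroup `K ∪ hK`, where `h` normalizes `K` and `h ^ 2 ∈ K`. -/
def extendTwo (K : Subgroup Γ) (h : Γ) (h1 : ∀ k ∈ K, h⁻¹ * k * h ∈ K) (h2 : h * h ∈ K) :
    Subgroup Γ where
  carrier := {g | g ∈ K ∨ h⁻¹ * g ∈ K}
  one_mem' := Or.inl (one_mem K)
  mul_mem' := by
    rintro a b (ha | ha) (hb | hb)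
    · exact Or.inl (mul_mem ha hb)
    · refine Or.inr ?_
      have : h⁻¹ * (a * b) = h⁻¹ * a * h * (h⁻¹ * b) := by group
      rw [this]
      exact mul_mem (h1 a ha) hb
    · refine Or.inr ?_
      rw [← mul_assoc]
      exact mul_mem ha hb
    · refine Or.inl ?_
      have : a * b = h * h * (h⁻¹ * (h⁻¹ * a) * h) * (h⁻¹ * b) := by group
      rw [this]
      exact mul_mem (mul_mem h2 (h1 _ ha)) hb
  inv_mem' := by
    rintro a (ha | ha)
    · exact Or.inl (inv_mem ha)
    · refine Or.inr ?_
      have : h⁻¹ * a⁻¹ = h⁻¹ * (h⁻¹ * a)⁻¹ * h * (h * h)⁻¹ := by group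
      rw [this]
      exact mul_mem (h1 _ (inv_mem ha)) (inv_mem h2)

open scoped Pointwise in
theorem exists_mem_sylow_conj [Finite Γ] (S : Sylow 2 Γ) (N : Subgroup Γ) (hSN : (S
    : Subgroup Γ) ≤ N)
    {h : Γ} (hN : h ∈ N) (hh : h * h = 1) : ∃ g ∈ N, g * h * g⁻¹ ∈ S := by
  have : Fact (Nat.Prime 2) := ⟨Nat.prime_two⟩
  let h' : N := ⟨h, hN⟩
  have hh' : h' ^ 2 = 1 := by rw [pow_two]; exact Subtype.ext hh
  have hp : IsPGroup 2 (Subgroup.zpowers h') := by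
    rintro ⟨y, hy⟩
    obtain ⟨i, rfl⟩ := Subgroup.mem_zpowers_iff.1 hy
    refine ⟨1, Subtype.ext ?_⟩
    change (h' ^ i) ^ (2 ^ 1) = 1
    rw [pow_one, ← zpow_natCast, zpow_comm, zpow_natCast, hh', _root_.one_zpow]
  obtain ⟨Q, hQ⟩ := hp.exists_le_sylow
  obtain ⟨g, hg⟩ := MulAction.exists_smul_eq N Q (S.subtype hSN)
  refine ⟨g, g.2, ?_⟩
  have h1 : g * h' * g⁻¹ ∈ g • Q := by
    have : (MulAut.conj g) h' ∈ (MulAut.conj g) • (Q : Subgroup N) :=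
      Subgroup.smul_mem_pointwise_smul _ _ _ (hQ (Subgroup.mem_zpowers h'))
    exact this
  rw [hg] at h1
  exact h1

theorem local_structure [Finite Γ] {x : Γ} (hx : Odd (orderOf x))
    (hinv : ∀ g, g * x * g⁻¹ = x ∨ g * x * g⁻¹ = x⁻¹) {z : Γ} (hz : ∀ s, s * z = z * s)
    (hz2 : z * z = 1) (hz1 : z ≠ 1)
    (W : ∀ c, x * c = c * x → (∃ k, orderOf c = 2 ^ k) →
      ∃ h, h * h = 1 ∧ h * x * h⁻¹ = x⁻¹ ∧ h * c * h⁻¹ = c⁻¹) (S : Sylow 2 Γ) :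
    (∃ s ∈ S, s * x * s⁻¹ = x⁻¹) ∧
    ((∃ t, x * t = t * x ∧ t * t = 1 ∧ t ≠ 1 ∧ t ≠ z ∧
      ∀ s ∈ S, s * t * s⁻¹ = t ∨ s * t * s⁻¹ = t * z) ∨
    ∃ H : Subgroup Γ, NoAlt H ∧ x ∈ H ∧ ∀ s ∈ S, s ∈ H) := by
  have hfact : Fact (Nat.Prime 2) := ⟨Nat.prime_two⟩
  have hconj : ∀ g h, h * x * h⁻¹ = x⁻¹ → (g * h * g⁻¹) * x * (g * h * g⁻¹)⁻¹ = x⁻¹ := by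
    intro g h hh
    have h1 : (g * h * g⁻¹) * x * (g * h * g⁻¹)⁻¹ = g * (h * (g⁻¹ * x * g⁻¹⁻¹) * h⁻¹) * g⁻¹ := by
      group
    have h2 : h * x⁻¹ * h⁻¹ = x := by
      have : h * x⁻¹ * h⁻¹ = (h * x * h⁻¹)⁻¹ := by group
      rw [this, hh, inv_inv]
    rw [h1]
    rcases hinv g⁻¹ with e | e
    · rw [e, hh]
      have h3 : g * x⁻¹ * g⁻¹ = g * (g⁻¹ * x * g⁻¹⁻¹)⁻¹ * g⁻¹ := by rw [e]
      rw [h3]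
      group
    · rw [e, h2]
      have h3 : g * x * g⁻¹ = g * (g⁻¹ * x * g⁻¹⁻¹)⁻¹ * g⁻¹ := by rw [e, inv_inv]
      rw [h3]
      group
  constructor
  · obtain ⟨h, hh, hhx, -⟩ := W 1 (by simp) ⟨0, by simp⟩
    obtain ⟨g, -, hg⟩ := exists_mem_sylow_conj S ⊤ le_top (Subgroup.mem_top h) hh
    exact ⟨_, hg, hconj g h hhx⟩
  by_cases hcase : ∃ t, x * t = t * x ∧ t * t = 1 ∧ t ≠ 1 ∧ t ≠ z ∧
      ∀ s ∈ S, s * t * s⁻¹ = t ∨ s * t * s⁻¹ = t * z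
  · exact Or.inl hcase
  refine Or.inr ?_
  push Not at hcase
  have hzS : z ∈ S := by
    obtain ⟨g, -, hg⟩ := exists_mem_sylow_conj S ⊤ le_top (Subgroup.mem_top z) hz2
    rwa [hz, mul_inv_cancel_right] at hg
  let T : Subgroup (S : Subgroup Γ) := (Subgroup.centralizer {x}).subgroupOf S
  have hTmem : ∀ t : (S : Subgroup Γ), t ∈ T ↔ x * t = t * x := fun t => by
    rw [Subgroup.mem_subgroupOf, Subgroup.mem_centralizer_singleton_iff, eq_comm]
  have hcommconj : ∀ g t : Γ, x * t = t * x → x * (g * t * g⁻¹) = g * t * g⁻¹ * x := by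
    intro g t ht
    have h1 : x * (g * t * g⁻¹) * x⁻¹ = g * ((g⁻¹ * x * g⁻¹⁻¹) * t * (g⁻¹ * x * g⁻¹⁻¹)⁻¹) * g⁻¹ :=
        by
      group
    rw [← mul_inv_eq_iff_eq_mul, h1]
    rcases hinv g⁻¹ with e | e
    · rw [e, ht, mul_inv_cancel_right]
    · rw [e]
      have : x⁻¹ * t * x⁻¹⁻¹ = t := by rw [inv_inv, mul_assoc, ← ht, inv_mul_cancel_left]
      rw [this]
  have hTN : T.Normal := ⟨fun t ht g => (hTmem _).2 (hcommconj g t ((hTmem t).1 ht))⟩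
  obtain ⟨c, hcT, hcN, w, hwT, hTw, hw2, hws⟩ :=
    exists_cyclic_of_central_involutions S.2 T (z := ⟨z, hzS⟩) ((hTmem _).2 (hz x))
      (fun s => Subtype.ext (hz s)) (Subtype.ext hz2) (fun h => hz1 (congrArg Subtype.val h))
      (by
        intro t ht ht2 hts
        by_contra! hcon
        obtain ⟨s, hs, hs1, hs2⟩ := hcase t ((hTmem t).1 ht) (congrArg Subtype.val ht2)
          (fun h => hcon.1 (Subtype.ext h)) (fun h => hcon.2 (Subtype.ext h))
        rcases hts ⟨s, hs⟩ with h | h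
        · exact hs1 (congrArg Subtype.val h)
        · exact hs2 (congrArg Subtype.val h))
  have hC : ∀ u : (S : Subgroup Γ), u ∈ Subgroup.zpowers c ↔ (u : Γ) ∈ Subgroup.zpowers (c : Γ) :=
      by
    intro u
    simp only [Subgroup.mem_zpowers_iff]
    refine exists_congr fun i => ⟨fun h => ?_, fun h => Subtype.ext ?_⟩
    · rw [← h]; simp
    · simpa using h
  have hxc : x * c = c * x := (hTmem c).1 hcT
  have hxw : x * w = w * x := (hTmem w).1 hwT
  obtain ⟨k, hk⟩ := IsPGroup.iff_orderOf.1 S.2 c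
  have hk' : orderOf (c : Γ) = 2 ^ k := by rw [Subgroup.orderOf_coe, hk]
  let N : Subgroup Γ := Subgroup.normalizer (Subgroup.zpowers (c : Γ) : Set Γ)
  have hSN : (S : Subgroup Γ) ≤ N := by
    intro s hs
    rw [Subgroup.mem_normalizer_iff]
    have key : ∀ s ∈ S, ∀ n ∈ Subgroup.zpowers (c : Γ), s * n * s⁻¹ ∈ Subgroup.zpowers (c : Γ) := by
      intro s hs n hn
      obtain ⟨i, rfl⟩ := Subgroup.mem_zpowers_iff.1 hn
      rw [← conj_zpow]
      exact zpow_mem ((hC _).1 (hcN.conj_mem c (Subgroup.mem_zpowers c) ⟨s, hs⟩)) i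
    refine fun n => ⟨key s hs n, fun h => ?_⟩
    have := key s⁻¹ (inv_mem hs) _ h
    have h1 : s⁻¹ * (s * n * s⁻¹) * s⁻¹⁻¹ = n := by group
    rwa [h1] at this
  obtain ⟨h₀, hh₀, hh₀x, hh₀c⟩ := W c hxc ⟨k, hk'⟩
  have hh₀N : h₀ ∈ N := by
    have key : ∀ n ∈ Subgroup.zpowers (c : Γ), h₀ * n * h₀⁻¹ ∈ Subgroup.zpowers (c : Γ) := by
      intro n hn
      obtain ⟨i, rfl⟩ := Subgroup.mem_zpowers_iff.1 hn
      rw [← conj_zpow, hh₀c]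
      exact zpow_mem (inv_mem (Subgroup.mem_zpowers _)) i
    refine Subgroup.mem_normalizer_iff.2 fun n => ⟨key n, fun h => ?_⟩
    have := key _ h
    have h1 : h₀ * (h₀ * n * h₀⁻¹) * h₀⁻¹ = (h₀ * h₀) * n * (h₀ * h₀)⁻¹ := by group
    rwa [h1, hh₀, one_mul, inv_one, mul_one] at this
  obtain ⟨g, hgN, hgS⟩ := exists_mem_sylow_conj S N hSN hh₀N hh₀
  set h := g * h₀ * g⁻¹ with hdef
  have hhx : h * x * h⁻¹ = x⁻¹ := hconj g h₀ hh₀x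
  have hh : h * h = 1 := by
    have : h * h = g * (h₀ * h₀) * g⁻¹ := by rw [hdef]; group
    rw [this, hh₀, mul_one, mul_inv_cancel]
  have hhc : h * c * h⁻¹ = (c : Γ)⁻¹ := by
    have h1 : g⁻¹ * c * g⁻¹⁻¹ ∈ Subgroup.zpowers (c : Γ) :=
      (Subgroup.mem_normalizer_iff.1 (inv_mem hgN) _).1 (Subgroup.mem_zpowers _)
    obtain ⟨i, hi⟩ := Subgroup.mem_zpowers_iff.1 h1
    have h2 : h * c * h⁻¹ = g * (h₀ * (g⁻¹ * c * g⁻¹⁻¹) * h₀⁻¹) * g⁻¹ := by rw [hdef]; group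
    rw [h2, ← hi, ← conj_zpow, hh₀c, _root_.inv_zpow, hi]
    group
  set y := x * (c : Γ) with hy
  have hcop : Nat.Coprime (orderOf x) (orderOf (c : Γ)) := by
    rw [hk']
    exact (Nat.coprime_two_right.2 hx).pow_right k
  have hxy : x ∈ Subgroup.zpowers y := by
    obtain ⟨e, he1, he2⟩ := Nat.chineseRemainder hcop 1 0
    refine Subgroup.mem_zpowers_iff.2 ⟨e, ?_⟩
    rw [zpow_natCast, hy, Commute.mul_pow hxc, pow_eq_pow_iff_modEq.2 he1,
      pow_eq_pow_iff_modEq.2 he2, pow_one, pow_zero, mul_one]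
  have hcy : (c : Γ) ∈ Subgroup.zpowers y := by
    have : (c : Γ) = x⁻¹ * y := by rw [hy, inv_mul_cancel_left]
    rw [this]
    exact mul_mem (inv_mem hxy) (Subgroup.mem_zpowers y)
  have hCy : Subgroup.zpowers (c : Γ) ≤ Subgroup.zpowers y := by simpa using hcy
  have hhK : ∀ a ∈ Subgroup.zpowers y, h * a * h⁻¹ = a⁻¹ := by
    intro a ha
    obtain ⟨i, rfl⟩ := Subgroup.mem_zpowers_iff.1 ha
    have : h * y * h⁻¹ = y⁻¹ := by
      have h1 : h * y * h⁻¹ = (h * x * h⁻¹) * (h * c * h⁻¹) := by rw [hy]; group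
      rw [h1, hhx, hhc, hy, _root_.mul_inv_rev]
      exact (Commute.inv_inv (a := x) (b := (c : Γ)) hxc).eq
    rw [← conj_zpow, this, _root_.inv_zpow]
  have hhinv : h⁻¹ = h := inv_eq_of_mul_eq_one_left hh
  let D := extendTwo (Subgroup.zpowers y) h
    (fun a ha => by
      have := hhK a ha
      rw [hhinv] at this ⊢
      rw [this]
      exact inv_mem ha) (by rw [hh]; exact one_mem _)
  have hKD : Subgroup.zpowers y ≤ D := fun a ha => Or.inl ha
  have hhD : h ∈ D := Or.inr (by rw [inv_mul_cancel]; exact one_mem _)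
  have hwS : ∀ s ∈ S, (w : Γ)⁻¹ * (s * w * s⁻¹) ∈ Subgroup.zpowers (c : Γ) := fun s hs =>
    (hC _).1 (hws ⟨s, hs⟩)
  have hwh : (w : Γ)⁻¹ * h * w ∈ D := by
    have h1 : (w : Γ)⁻¹ * h * w = (w : Γ)⁻¹ * (h * w * h⁻¹) * h := by group
    rw [h1]
    exact mul_mem (hKD (hCy (hwS h hgS))) hhD
  have hwK : ∀ a ∈ Subgroup.zpowers y, (w : Γ)⁻¹ * a * w ∈ Subgroup.zpowers y := by
    intro a ha
    obtain ⟨i, rfl⟩ := Subgroup.mem_zpowers_iff.1 ha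
    have h0 := conj_zpow (a := (w : Γ)⁻¹) (b := y) (i := i)
    rw [inv_inv] at h0
    rw [← h0]
    refine zpow_mem ?_ i
    have h1 : (w : Γ)⁻¹ * y * w = ((w : Γ)⁻¹ * (x * w)) * ((w : Γ)⁻¹ * c * (w : Γ)⁻¹⁻¹) := by
      rw [hy]; group
    rw [h1, hxw, inv_mul_cancel_left]
    refine mul_mem hxy (hCy ?_)
    exact (hC _).1 (hcN.conj_mem c (Subgroup.mem_zpowers c) w⁻¹)
  let H := extendTwo D w
    (by
      rintro a (ha | ha)
      · exact hKD (hwK a ha)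
      · have h1 : (w : Γ)⁻¹ * a * w = ((w : Γ)⁻¹ * h * w) * ((w : Γ)⁻¹ * (h⁻¹ * a) * w) := by group
        rw [h1]
        exact mul_mem hwh (hKD (hwK _ ha)))
    (hKD (hCy ((hC _).1 hw2)))
  have hDH : D ≤ H := fun a ha => Or.inl ha
  refine ⟨H, ?_, hDH (hKD hxy), fun s hs => ?_⟩
  · have hD1 : ∀ g : D, g ∈ (Subgroup.zpowers y).subgroupOf D ∨
        (⟨h, hhD⟩ : D)⁻¹ * g ∈ (Subgroup.zpowers y).subgroupOf D := fun g => g.2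
    have hD2 : (⟨h, hhD⟩ : D) * ⟨h, hhD⟩ = 1 := Subtype.ext hh
    have hD3 : ∀ a ∈ (Subgroup.zpowers y).subgroupOf D,
        (⟨h, hhD⟩ : D) * a * (⟨h, hhD⟩ : D)⁻¹ = a⁻¹ := fun a ha => Subtype.ext (hhK a ha)
    refine NoAlt.of_index_two (NoAlt.of_dihedral _ _ (fun a ha b hb => Subtype.ext ?_) hD1 hD2 hD3)
      (AllReal.of_dihedral _ _ hD1 hD2 hD3) (Subgroup.inclusion hDH)
      ⟨w, Or.inr (by rw [inv_mul_cancel]; exact one_mem _)⟩ fun g => ?_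
    · obtain ⟨i, hi⟩ := Subgroup.mem_zpowers_iff.1 (Subgroup.mem_subgroupOf.1 ha)
      obtain ⟨j, hj⟩ := Subgroup.mem_zpowers_iff.1 (Subgroup.mem_subgroupOf.1 hb)
      rw [Subgroup.coe_mul, Subgroup.coe_mul, ← hi, ← hj, ← _root_.zpow_add, ← _root_.zpow_add,
        add_comm]
    · refine g.2.imp (fun hg => ⟨⟨g, hg⟩, rfl⟩) fun hg => ⟨⟨_, hg⟩, rfl⟩
  · have hT : ∀ t ∈ S, x * t = t * x → t ∈ H := fun t ht htx => by
      rcases hTw ⟨t, ht⟩ ((hTmem _).2 htx) with h1 | h1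
      · exact hDH (hKD (hCy ((hC _).1 h1)))
      · exact Or.inr (hKD (hCy ((hC _).1 h1)))
    rcases hinv s with hsx | hsx
    · exact hT s hs (by rw [mul_inv_eq_iff_eq_mul] at hsx; exact hsx.symm)
    · have h1 : h⁻¹ * s ∈ H := by
        refine hT _ (mul_mem (inv_mem hgS) hs) ?_
        rw [eq_comm, ← mul_inv_eq_iff_eq_mul]
        have h2 : h⁻¹ * s * x * (h⁻¹ * s)⁻¹ = h⁻¹ * (s * x * s⁻¹) * h := by group
        rw [h2, hsx, ← hhx]
        group
      have h2 : s = h * (h⁻¹ * s) := by group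
      rw [h2]
      exact mul_mem (hDH hhD) h1

end Local

section Global

theorem NoAlt.of_subsingleton (D : Type) [Group D] [Subsingleton D] : NoAlt D :=
  NoAlt.of_dihedral ⊤ 1 (fun _ _ _ _ => Subsingleton.elim _ _) (fun _ => Or.inl (Subgroup.mem_top
    _))
    (Subsingleton.elim _ _) fun _ _ => Subsingleton.elim _ _

theorem NoAlt.of_surjective {H₁ H₂ : Type} [Group H₁] [Group H₂] (h : NoAlt H₁) (f : H₁ →* H₂)
    (hf : Function.Surjective f) : NoAlt H₂ :=
  NoAlt.of_product (G₁ := Unit) (.of_subsingleton Unit) (fun _ => ⟨1, rfl⟩) h 1 f (by simp)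
    fun n => ⟨1, (hf n).choose, by simp [(hf n).choose_spec]⟩

variable {G : Type} [Group G]

/-- A finite group with a central involution `z`, in which every element is inverted by an
involution (or by `1`), has no irreducible representation of symplectic type as soon as the
stabilizers of `{t, tz}` have none, for all involutions `t ≠ z`. -/
theorem NoAlt.of_involutions [Finite G] {z : G} (hz : ∀ s, s * z = z * s) (hz2 : z * z = 1)
    (hz1 : z ≠ 1) (W : ∀ y : G, ∃ h, h * h = 1 ∧ h * y * h⁻¹ = y⁻¹)
    (hloc : ∀ t, t * t = 1 → t ≠ 1 → t ≠ z → ∃ H : Subgroup G, NoAlt H ∧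
      ∀ g, g * t * g⁻¹ = t ∨ g * t * g⁻¹ = t * z → g ∈ H) : NoAlt G := by
  have hfact : Fact (Nat.Prime 2) := ⟨Nat.prime_two⟩
  refine NoAlt.of_local fun x hx => ?_
  let C : Subgroup G := Subgroup.centralizer {x}
  have hC : ∀ c, c ∈ C ↔ x * c = c * x := fun c => by
    rw [Subgroup.mem_centralizer_singleton_iff, eq_comm]
  let Γ : Subgroup G :=
    { carrier := {g | g * x * g⁻¹ = x ∨ g * x * g⁻¹ = x⁻¹}
      one_mem' := Or.inl (by simp)
      mul_mem' := by
        intro a b ha hb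
        have h1 : a * b * x * (a * b)⁻¹ = a * (b * x * b⁻¹) * a⁻¹ := by group
        have h2 : a * x⁻¹ * a⁻¹ = (a * x * a⁻¹)⁻¹ := by group
        simp only [Set.mem_ofPred_eq] at ha hb ⊢
        rw [h1]
        rcases ha with ha | ha <;> rcases hb with hb | hb <;> simp [ha, hb, h2]
      inv_mem' := by
        intro a ha
        have h2 : a⁻¹ * x⁻¹ * a = (a⁻¹ * x * a)⁻¹ := by group
        have h3 : a⁻¹ * (a * x * a⁻¹) * a = x := by group
        simp only [Set.mem_ofPred_eq, inv_inv] at ha ⊢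
        rcases ha with ha | ha <;> rw [ha] at h3
        · exact Or.inl h3
        · rw [h2] at h3
          exact Or.inr (by rw [← h3, inv_inv, h3]) }
  have hCΓ : C ≤ Γ := fun c hc => Or.inl (by rw [← (hC c).1 hc, mul_inv_cancel_right])
  have hxΓ : x ∈ Γ := hCΓ ((hC x).2 rfl)
  have hzΓ : z ∈ Γ := hCΓ ((hC z).2 (hz x))
  obtain ⟨T⟩ : Nonempty (Sylow 2 C) := inferInstance
  obtain ⟨S, hTS⟩ := (T.2.map (Subgroup.inclusion hCΓ)).exists_le_sylow
  have hTS' : ∀ t : C, t ∈ T → Subgroup.inclusion hCΓ t ∈ S := fun t ht => hTS ⟨t, ht, rfl⟩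
  have hST : ∀ t : C, Subgroup.inclusion hCΓ t ∈ S → t ∈ T := by
    have hp : IsPGroup 2 ((S : Subgroup Γ).comap (Subgroup.inclusion hCΓ)) :=
      S.2.comap_of_injective _ (Subgroup.inclusion_injective hCΓ)
    have := T.3 hp fun t ht => hTS' t ht
    intro t ht
    have h1 : t ∈ (S : Subgroup Γ).comap (Subgroup.inclusion hCΓ) := ht
    rw [this] at h1
    exact h1
  obtain ⟨⟨s, hsS, hsx⟩, hH⟩ := local_structure (Γ := Γ) (x := ⟨x, hxΓ⟩)
    (by rwa [← Subgroup.orderOf_coe])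
    (fun g => g.2.imp (fun h => Subtype.ext h) fun h => Subtype.ext h) (z := ⟨z, hzΓ⟩)
    (fun s => Subtype.ext (hz s)) (Subtype.ext hz2) (fun h => hz1 (congrArg Subtype.val h)) (by
      rintro c hxc ⟨k, hk⟩
      replace hxc : x * c = c * x := congrArg Subtype.val hxc
      rw [← Subgroup.orderOf_coe] at hk
      have hcop : Nat.Coprime (orderOf x) (orderOf (c : G)) := by
        rw [hk]
        exact (Nat.coprime_two_right.2 hx).pow_right k
      obtain ⟨h, hh, hhy⟩ := W (x * c)
      have hpow : ∀ e : ℕ, h * (x * c) ^ e * h⁻¹ = ((x * c : G) ^ e)⁻¹ := fun e => by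
        rw [← conj_pow, hhy, inv_pow]
      have hhx : h * x * h⁻¹ = x⁻¹ := by
        obtain ⟨e, he1, he2⟩ := Nat.chineseRemainder hcop 1 0
        have h1 := hpow e
        rwa [Commute.mul_pow hxc, pow_eq_pow_iff_modEq.2 he1,
          pow_eq_pow_iff_modEq.2 he2, pow_one, pow_zero, mul_one] at h1
      have hhc : h * c * h⁻¹ = (c : G)⁻¹ := by
        obtain ⟨e, he1, he2⟩ := Nat.chineseRemainder hcop 0 1
        have h1 := hpow e
        rwa [Commute.mul_pow hxc, pow_eq_pow_iff_modEq.2 he1,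
          pow_eq_pow_iff_modEq.2 he2, pow_one, pow_zero, one_mul] at h1
      exact ⟨⟨h, Or.inr hhx⟩, Subtype.ext hh, Subtype.ext hhx, Subtype.ext hhc⟩) S
  have hsT : ∀ t ∈ T, ∃ t' ∈ T, (s : G) * t * (s : G)⁻¹ = (t' : G) := by
    intro t ht
    have h1 : (s : G) * t * (s : G)⁻¹ ∈ C := by
      rw [hC]
      have h2 : (s : G) * x * (s : G)⁻¹ = x⁻¹ := congrArg Subtype.val hsx
      have h3 : x = s * x⁻¹ * (s : G)⁻¹ := by
        have : (s : G) * x⁻¹ * (s : G)⁻¹ = ((s : G) * x * (s : G)⁻¹)⁻¹ := by group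
        rw [this, h2, inv_inv]
      have h4 : (t : G) * x⁻¹ = x⁻¹ * t := by
        rw [mul_inv_eq_iff_eq_mul, mul_assoc, eq_inv_mul_iff_mul_eq]
        exact (hC t).1 t.2
      calc x * (s * t * (s : G)⁻¹) = s * x⁻¹ * (s : G)⁻¹ * (s * t * (s : G)⁻¹) := by rw [← h3]
        _ = s * (x⁻¹ * t) * (s : G)⁻¹ := by group
        _ = s * t * (s : G)⁻¹ * (s * x⁻¹ * (s : G)⁻¹) := by rw [← h4]; group
        _ = _ := by rw [← h3]
    exact ⟨⟨_, h1⟩, hST _ (mul_mem (mul_mem hsS (hTS' t ht)) (inv_mem hsS)), rfl⟩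
  have hfin : ∃ H : Subgroup G, NoAlt H ∧ x ∈ H ∧ ∀ s : Γ, s ∈ S → (s : G) ∈ H := by
    rcases hH with ⟨t, hxt, ht2, ht1, htz, ht⟩ | ⟨H, hH, hxH, hSH⟩
    · obtain ⟨H, hH, hHt⟩ := hloc t (congrArg Subtype.val ht2) (fun h => ht1 (Subtype.ext h))
        fun h => htz (Subtype.ext h)
      refine ⟨H, hH, hHt x (Or.inl ?_), fun s hs => hHt s ?_⟩
      · rw [mul_inv_eq_iff_eq_mul]
        exact congrArg Subtype.val hxt
      · exact (ht s hs).imp (congrArg Subtype.val) (congrArg Subtype.val)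
    · refine ⟨H.map Γ.subtype, hH.of_surjective (Γ.subtype.subgroupMap H)
        (Γ.subtype.subgroupMap_surjective H), ⟨⟨x, hxΓ⟩, hxH, rfl⟩, fun s hs => ⟨s, hSH s hs, rfl⟩⟩
  obtain ⟨H, hH, hxH, hSH⟩ := hfin
  exact ⟨H, C, T, s, hC, hH, hxH, hSH s hsS, congrArg Subtype.val hsx,
    fun t ht => hSH _ (hTS' t ht), hsT⟩

end Global

section Skew

variable {F V : Type} [Field F] [AddCommGroup V] [Module F V] {B : LinearMap.BilinForm F V}
  {S : Module.End F V}

theorem aeval_sq_comm (p : Polynomial F) (v : V) :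
    S (Polynomial.aeval (S * S) p v) = Polynomial.aeval (S * S) p (S v) := by
  have h : Commute S (S * S) := (Commute.refl S).mul_right (Commute.refl S)
  have h1 : S * Polynomial.aeval (S * S) p = Polynomial.aeval (S * S) p * S := by
    induction p using Polynomial.induction_on' with
    | add p q hp hq => rw [map_add, mul_add, add_mul, hp, hq]
    | monomial n a =>
      rw [Polynomial.aeval_monomial]
      have hc : Commute S (algebraMap F (Module.End F V) a) := (Algebra.commutes a S).symm
      exact hc.mul_right (h.pow_right n)
  exact congrArg (fun f : Module.End F V => f v) h1

theorem aeval_sq_selfAdjoint (hS : ∀ u v, B (S u) v = -B u (S v)) (p : Polynomial F) (u v : V) :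
    B (Polynomial.aeval (S * S) p u) v = B u (Polynomial.aeval (S * S) p v) := by
  have hSS : ∀ n : ℕ, ∀ u v, B (((S * S) ^ n) u) v = B u (((S * S) ^ n) v) := by
    intro n
    induction n with
    | zero => intro u v; rfl
    | succ n ih =>
      intro u v
      rw [pow_succ, Module.End.mul_apply, ih, Module.End.mul_apply, hS, hS, neg_neg, ← pow_succ,
        pow_succ']
      rfl
  induction p using Polynomial.induction_on' with
  | add p q hp hq => simp only [map_add, LinearMap.add_apply, hp, hq]
  | monomial n a =>
    rw [Polynomial.aeval_monomial, Module.End.mul_apply, Module.End.mul_apply,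
      Module.algebraMap_end_apply, Module.algebraMap_end_apply, map_smul, map_smul,
      LinearMap.smul_apply, hSS]

theorem aeval_mul_apply (T : Module.End F V) (p q : Polynomial F) (v : V) :
    Polynomial.aeval T (p * q) v = Polynomial.aeval T p (Polynomial.aeval T q v) := by
  rw [map_mul, Module.End.mul_apply]

/-- In the local algebra `F[T]`, where `h(T)` is nilpotent for an irreducible `h`, every element is
zero or associated with a power of `h(T)`. -/
theorem aeval_local {T : Module.End F V} {h : Polynomial F} (hirr : Irreducible h) {e : ℕ}
    (he : Polynomial.aeval T h ^ (e + 1) = 0) (p : Polynomial F) :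
    Polynomial.aeval T p = 0 ∨ ∃ d ≤ e, ∃ p' r : Polynomial F,
      Polynomial.aeval T p = Polynomial.aeval T (p' * h ^ d) ∧
      Polynomial.aeval T (r * p) = Polynomial.aeval T (h ^ d) := by
  by_cases hp : p = 0
  · exact Or.inl (by rw [hp, map_zero])
  obtain ⟨c, hc, hhc⟩ := (FiniteMultiplicity.of_not_isUnit hirr.not_isUnit
    hp).exists_eq_pow_mul_and_not_dvd
  set d := multiplicity h p
  by_cases hd : d ≤ e
  · refine Or.inr ⟨d, hd, c, ?_⟩
    obtain ⟨a, b, hab⟩ : IsCoprime c (h ^ (e + 1)) :=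
      ((hirr.coprime_iff_not_dvd.2 hhc).symm).pow_right
    refine ⟨a, by rw [hc, mul_comm], ?_⟩
    have h1 : a * p = h ^ d - b * h ^ d * h ^ (e + 1) := by
      rw [hc]
      linear_combination h ^ d * hab
    rw [h1, map_sub, map_mul _ (b * h ^ d), map_pow _ h (e + 1), he, mul_zero, sub_zero]
  · left
    obtain ⟨k, hk⟩ : ∃ k, d = e + 1 + k := ⟨d - (e + 1), by omega⟩
    rw [hc, hk, pow_add, mul_assoc, map_mul, map_pow, he, zero_mul]

variable (S) in
/-- The cyclic submodule generated by `v` under the square of `S`. -/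
def evenSpan (v : V) : Submodule F V :=
  LinearMap.range ((Polynomial.aeval (S * S) : Polynomial F →ₐ[F] Module.End F V).toLinearMap.flip
    v)

theorem mem_evenSpan {v u : V} :
    u ∈ evenSpan S v ↔ ∃ p : Polynomial F, Polynomial.aeval (S * S) p v = u := Iff.rfl

theorem self_mem_evenSpan (v : V) : v ∈ evenSpan S v := ⟨1, by simp⟩

theorem sq_mem_evenSpan {v u : V} (hu : u ∈ evenSpan S v) : S (S u) ∈ evenSpan S v := by
  obtain ⟨p, rfl⟩ := mem_evenSpan.1 hu
  refine ⟨Polynomial.X * p, ?_⟩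
  change Polynomial.aeval (S * S) (Polynomial.X * p) v = _
  rw [aeval_mul_apply, Polynomial.aeval_X]
  rfl

theorem evenSpan_orthogonal (hB : ∀ u v, B u v = B v u) (hS : ∀ u v, B (S u) v = -B u (S v))
    (h2 : (2 : F) ≠ 0) {v u w : V} (hu : u ∈ evenSpan S v) (hw : w ∈ evenSpan S v) :
    B u (S w) = 0 := by
  obtain ⟨p, rfl⟩ := mem_evenSpan.1 hu
  obtain ⟨q, rfl⟩ := mem_evenSpan.1 hw
  have h1 : B (Polynomial.aeval (S * S) p v) (S (Polynomial.aeval (S * S) q v)) =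
      B (Polynomial.aeval (S * S) (p * q) v) (S v) := by
    rw [aeval_sq_comm, ← aeval_sq_selfAdjoint hS, ← aeval_mul_apply, mul_comm]
  have h3 : B (Polynomial.aeval (S * S) (p * q) v) (S v) =
      -B (Polynomial.aeval (S * S) (p * q) v) (S v) := by
    conv_lhs => rw [aeval_sq_selfAdjoint hS, ← aeval_sq_comm, hB, hS, hB]
    rw [hB]
  rw [h1]
  have h4 : 2 * B (Polynomial.aeval (S * S) (p * q) v) (S v) = 0 := by linear_combination h3
  exact (mul_eq_zero.1 h4).resolve_left h2

end Skew

section Indecomposable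

variable {F V : Type} [Field F] [AddCommGroup V] [Module F V]

/-- The restriction of `B` to the submodule `U` is nondegenerate. -/
def NondegOn (B : LinearMap.BilinForm F V) (U : Submodule F V) : Prop :=
  ∀ u ∈ U, (∀ v ∈ U, B u v = 0) → u = 0

/-- `P` and `N` are orthogonal, span the space and are interchanged by `S`. -/
structure IsSwapped (B : LinearMap.BilinForm F V) (S : Module.End F V) (P N : Submodule F V) :
    Prop where
  sup : P ⊔ N = ⊤
  orth : ∀ p ∈ P, ∀ n ∈ N, B p n = 0
  mapsTo_right : ∀ p ∈ P, S p ∈ N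
  mapsTo_left : ∀ n ∈ N, S n ∈ P

variable {B : LinearMap.BilinForm F V} {S : Module.End F V}

theorem exists_nondegOn_ker_pow [FiniteDimensional F V] (hB : ∀ u v, B u v = B v u)
    (hnd : ∀ u, (∀ w, B u w = 0) → u = 0)
    {T T' : Module.End F V} (hT : ∀ u v, B (T u) v = B u (T' v))
    (hk : ∀ n : ℕ, ∀ x, (T ^ n) x = 0 → (T' ^ n) x = 0) :
    ∃ n : ℕ, 0 < n ∧ NondegOn B (LinearMap.ker (T ^ n)) := by
  have hTn : ∀ n : ℕ, ∀ u v, B ((T ^ n) u) v = B u ((T' ^ n) v) := by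
    intro n
    induction n with
    | zero => intro u v; rfl
    | succ n ih =>
      intro u v
      rw [pow_succ, Module.End.mul_apply, ih, hT, pow_succ', Module.End.mul_apply]
  obtain ⟨n, hn⟩ := Filter.eventually_atTop.1 T.eventually_isCompl_ker_pow_range_pow
  refine ⟨n + 1, n.succ_pos, fun u hu huk => hnd u fun w => ?_⟩
  obtain ⟨a, ha, b, ⟨c, rfl⟩, rfl⟩ :=
    Submodule.mem_sup.1 ((hn (n + 1) n.le_succ).sup_eq_top.symm ▸ Submodule.mem_top : w ∈ _)
  rw [map_add, huk a ha, hB, hTn, hk _ _ hu, map_zero, add_zero]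

theorem aeval_nilpotent_or_injective (hB : ∀ u v, B u v = B v u)
    (hS : ∀ u v, B (S u) v = -B u (S v)) (hnd : ∀ u, (∀ w, B u w = 0) → u = 0)
    (hind : ∀ U : Submodule F V, (∀ u ∈ U, S u ∈ U) → NondegOn B U → U = ⊥ ∨ U = ⊤)
    [FiniteDimensional F V] (p : Polynomial F) :
    IsNilpotent (Polynomial.aeval (S * S) p) ∨ ∀ v, Polynomial.aeval (S * S) p v = 0 → v = 0 := by
  obtain ⟨n, hn, h⟩ := exists_nondegOn_ker_pow hB hnd (aeval_sq_selfAdjoint hS p) fun n x hx => hx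
  have hinv : ∀ u ∈ LinearMap.ker (Polynomial.aeval (S * S) p ^ n),
      S u ∈ LinearMap.ker (Polynomial.aeval (S * S) p ^ n) := by
    intro u hu
    rw [LinearMap.mem_ker, ← map_pow] at hu ⊢
    rw [← aeval_sq_comm, hu, map_zero]
  rcases hind _ hinv h with h | h
  · right
    intro v hv
    have hv' : v ∈ LinearMap.ker (Polynomial.aeval (S * S) p ^ n) := by
      obtain ⟨m, rfl⟩ := Nat.exists_eq_succ_of_ne_zero hn.ne'
      rw [LinearMap.mem_ker, pow_succ, Module.End.mul_apply, hv, map_zero]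
    rwa [h, Submodule.mem_bot] at hv'
  · exact Or.inl ⟨n, LinearMap.ker_eq_top.1 h⟩

theorem exists_irreducible_not_injective [FiniteDimensional F V] [Nontrivial V]
    (T : Module.End F V) :
    ∃ h : Polynomial F, Irreducible h ∧ ∃ v, v ≠ 0 ∧ Polynomial.aeval T h v = 0 := by
  have hint : IsIntegral F T := Algebra.IsIntegral.isIntegral T
  obtain ⟨h, hirr, c, hc⟩ := WfDvdMonoid.exists_irreducible_factor (minpoly.not_isUnit F T)
    (minpoly.ne_zero hint)
  refine ⟨h, hirr, ?_⟩
  by_contra hno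
  push Not at hno
  have hc0 : c ≠ 0 := by
    rintro rfl
    exact minpoly.ne_zero hint (by rw [hc, mul_zero])
  have hcT : Polynomial.aeval T c = 0 := by
    ext v
    by_contra hv
    refine hno _ hv ?_
    rw [← aeval_mul_apply, ← hc, minpoly.aeval, LinearMap.zero_apply]
  have hd := minpoly.dvd F T hcT
  rw [hc] at hd
  obtain ⟨k, hk⟩ := hd
  have h1 : h * k = 1 := mul_left_cancel₀ hc0 (by rw [mul_one]; linear_combination -hk)
  exact hirr.not_isUnit (IsUnit.of_mul_eq_one _ h1)

theorem exists_isSwapped_of_cyclic (hB : ∀ u v, B u v = B v u) (hS : ∀ u v, B (S u) v = -B u (S v))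
    (h2 : (2 : F) ≠ 0)
    (hind : ∀ U : Submodule F V, (∀ u ∈ U, S u ∈ U) → NondegOn B U → U = ⊥ ∨ U = ⊤)
    {v : V} (hv : v ≠ 0)
    (hev : ∀ p : Polynomial F, Polynomial.aeval (S * S) p v = 0 ∨
      ∃ r : Polynomial F, B (Polynomial.aeval (S * S) p v) (Polynomial.aeval (S * S) r v) ≠ 0)
    (hodd : ∀ q : Polynomial F, S (S (Polynomial.aeval (S * S) q v)) = 0 →
      S (Polynomial.aeval (S * S) q v) = 0) : ∃ P N, IsSwapped B S P N := by
  have horth : ∀ p ∈ evenSpan S v, ∀ n ∈ (evenSpan S v).map S, B p n = 0 := by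
    rintro p hp _ ⟨n, hn, rfl⟩
    exact evenSpan_orthogonal hB hS h2 hp hn
  have hleft : ∀ n ∈ (evenSpan S v).map S, S n ∈ evenSpan S v := by
    rintro _ ⟨n, hn, rfl⟩
    exact sq_mem_evenSpan hn
  have hnz : ∀ x ∈ evenSpan S v, (∀ w ∈ evenSpan S v, B x w = 0) → x = 0 := by
    rintro _ ⟨p, rfl⟩ hx
    rcases hev p with h | ⟨r, hr⟩
    · exact h
    · exact absurd (hx _ ⟨r, rfl⟩) hr
  refine ⟨evenSpan S v, (evenSpan S v).map S, ?_, horth,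
    fun p hp => Submodule.mem_map_of_mem hp, hleft⟩
  refine (hind _ ?_ ?_).resolve_left fun h => hv ?_
  · intro u hu
    obtain ⟨a, ha, b, hb, rfl⟩ := Submodule.mem_sup.1 hu
    rw [map_add, add_comm]
    exact Submodule.add_mem_sup (hleft b hb) (Submodule.mem_map_of_mem ha)
  · intro u hu huo
    obtain ⟨a, ha, b, ⟨c, hc, rfl⟩, rfl⟩ := Submodule.mem_sup.1 hu
    have ha0 : a = 0 := hnz a ha fun w hw => by
      have := huo w (Submodule.mem_sup_left hw)
      rwa [map_add, LinearMap.add_apply, hB (S c), horth w hw _ (Submodule.mem_map_of_mem hc),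
        add_zero] at this
    have hc0 : S (S c) = 0 := hnz _ (sq_mem_evenSpan hc) fun w hw => by
      have := huo (S w) (Submodule.mem_sup_right (Submodule.mem_map_of_mem hw))
      rw [ha0, zero_add] at this
      rw [hS, this, neg_zero]
    rw [ha0, zero_add]
    obtain ⟨q, rfl⟩ := mem_evenSpan.1 hc
    exact hodd q hc0
  · have := (le_sup_left : evenSpan S v ≤ evenSpan S v ⊔ (evenSpan S v).map S) (self_mem_evenSpan v)
    rwa [h, Submodule.mem_bot] at this

end Indecomposable

section Find

open Polynomial

variable {F V : Type} [Field F] [AddCommGroup V] [Module F V] {B : LinearMap.BilinForm F V}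
  {S : Module.End F V}

theorem exists_apply_self_ne_zero (hB : ∀ u v, B u v = B v u) (h2 : (2 : F) ≠ 0)
    (hnd : ∀ u, (∀ w, B u w = 0) → u = 0) {Q : Module.End F V}
    (hQ : ∀ u v, B (Q u) v = B u (Q v)) (hQ0 : Q ≠ 0) : ∃ v, B (Q v) v ≠ 0 := by
  by_contra! hno
  refine hQ0 (LinearMap.ext fun u => hnd _ fun w => ?_)
  have h := hno (u + w)
  simp only [map_add, LinearMap.add_apply, hno, zero_add, add_zero] at h
  rw [hQ w u, hB w (Q u)] at h
  have h4 : 2 * B (Q u) w = 0 := by linear_combination h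
  exact (mul_eq_zero.1 h4).resolve_left h2

theorem exists_orthogonal_of_notMem [FiniteDimensional F V]
    (hnd : ∀ u, (∀ w, B u w = 0) → u = 0) (hB : ∀ u v, B u v = B v u)
    {U : Submodule F V} {x : V} (hx : x ∉ U) : ∃ w, (∀ u ∈ U, B u w = 0) ∧ B x w ≠ 0 := by
  obtain ⟨f, hfx, hfU⟩ := Submodule.exists_le_ker_of_notMem hx
  have hinj : Function.Injective (B : V →ₗ[F] Module.Dual F V) :=
    (injective_iff_map_eq_zero _).2 fun u hu => hnd u fun w => by rw [hu]; rfl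
  obtain ⟨w, rfl⟩ := (LinearMap.injective_iff_surjective_of_finrank_eq_finrank
    (Subspace.dual_finrank_eq).symm).1 hinj f
  exact ⟨w, fun u hu => by rw [hB]; exact hfU hu, by rwa [hB]⟩

theorem aeval_local_pow {T : Module.End F V} {h : F[X]} (hirr : Irreducible h) {e : ℕ}
    (he : aeval T (h ^ (e + 1)) = 0) (p : F[X]) :
    aeval T p = 0 ∨ ∃ d ≤ e, (∃ p', aeval T p = aeval T (p' * h ^ d)) ∧
      (∃ r, aeval T (r * h ^ (e - d) * p) = aeval T (h ^ e)) ∧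
      ∀ k, e + 1 ≤ k + d → aeval T (h ^ k * p) = 0 := by
  rcases aeval_local hirr (by rwa [map_pow] at he) p with h0 | ⟨d, hd, p', r, hp, hr⟩
  · exact Or.inl h0
  refine Or.inr ⟨d, hd, ⟨p', hp⟩, ⟨r, ?_⟩, fun k hk => ?_⟩
  · rw [mul_right_comm, map_mul, hr, ← map_mul, ← pow_add, Nat.add_sub_cancel' hd]
  · obtain ⟨m, hm⟩ := Nat.exists_eq_add_of_le hk
    rw [map_mul, hp, ← map_mul, mul_left_comm, ← pow_add, hm, pow_add, map_mul, map_mul, he,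
      zero_mul, mul_zero]

theorem exists_isSwapped_of_local (hB : ∀ u v, B u v = B v u) (hS : ∀ u v, B (S u) v = -B u (S v))
    (h2 : (2 : F) ≠ 0) (hnd : ∀ u, (∀ w, B u w = 0) → u = 0)
    (hind : ∀ U : Submodule F V, (∀ u ∈ U, S u ∈ U) → NondegOn B U → U = ⊥ ∨ U = ⊤)
    {h : F[X]} (hirr : Irreducible h) {e : ℕ}
    (hne : aeval (S * S) (h ^ e) ≠ 0) (he : aeval (S * S) (h ^ (e + 1)) = 0)
    (hodd : ∀ v, aeval (S * S) (h ^ e) v ≠ 0 → ∀ q : F[X],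
      S (S (aeval (S * S) q v)) = 0 → S (aeval (S * S) q v) = 0) :
    ∃ P N, IsSwapped B S P N := by
  obtain ⟨v, hv⟩ := exists_apply_self_ne_zero hB h2 hnd (aeval_sq_selfAdjoint hS (h ^ e)) hne
  have hv0 : aeval (S * S) (h ^ e) v ≠ 0 := fun h0 => hv (by rw [h0, map_zero]; rfl)
  refine exists_isSwapped_of_cyclic hB hS h2 hind (v := v) ?_ (fun p => ?_) (hodd v hv0)
  · rintro rfl
    exact hv0 (map_zero _)
  · rcases aeval_local_pow hirr he p with h0 | ⟨d, -, -, ⟨r, hr⟩, -⟩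
    · exact Or.inl (by rw [h0]; rfl)
    · refine Or.inr ⟨r * h ^ (e - d), ?_⟩
      rwa [← aeval_sq_selfAdjoint hS, ← aeval_mul_apply, hr]

theorem aeval_odd_skew (hB : ∀ u v, B u v = B v u) (hS : ∀ u v, B (S u) v = -B u (S v))
    (p : F[X]) (u v : V) :
    B (S (aeval (S * S) p u)) v = -B (S (aeval (S * S) p v)) u := by
  rw [aeval_sq_comm, aeval_sq_selfAdjoint hS, hS, hB]

theorem eq_zero_of_orthogonal_pair (hB : ∀ u v, B u v = B v u) (hS : ∀ u v, B (S u) v = -B u (S v))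
    {e : ℕ} (he : aeval (S * S) ((X : F[X]) ^ (e + 1)) = 0)
    {v w : V} (hvw : B (S (aeval (S * S) ((X : F[X]) ^ e) v)) w ≠ 0) {u : V}
    (hu : u ∈ evenSpan S v ⊔ (evenSpan S w).map S)
    (huo : ∀ x ∈ evenSpan S v ⊔ (evenSpan S w).map S, B u x = 0) : u = 0 := by
  obtain ⟨_, ⟨p, rfl⟩, _, ⟨_, ⟨s, rfl⟩, rfl⟩, rfl⟩ := Submodule.mem_sup.1 hu
  change aeval (S * S) p v + S (aeval (S * S) s w) = 0
  have hv : ∀ x : F[X], B (aeval (S * S) (x * p) v) v + B (S (aeval (S * S) (x * s) w)) v = 0 := by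
    intro x
    have := huo (aeval (S * S) x v) (Submodule.mem_sup_left ⟨x, rfl⟩)
    change B (aeval (S * S) p v + S (aeval (S * S) s w)) _ = 0 at this
    rwa [map_add, LinearMap.add_apply, ← aeval_sq_selfAdjoint hS, ← aeval_sq_selfAdjoint hS,
      ← aeval_sq_comm, ← aeval_mul_apply, ← aeval_mul_apply] at this
  have hw : ∀ x : F[X],
      B (aeval (S * S) (x * p) v) (S w) - B (aeval (S * S) (X * x * s) w) w = 0 := by
    intro x
    have := huo (S (aeval (S * S) x w)) (Submodule.mem_sup_right
      (Submodule.mem_map_of_mem ⟨x, rfl⟩))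
    change B (aeval (S * S) p v + S (aeval (S * S) s w)) _ = 0 at this
    have h3 : B (aeval (S * S) (X * x * s) w) w =
        B (aeval (S * S) s w) (S (S (aeval (S * S) x w))) := by
      rw [aeval_mul_apply, aeval_sq_selfAdjoint hS, aeval_mul_apply, aeval_X, Module.End.mul_apply]
    rwa [map_add, LinearMap.add_apply, hS (aeval (S * S) s w), ← h3, aeval_sq_comm,
      ← aeval_sq_selfAdjoint hS, ← aeval_mul_apply, ← sub_eq_add_neg] at this
  have hwv : B (S (aeval (S * S) ((X : F[X]) ^ e) w)) v ≠ 0 := by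
    rwa [aeval_odd_skew hB hS, neg_ne_zero]
  have hvw' : B (aeval (S * S) ((X : F[X]) ^ e) v) (S w) ≠ 0 := by
    rwa [hS, neg_ne_zero] at hvw
  have hX := irreducible_X (R := F)
  by_cases hcase : aeval (S * S) p = 0 ∧ aeval (S * S) s = 0
  · rw [hcase.1, hcase.2, LinearMap.zero_apply, LinearMap.zero_apply, map_zero, add_zero]
  exfalso
  rcases aeval_local_pow hX he p with hp | ⟨d, hd, -, ⟨r, hr⟩, hdk⟩ <;>
  rcases aeval_local_pow hX he s with hs | ⟨d', hd', -, ⟨r', hr'⟩, hdk'⟩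
  · exact hcase ⟨hp, hs⟩
  · have := hv (r' * X ^ (e - d'))
    rw [hr', map_mul, hp, mul_zero, LinearMap.zero_apply, map_zero, LinearMap.zero_apply,
      zero_add] at this
    exact hwv this
  · have := hw (r * X ^ (e - d))
    rw [hr, map_mul _ _ s, hs, mul_zero, LinearMap.zero_apply, map_zero, LinearMap.zero_apply,
      sub_zero] at this
    exact hvw' this
  · rcases le_or_gt d d' with hdd | hdd
    · have := hw (r * X ^ (e - d))
      rw [hr, show X * (r * X ^ (e - d)) * s = r * (X ^ (e - d + 1) * s) by ring, map_mul _ r,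
        hdk' _ (by omega), mul_zero, LinearMap.zero_apply, map_zero, LinearMap.zero_apply,
        sub_zero] at this
      exact hvw' this
    · have := hv (r' * X ^ (e - d'))
      rw [hr', mul_assoc, map_mul _ r', hdk _ (by omega), mul_zero, LinearMap.zero_apply, map_zero,
        LinearMap.zero_apply, zero_add] at this
      exact hwv this

theorem exists_isSwapped_of_odd (hB : ∀ u v, B u v = B v u) (hS : ∀ u v, B (S u) v = -B u (S v))
    (h2 : (2 : F) ≠ 0) (hnd : ∀ u, (∀ w, B u w = 0) → u = 0)
    (hind : ∀ U : Submodule F V, (∀ u ∈ U, S u ∈ U) → NondegOn B U → U = ⊥ ∨ U = ⊤)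
    [FiniteDimensional F V] {e : ℕ}
    (he : aeval (S * S) ((X : F[X]) ^ (e + 1)) = 0)
    {v : V} (hv : S (aeval (S * S) ((X : F[X]) ^ e) v) ≠ 0) : ∃ P N, IsSwapped B S P N := by
  have hnot : S (aeval (S * S) ((X : F[X]) ^ e) v) ∉ evenSpan S v := by
    rintro ⟨p, hp⟩
    change aeval (S * S) p v = _ at hp
    rcases aeval_local_pow irreducible_X he p with h0 | ⟨d, hd, -, ⟨r, hr⟩, -⟩
    · rw [h0] at hp
      exact hv hp.symm
    · refine hv ?_
      rw [← hr, aeval_mul_apply, hp, ← aeval_sq_comm, ← Module.End.mul_apply S S,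
        ← aeval_X (R := F) (S * S), aeval_X, ← aeval_mul_apply]
      have : (S * S) (aeval (S * S) (r * X ^ (e - d) * X ^ e) v) =
          aeval (S * S) (r * X ^ (e - d) * X ^ (e + 1)) v := by
        rw [show r * X ^ (e - d) * X ^ (e + 1) = X * (r * X ^ (e - d) * X ^ e) by ring,
          aeval_mul_apply _ X, aeval_X]
      rw [this, map_mul, he, mul_zero]
      rfl
  obtain ⟨w, hw, hvw⟩ := exists_orthogonal_of_notMem hnd hB hnot
  have hEE : ∀ a ∈ evenSpan S v, ∀ b ∈ evenSpan S w, B a b = 0 := by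
    rintro _ ⟨p, rfl⟩ _ ⟨q, rfl⟩
    change B (aeval (S * S) p v) (aeval (S * S) q w) = 0
    rw [← aeval_sq_selfAdjoint hS, ← aeval_mul_apply]
    exact hw _ ⟨_, rfl⟩
  have horth : ∀ a ∈ evenSpan S v ⊔ (evenSpan S w).map S,
      ∀ b ∈ evenSpan S w ⊔ (evenSpan S v).map S, B a b = 0 := by
    intro a ha b hb
    obtain ⟨a, hav, _, ⟨a', ha', rfl⟩, rfl⟩ := Submodule.mem_sup.1 ha
    obtain ⟨b, hbw, _, ⟨b', hb', rfl⟩, rfl⟩ := Submodule.mem_sup.1 hb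
    simp only [map_add, LinearMap.add_apply]
    rw [hEE a hav b hbw, evenSpan_orthogonal hB hS h2 hav hb', hB (S a') b,
      evenSpan_orthogonal hB hS h2 hbw ha', hS, hB, hEE _ (sq_mem_evenSpan hb') a' ha']
    simp
  have hmaps : ∀ x y : V, ∀ a ∈ evenSpan S x ⊔ (evenSpan S y).map S,
      S a ∈ evenSpan S y ⊔ (evenSpan S x).map S := by
    intro x y a ha
    obtain ⟨a, hax, _, ⟨a', ha', rfl⟩, rfl⟩ := Submodule.mem_sup.1 ha
    rw [map_add, add_comm]
    exact Submodule.add_mem_sup (sq_mem_evenSpan ha') (Submodule.mem_map_of_mem hax)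
  have hwv : B (S (aeval (S * S) ((X : F[X]) ^ e) w)) v ≠ 0 := by
    rwa [aeval_odd_skew hB hS, neg_ne_zero]
  refine ⟨_, _, ?_, horth, hmaps v w, hmaps w v⟩
  refine (hind _ ?_ ?_).resolve_left fun h => hv ?_
  · intro u hu
    obtain ⟨a, ha, b, hb, rfl⟩ := Submodule.mem_sup.1 hu
    rw [map_add, add_comm]
    exact Submodule.add_mem_sup (hmaps w v b hb) (hmaps v w a ha)
  · intro u hu huo
    obtain ⟨a, ha, b, hb, rfl⟩ := Submodule.mem_sup.1 hu
    have ha0 : a = 0 := eq_zero_of_orthogonal_pair hB hS he hvw ha fun x hx => by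
      have := huo x (Submodule.mem_sup_left hx)
      rwa [map_add, LinearMap.add_apply, hB b, horth x hx b hb, add_zero] at this
    have hb0 : b = 0 := eq_zero_of_orthogonal_pair hB hS he hwv hb fun x hx => by
      have := huo x (Submodule.mem_sup_right hx)
      rwa [map_add, LinearMap.add_apply, horth a ha x hx, zero_add] at this
    rw [ha0, hb0, add_zero]
  · have := sup_eq_bot_iff.1 h
    have h3 := self_mem_evenSpan (S := S) v
    rw [(sup_eq_bot_iff.1 this.1).1, Submodule.mem_bot] at h3
    rw [h3, map_zero, map_zero]

theorem exists_isSwapped (hB : ∀ u v, B u v = B v u) (hS : ∀ u v, B (S u) v = -B u (S v))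
    (h2 : (2 : F) ≠ 0) (hnd : ∀ u, (∀ w, B u w = 0) → u = 0)
    (hind : ∀ U : Submodule F V, (∀ u ∈ U, S u ∈ U) → NondegOn B U → U = ⊥ ∨ U = ⊤)
    [FiniteDimensional F V] [Nontrivial V] : ∃ P N, IsSwapped B S P N := by
  have key : ∀ h : F[X], (∃ v, v ≠ 0 ∧ aeval (S * S) h v = 0) →
      ∃ e, aeval (S * S) (h ^ e) ≠ 0 ∧ aeval (S * S) (h ^ (e + 1)) = 0 := by
    rintro h ⟨v, hv, hhv⟩
    have hnil : IsNilpotent (aeval (S * S) h) :=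
      (aeval_nilpotent_or_injective hB hS hnd hind h).resolve_right fun hi => hv (hi v hhv)
    obtain ⟨e, he⟩ := Nat.exists_eq_succ_of_ne_zero (pos_nilpotencyClass_iff.2 hnil).ne'
    obtain ⟨h1, h3⟩ := nilpotencyClass_eq_succ_iff.1 he
    exact ⟨e, by rwa [map_pow], by rwa [map_pow]⟩
  by_cases hinj : ∀ v, S v = 0 → v = 0
  · obtain ⟨h, hirr, hv⟩ := exists_irreducible_not_injective (S * S)
    obtain ⟨e, h0, h1⟩ := key h hv
    exact exists_isSwapped_of_local hB hS h2 hnd hind hirr h0 h1 fun v _ q hq => hinj _ hq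
  push Not at hinj
  obtain ⟨v, hv, hv0⟩ := hinj
  obtain ⟨e, h0, h1⟩ := key X ⟨v, hv0, by rw [aeval_X, Module.End.mul_apply, hv, map_zero]⟩
  by_cases hodd : ∃ v, S (aeval (S * S) ((X : F[X]) ^ e) v) ≠ 0
  · obtain ⟨v, hv⟩ := hodd
    exact exists_isSwapped_of_odd hB hS h2 hnd hind h1 hv
  push Not at hodd
  refine exists_isSwapped_of_local hB hS h2 hnd hind irreducible_X h0 h1 fun v hv q hq => ?_
  rcases aeval_local_pow irreducible_X h1 q with hq0 | ⟨d, hd, ⟨q', hq'⟩, ⟨r, hr⟩, -⟩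
  · rw [hq0, LinearMap.zero_apply, map_zero]
  · rcases hd.lt_or_eq with hd | rfl
    · refine absurd ?_ hv
      obtain ⟨k, hk⟩ : ∃ k, e - d = k + 1 := ⟨e - d - 1, by omega⟩
      rw [← hr, hk, show r * X ^ (k + 1) * q = r * X ^ k * (X * q) by ring, aeval_mul_apply,
        aeval_mul_apply _ X, aeval_X, Module.End.mul_apply, hq, map_zero]
    · rw [hq', aeval_mul_apply, aeval_sq_comm, hodd, map_zero]

end Find

section Cayley

/-- `P` and `N` are orthogonal, span the space, are preserved by `y + y'` and are interchanged by
`y - y'`. -/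
structure IsReflected {F V : Type} [Field F] [AddCommGroup V] [Module F V]
    (B : LinearMap.BilinForm F V) (y y' : Module.End F V) (P N : Submodule F V) : Prop where
  sup : P ⊔ N = ⊤
  orth : ∀ p ∈ P, ∀ n ∈ N, B p n = 0
  add_left : ∀ p ∈ P, y p + y' p ∈ P
  add_right : ∀ n ∈ N, y n + y' n ∈ N
  sub_left : ∀ p ∈ P, y p - y' p ∈ N
  sub_right : ∀ n ∈ N, y n - y' n ∈ P

variable {F V : Type} [Field F] [AddCommGroup V] [Module F V] {B : LinearMap.BilinForm F V}
  {y y' : Module.End F V}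

theorem IsReflected.of_neg {P N : Submodule F V} (h : IsReflected B (-y) (-y') P N) :
    IsReflected B y y' P N where
  sup := h.sup
  orth := h.orth
  add_left p hp := by simpa [add_comm] using neg_mem (h.add_left p hp)
  add_right p hp := by simpa [add_comm] using neg_mem (h.add_right p hp)
  sub_left p hp := by simpa [add_comm, sub_eq_add_neg] using neg_mem (h.sub_left p hp)
  sub_right p hp := by simpa [add_comm, sub_eq_add_neg] using neg_mem (h.sub_right p hp)

theorem exists_mem_eq_of_injective [FiniteDimensional F V] {T : Module.End F V}
    (hT : ∀ v, T v = 0 → v = 0) {U : Submodule F V} (hU : ∀ u ∈ U, T u ∈ U) {u : V} (hu : u ∈ U) :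
    ∃ x ∈ U, T x = u := by
  have hinj : Function.Injective (T.restrict hU) :=
    (injective_iff_map_eq_zero _).2 fun a ha => Subtype.ext (hT a (congrArg Subtype.val ha))
  obtain ⟨x, hx⟩ := LinearMap.injective_iff_surjective.1 hinj ⟨u, hu⟩
  exact ⟨x, x.2, congrArg Subtype.val hx⟩

variable [FiniteDimensional F V]

theorem exists_isReflected_of_injective (hB : ∀ u v, B u v = B v u) (h2 : (2 : F) ≠ 0)
    (hnd : ∀ u, (∀ w, B u w = 0) → u = 0) (hy : ∀ u v, B (y u) v = B u (y' v))
    (hy'y : ∀ v, y' (y v) = v)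
    (hind : ∀ U : Submodule F V, (∀ u ∈ U, y u ∈ U) → NondegOn B U → U = ⊥ ∨ U = ⊤)
    [Nontrivial V] (hinj : ∀ v, y v + v = 0 → v = 0) :
    ∃ P N, IsReflected B y y' P N := by
  have hb : Function.Bijective (y + 1 : Module.End F V) := by
    have h := (injective_iff_map_eq_zero (y + 1 : Module.End F V)).2 hinj
    exact ⟨h, LinearMap.injective_iff_surjective.1 h⟩
  set S : Module.End F V := (y - 1) ∘ₗ (LinearEquiv.ofBijective _ hb).symm.toLinearMap with hSdef
  have hSa : ∀ a, S (y a + a) = y a - a := by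
    intro a
    have h : (LinearEquiv.ofBijective _ hb).symm (y a + a) = a :=
      (LinearEquiv.symm_apply_eq _).2 rfl
    rw [hSdef, LinearMap.comp_apply, LinearEquiv.coe_coe, h]
    rfl
  have hsurj : ∀ x, ∃ a, y a + a = x := hb.2
  have hS : ∀ u v, B (S u) v = -B u (S v) := by
    intro u v
    obtain ⟨a, rfl⟩ := hsurj u
    obtain ⟨b, rfl⟩ := hsurj v
    rw [hSa, hSa]
    have h1 : B (y a) (y b) = B a b := by rw [hy, hy'y]
    simp only [map_add, map_sub, LinearMap.add_apply, LinearMap.sub_apply, h1]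
    ring
  have hyS : ∀ x, y (x - S x) = x + S x := by
    intro x
    obtain ⟨a, rfl⟩ := hsurj x
    rw [hSa]
    simp only [map_sub, map_add]
    abel
  have hy0 : ∀ v, y v = 0 → v = 0 := fun v hv => by rw [← hy'y v, hv, map_zero]
  have h2' : ∀ v : V, v + v = 0 → v = 0 := fun v hv => by
    rw [← two_smul F] at hv
    exact (smul_eq_zero.1 hv).resolve_left h2
  have hsub : ∀ x, x - S x = 0 → x = 0 := by
    intro x hx
    have h3 := hyS x
    rw [hx, map_zero, ← sub_eq_zero.1 hx] at h3
    exact h2' x h3.symm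
  have hadd : ∀ x, x + S x = 0 → x = 0 := fun x hx => hsub x (hy0 _ (by rw [hyS, hx]))
  have hindS : ∀ U : Submodule F V, (∀ u ∈ U, S u ∈ U) → NondegOn B U → U = ⊥ ∨ U = ⊤ := by
    refine fun U hU hUn => hind U (fun u hu => ?_) hUn
    obtain ⟨x, hx, rfl⟩ := exists_mem_eq_of_injective (T := 1 - S) hsub
      (fun u hu => sub_mem hu (hU u hu)) hu
    change y (x - S x) ∈ U
    rw [hyS]
    exact add_mem hx (hU x hx)
  obtain ⟨P, N, h⟩ := exists_isSwapped hB hS h2 hnd hindS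
  have hinj2 : ∀ v, (1 - S * S) v = 0 → v = 0 := by
    intro v hv
    refine hsub v (hadd _ ?_)
    rw [← hv]
    simp
  have key : ∀ x, y ((1 - S * S) x) = x + S x + (S x + S (S x)) ∧
      y' ((1 - S * S) x) = x - S x - (S x - S (S x)) := by
    intro x
    constructor
    · rw [show (1 - S * S) x = x + S x - S (x + S x) by simp; abel, hyS, map_add]
    · rw [show (1 - S * S) x = x - S x + S (x - S x) by simp, ← hyS, hy'y, map_sub]
  have hmem : ∀ U W : Submodule F V, (∀ u ∈ U, S u ∈ W) → (∀ w ∈ W, S w ∈ U) → ∀ u ∈ U,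
      y u + y' u ∈ U ∧ y u - y' u ∈ W := by
    intro U W hUW hWU u hu
    obtain ⟨x, hx, rfl⟩ := exists_mem_eq_of_injective hinj2
      (fun u hu => sub_mem hu (hWU _ (hUW u hu))) hu
    rw [(key x).1, (key x).2]
    constructor
    · rw [show x + S x + (S x + S (S x)) + (x - S x - (S x - S (S x))) =
        (x + x) + (S (S x) + S (S x)) by abel]
      have := hWU _ (hUW x hx)
      exact add_mem (add_mem hx hx) (add_mem this this)
    · rw [show x + S x + (S x + S (S x)) - (x - S x - (S x - S (S x))) =
        (S x + S x) + (S x + S x) by abel]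
      have := hUW x hx
      exact add_mem (add_mem this this) (add_mem this this)
  exact ⟨P, N, h.sup, h.orth,
    fun p hp => (hmem P N h.mapsTo_right h.mapsTo_left p hp).1,
    fun p hp => (hmem N P h.mapsTo_left h.mapsTo_right p hp).1,
    fun p hp => (hmem P N h.mapsTo_right h.mapsTo_left p hp).2,
    fun p hp => (hmem N P h.mapsTo_left h.mapsTo_right p hp).2⟩

theorem exists_isReflected_of_indecomposable (hB : ∀ u v, B u v = B v u) (h2 : (2 : F) ≠ 0)
    (hnd : ∀ u, (∀ w, B u w = 0) → u = 0) (hy : ∀ u v, B (y u) v = B u (y' v))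
    (hyy' : ∀ v, y (y' v) = v) (hy'y : ∀ v, y' (y v) = v)
    (hind : ∀ U : Submodule F V, (∀ u ∈ U, y u ∈ U) → NondegOn B U → U = ⊥ ∨ U = ⊤)
    [Nontrivial V] : ∃ P N, IsReflected B y y' P N := by
  have hcomm : Commute y' (y + 1) := by
    refine Commute.add_right ?_ (Commute.one_right _)
    ext v
    exact (hy'y v).trans (hyy' v).symm
  have hy1 : y' + 1 = y' * (y + 1) := by
    ext v
    change y' v + v = y' (y v + v)
    rw [map_add, hy'y, add_comm]
  obtain ⟨n, hn, h⟩ := exists_nondegOn_ker_pow (T := y + 1) (T' := y' + 1) hB hnd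
    (fun u v => by simp [hy]) (fun n x hx => by
      rw [hy1, hcomm.mul_pow, Module.End.mul_apply, hx, map_zero])
  have hinv : ∀ u ∈ LinearMap.ker ((y + 1) ^ n), y u ∈ LinearMap.ker ((y + 1) ^ n) := by
    intro u hu
    rw [LinearMap.mem_ker] at hu ⊢
    have hc : Commute ((y + 1) ^ n) y :=
      ((Commute.refl y).add_left (Commute.one_left y)).pow_left n
    rw [← Module.End.mul_apply, hc.eq, Module.End.mul_apply, hu, map_zero]
  rcases hind _ hinv h with h | h
  · refine exists_isReflected_of_injective hB h2 hnd hy hy'y hind fun v hv => ?_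
    have hv' : v ∈ LinearMap.ker ((y + 1) ^ n) := by
      obtain ⟨m, rfl⟩ := Nat.exists_eq_succ_of_ne_zero hn.ne'
      rw [LinearMap.mem_ker, pow_succ, Module.End.mul_apply]
      change ((y + 1) ^ m) (y v + v) = 0
      rw [hv, map_zero]
    rwa [h, Submodule.mem_bot] at hv'
  · obtain ⟨P, N, hPN⟩ := exists_isReflected_of_injective (B := B) (y := -y) (y' := -y') hB h2 hnd
      (fun u v => by simp [hy]) (fun v => by simp [hy'y])
      (fun U hU => hind U fun u hu => by simpa using neg_mem (hU u hu)) fun v hv => by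
        have hyv : y v = v := by
          rw [LinearMap.neg_apply, neg_add_eq_zero] at hv
          exact hv
        have hpow : ∀ m : ℕ, ((y + 1) ^ m) v = (2 : F) ^ m • v := by
          intro m
          induction m with
          | zero => simp
          | succ m ih =>
            rw [pow_succ', Module.End.mul_apply, ih, map_smul, pow_succ, mul_smul, two_smul]
            congr 1
            change y v + v = _
            rw [hyv]
        have h0 := hpow n
        rw [LinearMap.ker_eq_top.1 h, LinearMap.zero_apply] at h0
        exact (smul_eq_zero.1 h0.symm).resolve_left (pow_ne_zero n h2)
    exact ⟨P, N, hPN.of_neg⟩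

end Cayley

section Glue

variable {F V : Type} [Field F] [AddCommGroup V] [Module F V] {B : LinearMap.BilinForm F V}
  {y y' : Module.End F V}

theorem IsReflected.glue {U W : Submodule F V} (hUW : U ⊔ W = ⊤)
    (horth : ∀ u ∈ U, ∀ w ∈ W, B u w = 0) (hB : ∀ u v, B u v = B v u)
    {hU : ∀ u ∈ U, y u ∈ U} {hU' : ∀ u ∈ U, y' u ∈ U}
    {hW : ∀ u ∈ W, y u ∈ W} {hW' : ∀ u ∈ W, y' u ∈ W} {P N : Submodule F U}
    {P' N' : Submodule F W}
    (h : IsReflected (B.restrict U) (y.restrict hU) (y'.restrict hU') P N)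
    (h' : IsReflected (B.restrict W) (y.restrict hW) (y'.restrict hW') P' N') :
    IsReflected B y y' (P.map U.subtype ⊔ P'.map W.subtype)
      (N.map U.subtype ⊔ N'.map W.subtype) where
  sup := by
    rw [sup_sup_sup_comm, ← Submodule.map_sup, ← Submodule.map_sup, h.sup, h'.sup,
      Submodule.map_subtype_top, Submodule.map_subtype_top, hUW]
  orth := by
    intro p hp n hn
    obtain ⟨_, ⟨a, ha, rfl⟩, _, ⟨b, hb, rfl⟩, rfl⟩ := Submodule.mem_sup.1 hp
    obtain ⟨_, ⟨c, hc, rfl⟩, _, ⟨d, hd, rfl⟩, rfl⟩ := Submodule.mem_sup.1 hn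
    have h1 : B a c = 0 := h.orth a ha c hc
    have h2 : B b d = 0 := h'.orth b hb d hd
    simp [h1, h2, horth a a.2 d d.2, hB b c, horth c c.2 b b.2]
  add_left := by
    intro p hp
    obtain ⟨_, ⟨a, ha, rfl⟩, _, ⟨b, hb, rfl⟩, rfl⟩ := Submodule.mem_sup.1 hp
    rw [map_add, map_add, add_add_add_comm]
    exact Submodule.add_mem_sup ⟨_, h.add_left a ha, rfl⟩ ⟨_, h'.add_left b hb, rfl⟩
  add_right := by
    intro p hp
    obtain ⟨_, ⟨a, ha, rfl⟩, _, ⟨b, hb, rfl⟩, rfl⟩ := Submodule.mem_sup.1 hp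
    rw [map_add, map_add, add_add_add_comm]
    exact Submodule.add_mem_sup ⟨_, h.add_right a ha, rfl⟩ ⟨_, h'.add_right b hb, rfl⟩
  sub_left := by
    intro p hp
    obtain ⟨_, ⟨a, ha, rfl⟩, _, ⟨b, hb, rfl⟩, rfl⟩ := Submodule.mem_sup.1 hp
    rw [map_add, map_add, add_sub_add_comm]
    exact Submodule.add_mem_sup ⟨_, h.sub_left a ha, rfl⟩ ⟨_, h'.sub_left b hb, rfl⟩
  sub_right := by
    intro p hp
    obtain ⟨_, ⟨a, ha, rfl⟩, _, ⟨b, hb, rfl⟩, rfl⟩ := Submodule.mem_sup.1 hp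
    rw [map_add, map_add, add_sub_add_comm]
    exact Submodule.add_mem_sup ⟨_, h.sub_right a ha, rfl⟩ ⟨_, h'.sub_right b hb, rfl⟩

theorem NondegOn.sup_orthogonal [FiniteDimensional F V] (hB : ∀ u v, B u v = B v u)
    {U : Submodule F V} (hU : NondegOn B U) : U ⊔ B.orthogonal U = ⊤ := by
  refine eq_top_iff.2 fun v _ => ?_
  have hinj : Function.Injective (B.restrict U : U →ₗ[F] Module.Dual F U) :=
    (injective_iff_map_eq_zero _).2 fun u hu => Subtype.ext <| hU u u.2 fun w hw =>
      congrArg (fun f : Module.Dual F U => f ⟨w, hw⟩) hu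
  obtain ⟨u, hu⟩ := (LinearMap.injective_iff_surjective_of_finrank_eq_finrank
    (Subspace.dual_finrank_eq).symm).1 hinj ((B v).comp U.subtype)
  refine Submodule.mem_sup.2 ⟨u, u.2, v - u, ?_, by abel⟩
  intro w hw
  have := congrArg (fun f : Module.Dual F U => f ⟨w, hw⟩) hu
  change B u w = B v w at this
  change B w (v - u) = 0
  rw [map_sub, hB w, hB w, this, sub_self]

theorem NondegOn.orthogonal [FiniteDimensional F V] (hB : ∀ u v, B u v = B v u)
    (hnd : ∀ u, (∀ w, B u w = 0) → u = 0)
    {U : Submodule F V} (hU : NondegOn B U) : NondegOn B (B.orthogonal U) := by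
  refine fun x hx hxo => hnd x fun w => ?_
  obtain ⟨a, ha, b, hb, rfl⟩ := Submodule.mem_sup.1
    ((hU.sup_orthogonal hB).symm ▸ Submodule.mem_top : w ∈ _)
  rw [map_add, hB x a, hx a ha, hxo b hb, add_zero]

theorem exists_isReflected [FiniteDimensional F V] (hB : ∀ u v, B u v = B v u) (h2 : (2 : F) ≠ 0)
    (hnd : ∀ u, (∀ w, B u w = 0) → u = 0) (hy : ∀ u v, B (y u) v = B u (y' v))
    (hyy' : ∀ v, y (y' v) = v) (hy'y : ∀ v, y' (y v) = v) : ∃ P N, IsReflected B y y' P N := by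
  induction hn : Module.finrank F V using Nat.strong_induction_on generalizing V with
  | _ n ih =>
  subst hn
  rcases subsingleton_or_nontrivial V with hV | hV
  · refine ⟨⊤, ⊤, by simp, fun p _ n _ => ?_, ?_, ?_, ?_, ?_⟩
    · rw [Subsingleton.elim p 0, map_zero, LinearMap.zero_apply]
    all_goals exact fun _ _ => Submodule.mem_top
  by_cases hind : ∀ U : Submodule F V, (∀ u ∈ U, y u ∈ U) → NondegOn B U → U = ⊥ ∨ U = ⊤
  · exact exists_isReflected_of_indecomposable hB h2 hnd hy hyy' hy'y hind
  push Not at hind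
  obtain ⟨U, hU, hUn, hU0, hU1⟩ := hind
  have hy0 : ∀ v, y v = 0 → v = 0 := fun v hv => by rw [← hy'y v, hv, map_zero]
  have hU' : ∀ u ∈ U, y' u ∈ U := by
    intro u hu
    obtain ⟨x, hx, rfl⟩ := exists_mem_eq_of_injective hy0 hU hu
    rwa [hy'y]
  have hW : ∀ w ∈ B.orthogonal U, y w ∈ B.orthogonal U := by
    intro w hw u hu
    change B u (y w) = 0
    rw [hB, hy, hB]
    exact hw _ (hU' u hu)
  have hW' : ∀ w ∈ B.orthogonal U, y' w ∈ B.orthogonal U := by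
    intro w hw u hu
    change B u (y' w) = 0
    rw [← hy]
    exact hw _ (hU u hu)
  have hWn := hUn.orthogonal hB hnd
  have hsup := hUn.sup_orthogonal hB
  have hW1 : B.orthogonal U ≠ ⊤ := by
    intro h
    refine hU0 ((Submodule.eq_bot_iff U).2 fun u hu => hUn u hu fun v hv => ?_)
    exact (h.symm ▸ Submodule.mem_top : v ∈ B.orthogonal U) u hu
  have sub : ∀ (U : Submodule F V) (hU : ∀ u ∈ U, y u ∈ U) (hU' : ∀ u ∈ U, y' u ∈ U),
      NondegOn B U → U ≠ ⊤ →
      ∃ P N, IsReflected (B.restrict U) (y.restrict hU) (y'.restrict hU') P N := by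
    intro U hU hU' hUn hU1
    exact ih _ (Submodule.finrank_lt hU1) (fun u v => hB u v)
      (fun u hu => Subtype.ext (hUn u u.2 fun v hv => hu ⟨v, hv⟩)) (fun u v => hy u v)
      (fun v => Subtype.ext (hyy' v)) (fun v => Subtype.ext (hy'y v)) rfl
  obtain ⟨P, N, hPN⟩ := sub U hU hU' hUn hU1
  obtain ⟨P', N', hPN'⟩ := sub _ hW hW' hWn hW1
  exact ⟨_, _, hPN.glue hsup (fun u hu w hw => hw u hu) hB hPN'⟩

/-- Wonenburger's theorem: every isometry of a nondegenerate symmetric form is inverted by an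
isometric involution. -/
theorem exists_involution_inverting [FiniteDimensional F V] (hB : ∀ u v, B u v = B v u)
    (h2 : (2 : F) ≠ 0) (hnd : ∀ u, (∀ w, B u w = 0) → u = 0) (hy : ∀ u v, B (y u) v = B u (y' v))
    (hyy' : ∀ v, y (y' v) = v) (hy'y : ∀ v, y' (y v) = v) :
    ∃ h : Module.End F V, (∀ v, h (h v) = v) ∧ (∀ u v, B (h u) (h v) = B u v) ∧
      ∀ v, h (y v) = y' (h v) := by
  obtain ⟨P, N, hPN⟩ := exists_isReflected hB h2 hnd hy hyy' hy'y
  have hdisj : IsCompl P N := by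
    refine ⟨Submodule.disjoint_def.2 fun x hxP hxN => hnd x fun w => ?_,
      codisjoint_iff.2 hPN.sup⟩
    obtain ⟨a, ha, b, hb, rfl⟩ := Submodule.mem_sup.1 (hPN.sup.symm ▸ Submodule.mem_top : w ∈ _)
    rw [map_add, hB x a, hPN.orth a ha x hxN, hPN.orth x hxP b hb, add_zero]
  set h : Module.End F V := LinearMap.ofIsCompl hdisj P.subtype (-N.subtype) with hh
  have hP : ∀ p ∈ P, h p = p := fun p hp => LinearMap.ofIsCompl_apply_left hdisj ⟨p, hp⟩
  have hN : ∀ n ∈ N, h n = -n := fun n hn => LinearMap.ofIsCompl_apply_right hdisj ⟨n, hn⟩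
  have hdec : ∀ v, ∃ a ∈ P, ∃ b ∈ N, a + b = v := fun v =>
    Submodule.mem_sup.1 (hPN.sup.symm ▸ Submodule.mem_top : v ∈ _)
  refine ⟨h, fun v => ?_, fun u v => ?_, fun v => ?_⟩
  · obtain ⟨a, ha, b, hb, rfl⟩ := hdec v
    rw [map_add, hP a ha, hN b hb, map_add, map_neg, hP a ha, hN b hb, neg_neg]
  · obtain ⟨a, ha, b, hb, rfl⟩ := hdec v
    obtain ⟨c, hc, d, hd, rfl⟩ := hdec u
    rw [map_add h a, hP a ha, hN b hb, map_add h c, hP c hc, hN d hd]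
    simp [hPN.orth a ha d hd, hPN.orth c hc b hb, hB d a]
  · have h2' : ∀ u v : V, (2 : F) • u = (2 : F) • v → u = v := fun u v h => by
      rwa [smul_right_inj h2] at h
    have hPy : ∀ p ∈ P, h (y p) = y' p := fun p hp => h2' _ _ <| by
      rw [← map_smul, show (2 : F) • y p = (y p + y' p) + (y p - y' p) by rw [two_smul]; abel,
        map_add, hP _ (hPN.add_left p hp), hN _ (hPN.sub_left p hp), two_smul]
      abel
    have hNy : ∀ p ∈ N, h (y p) = -y' p := fun p hp => h2' _ _ <| by
      rw [← map_smul, show (2 : F) • y p = (y p - y' p) + (y p + y' p) by rw [two_smul]; abel,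
        map_add, hP _ (hPN.sub_right p hp), hN _ (hPN.add_right p hp), two_smul]
      abel
    obtain ⟨a, ha, b, hb, rfl⟩ := hdec v
    rw [map_add, map_add, hPy a ha, hNy b hb, map_add h, hP a ha, hN b hb, map_add, map_neg]

end Glue

section Isometry

variable {F V : Type} [Field F] [AddCommGroup V] [Module F V]

/-- The isometry group of a bilinear form. -/
def isoGroup (B : LinearMap.BilinForm F V) : Subgroup (V ≃ₗ[F] V) where
  carrier := {g | ∀ u v, B (g u) (g v) = B u v}
  one_mem' _ _ := rfl
  mul_mem' {a b} ha hb u v := (ha (b u) (b v)).trans (hb u v)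
  inv_mem' {a} ha u v := by
    rw [← ha, ← LinearEquiv.mul_apply, ← LinearEquiv.mul_apply, mul_inv_cancel]
    rfl

instance isoGroup_finite [Finite V] (B : LinearMap.BilinForm F V) : Finite (isoGroup B) :=
  Finite.of_injective (fun (g : isoGroup B) (v : V) => g.1 v) fun _ _ h =>
    Subtype.ext (LinearEquiv.ext (congrFun h))

section Product

variable {U W : Submodule F V}

/-- The direct sum of automorphisms of two complementary subspaces. -/
def autProd (h : IsCompl U W) : (U ≃ₗ[F] U) × (W ≃ₗ[F] W) →* (V ≃ₗ[F] V) where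
  toFun ab := (Submodule.prodEquivOfIsCompl U W h).symm.trans
    ((ab.1.prodCongr ab.2).trans (Submodule.prodEquivOfIsCompl U W h))
  map_one' := by
    ext v
    exact (Submodule.prodEquivOfIsCompl U W h).apply_symm_apply v
  map_mul' a b := by
    ext v
    simp [LinearEquiv.mul_apply]

theorem autProd_apply (h : IsCompl U W) (a : U ≃ₗ[F] U) (b : W ≃ₗ[F] W) (u : U) (w : W) :
    autProd h (a, b) (u + w) = a u + b w := by
  have h1 : (Submodule.prodEquivOfIsCompl U W h).symm (u + w : V) = (u, w) :=
    (LinearEquiv.symm_apply_eq _).2 rfl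
  change Submodule.prodEquivOfIsCompl U W h (a.prodCongr b
    ((Submodule.prodEquivOfIsCompl U W h).symm (u + w : V))) = _
  rw [h1]
  rfl

theorem IsCompl.exists_add {U W : Submodule F V} (h : IsCompl U W) (v : V) :
    ∃ (u : U) (w : W), (u + w : V) = v := by
  obtain ⟨u, hu, w, hw, huw⟩ := Submodule.mem_sup.1 (h.sup_eq_top.symm ▸ Submodule.mem_top : v ∈ _)
  exact ⟨⟨u, hu⟩, ⟨w, hw⟩, huw⟩

/-- The direct sum of isometries of two complementary orthogonal subspaces. -/
def isoProd {B : LinearMap.BilinForm F V} (hB : ∀ u v, B u v = B v u) (h : IsCompl U W)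
    (horth : ∀ u ∈ U, ∀ w ∈ W, B u w = 0) :
    isoGroup (B.restrict U) × isoGroup (B.restrict W) →* isoGroup B :=
  ((autProd h).comp (MonoidHom.prodMap (Subgroup.subtype _) (Subgroup.subtype _))).codRestrict _ <|
    by
    rintro ⟨⟨a, ha⟩, ⟨b, hb⟩⟩ x y
    change B (autProd h (a, b) x) (autProd h (a, b) y) = B x y
    obtain ⟨u, w, rfl⟩ := IsCompl.exists_add h x
    obtain ⟨u', w', rfl⟩ := IsCompl.exists_add h y
    have h1 : B (a u) (a u') = B u u' := ha u u'
    have h2 : B (b w) (b w') = B w w' := hb w w'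
    rw [autProd_apply, autProd_apply]
    simp only [map_add, LinearMap.add_apply, h1, h2, horth _ (a u).2 _ (b w').2,
      hB (b w) (a u'), horth _ (a u').2 _ (b w).2, horth _ u.2 _ w'.2, hB w u',
      horth _ u'.2 _ w.2]

theorem isoProd_apply {B : LinearMap.BilinForm F V} (hB : ∀ u v, B u v = B v u) (h : IsCompl U W)
    (horth : ∀ u ∈ U, ∀ w ∈ W, B u w = 0)
    (x : isoGroup (B.restrict U) × isoGroup (B.restrict W)) (u : U) (w : W) :
    (isoProd hB h horth x : V ≃ₗ[F] V) (u + w) = x.1.1 u + x.2.1 w :=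
  autProd_apply h x.1.1 x.2.1 u w

theorem mem_range_isoProd [FiniteDimensional F V] {B : LinearMap.BilinForm F V}
    (hB : ∀ u v, B u v = B v u) (h : IsCompl U W)
    (horth : ∀ u ∈ U, ∀ w ∈ W, B u w = 0) {g : isoGroup B} (hU : ∀ u ∈ U, g.1 u ∈ U)
    (hW : ∀ w ∈ W, g.1 w ∈ W) : g ∈ (isoProd hB h horth).range := by
  have key : ∀ (U : Submodule F V), (∀ u ∈ U, g.1 u ∈ U) →
      ∃ a : isoGroup (B.restrict U), ∀ u, (a.1 u : V) = g.1 u := by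
    intro U hU
    refine ⟨⟨LinearEquiv.ofInjectiveEndo (LinearMap.restrict g.1.toLinearMap hU) ?_, ?_⟩, ?_⟩
    · intro x y hxy
      exact Subtype.ext (g.1.injective (congrArg Subtype.val hxy))
    · exact fun u v => g.2 u v
    · exact fun u => rfl
  obtain ⟨a, ha⟩ := key U hU
  obtain ⟨b, hb⟩ := key W hW
  refine ⟨(a, b), Subtype.ext (LinearEquiv.ext fun v => ?_)⟩
  obtain ⟨u, w, rfl⟩ := IsCompl.exists_add h v
  rw [isoProd_apply, map_add, ha, hb]

end Product

variable {B : LinearMap.BilinForm F V}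

theorem exists_involution_inverting_isoGroup [FiniteDimensional F V] (hB : ∀ u v, B u v = B v u)
    (h2 : (2 : F) ≠ 0) (hnd : ∀ u, (∀ w, B u w = 0) → u = 0) (y : isoGroup B) :
    ∃ h : isoGroup B, h * h = 1 ∧ h * y * h⁻¹ = y⁻¹ := by
  have hinv : ∀ v, y.1 ((y⁻¹).1 v) = v := fun v => by
    rw [← LinearEquiv.mul_apply, ← Subgroup.coe_mul, mul_inv_cancel]
    rfl
  have hinv' : ∀ v, (y⁻¹).1 (y.1 v) = v := fun v => by
    rw [← LinearEquiv.mul_apply, ← Subgroup.coe_mul, inv_mul_cancel]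
    rfl
  obtain ⟨h, hh, hiso, hy⟩ := exists_involution_inverting (y := y.1.toLinearMap)
    (y' := (y⁻¹).1.toLinearMap) hB h2 hnd
    (fun u v => by
      have := y.2 u ((y⁻¹).1 v)
      rwa [hinv] at this) hinv hinv'
  refine ⟨⟨LinearEquiv.ofInvolutive h hh, hiso⟩, Subtype.ext (LinearEquiv.ext hh), ?_⟩
  rw [mul_inv_eq_iff_eq_mul]
  exact Subtype.ext (LinearEquiv.ext hy)

theorem allReal_isoGroup [FiniteDimensional F V] (hB : ∀ u v, B u v = B v u)
    (h2 : (2 : F) ≠ 0) (hnd : ∀ u, (∀ w, B u w = 0) → u = 0) : AllReal (isoGroup B) := fun y =>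
  (exists_involution_inverting_isoGroup hB h2 hnd y).imp fun _ h => h.2

theorem noAlt_isoGroup [Finite F] [FiniteDimensional F V] (hB : ∀ u v, B u v = B v u)
    (h2 : (2 : F) ≠ 0) (hnd : ∀ u, (∀ w, B u w = 0) → u = 0) : NoAlt (isoGroup B) := by
  induction hn : Module.finrank F V using Nat.strong_induction_on generalizing V with
  | _ n ih =>
  subst hn
  have : Finite V := Module.finite_of_finite F
  rcases subsingleton_or_nontrivial V with hV | hV
  · have : Subsingleton (isoGroup B) :=
      ⟨fun a b => Subtype.ext (LinearEquiv.ext fun v => Subsingleton.elim _ _)⟩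
    exact NoAlt.of_subsingleton _
  set z : isoGroup B := ⟨LinearEquiv.neg F, fun u v => by simp⟩ with hz
  have hzv : ∀ v, z.1 v = -v := fun v => rfl
  have hself : ∀ v : V, v = -v → v = 0 := fun v hv => by
    have h3 : (2 : F) • v = 0 := by
      rw [two_smul]
      nth_rewrite 1 [hv]
      exact neg_add_cancel v
    exact (smul_eq_zero.1 h3).resolve_left h2
  refine NoAlt.of_involutions (z := z) (fun s => ?_) ?_ ?_
    (exists_involution_inverting_isoGroup hB h2 hnd) fun t ht ht1 htz => ?_
  · exact Subtype.ext (LinearEquiv.ext fun v => map_neg s.1 v)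
  · exact Subtype.ext (LinearEquiv.ext fun v => neg_neg v)
  · intro h
    obtain ⟨v, hv⟩ := exists_ne (0 : V)
    refine hv (hself v ?_)
    have := hzv v
    rw [h] at this
    exact this
  have htt : ∀ v, t.1 (t.1 v) = v := fun v => by
    rw [← LinearEquiv.mul_apply, ← Subgroup.coe_mul, ht]
    rfl
  set P : Submodule F V := LinearMap.ker (t.1.toLinearMap - 1) with hP
  set N : Submodule F V := LinearMap.ker (t.1.toLinearMap + 1) with hN
  have hmP : ∀ v, v ∈ P ↔ t.1 v = v := fun v => sub_eq_zero
  have hmN : ∀ v, v ∈ N ↔ t.1 v = -v := fun v => add_eq_zero_iff_eq_neg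
  have horth : ∀ u ∈ P, ∀ w ∈ N, B u w = 0 := by
    intro u hu w hw
    have h := t.2 u w
    rw [(hmP u).1 hu, (hmN w).1 hw, map_neg] at h
    have h3 : 2 * B u w = 0 := by linear_combination -h
    exact (mul_eq_zero.1 h3).resolve_left h2
  have hc : IsCompl P N := by
    refine ⟨Submodule.disjoint_def.2 fun x hx hx' =>
      hself x (((hmP x).1 hx).symm.trans ((hmN x).1 hx')),
      codisjoint_iff.2 (eq_top_iff.2 fun v _ => Submodule.mem_sup.2
        ⟨(2 : F)⁻¹ • (v + t.1 v), ?_, (2 : F)⁻¹ • (v - t.1 v), ?_, ?_⟩)⟩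
    · rw [hmP, map_smul, map_add, htt, add_comm]
    · rw [hmN, map_smul, map_sub, htt, ← smul_neg, neg_sub]
    · rw [← smul_add, show v + t.1 v + (v - t.1 v) = (2 : F) • v by rw [two_smul]; abel, smul_smul,
        inv_mul_cancel₀ h2, one_smul]
  have hP1 : P ≠ ⊤ := fun h => ht1 (Subtype.ext (LinearEquiv.ext fun v =>
    (hmP v).1 (h.symm ▸ Submodule.mem_top)))
  have hN1 : N ≠ ⊤ := fun h => htz (Subtype.ext (LinearEquiv.ext fun v =>
    (hmN v).1 (h.symm ▸ Submodule.mem_top)))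
  have hndP : ∀ u : P, (∀ w : P, B.restrict P u w = 0) → u = 0 := by
    refine fun u hu => Subtype.ext (hnd u fun x => ?_)
    obtain ⟨a, b, rfl⟩ := IsCompl.exists_add hc x
    rw [map_add, horth u u.2 b b.2, add_zero]
    exact hu a
  have hndN : ∀ u : N, (∀ w : N, B.restrict N u w = 0) → u = 0 := by
    refine fun u hu => Subtype.ext (hnd u fun x => ?_)
    obtain ⟨a, b, rfl⟩ := IsCompl.exists_add hc x
    rw [map_add, hB u a, horth a a.2 u u.2, zero_add]
    exact hu b
  have hBP : ∀ u v : P, B.restrict P u v = B.restrict P v u := fun u v => hB u v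
  have hBN : ∀ u v : N, B.restrict N u v = B.restrict N v u := fun u v => hB u v
  have nP := ih _ (Submodule.finrank_lt hP1) hBP hndP rfl
  have nN := ih _ (Submodule.finrank_lt hN1) hBN hndN rfl
  have rP := allReal_isoGroup hBP h2 hndP
  have rN := allReal_isoGroup hBN h2 hndN
  have hcomm : ∀ (a : isoGroup (B.restrict P)) (b : isoGroup (B.restrict N)),
      MonoidHom.inl _ _ a * MonoidHom.inr _ _ b = MonoidHom.inr _ _ b * MonoidHom.inl _ _ a := by
    intro a b
    simp
  have hsurj : ∀ n : isoGroup (B.restrict P) × isoGroup (B.restrict N),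
      ∃ a b, n = MonoidHom.inl _ _ a * MonoidHom.inr _ _ b := fun n => ⟨n.1, n.2, by simp⟩
  have hNA := NoAlt.of_product nP rP nN _ _ hcomm hsurj
  have hAR := AllReal.of_product rP rN _ _ hcomm hsurj
  have hzc : ∀ s, s * z = z * s := fun s => Subtype.ext (LinearEquiv.ext fun v => map_neg s.1 v)
  have hz2 : z * z = 1 := Subtype.ext (LinearEquiv.ext fun v => neg_neg v)
  let H : Subgroup (isoGroup B) :=
    { carrier := {g | g * t * g⁻¹ = t ∨ g * t * g⁻¹ = t * z}
      one_mem' := Or.inl (by simp)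
      mul_mem' := by
        intro a b ha hb
        have hab : a * b * t * (a * b)⁻¹ = a * (b * t * b⁻¹) * a⁻¹ := by group
        have hz' : a * (t * z) * a⁻¹ = a * t * a⁻¹ * z := by
          rw [mul_assoc a t z |>.symm, mul_assoc (a * t), ← hzc, ← mul_assoc]
        rw [Set.mem_ofPred_eq, hab]
        rcases ha with ha | ha <;> rcases hb with hb | hb <;> rw [hb]
        · exact Or.inl ha
        · rw [hz', ha]; exact Or.inr rfl
        · exact Or.inr ha
        · rw [hz', ha, mul_assoc, hz2, mul_one]; exact Or.inl rfl
      inv_mem' := by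
        intro a ha
        rw [Set.mem_ofPred_eq, inv_inv]
        rcases ha with ha | ha
        · left
          nth_rewrite 1 [← ha]
          group
        · right
          have h3 : a * t = t * z * a := by rw [← ha]; group
          have h4 : a * (t * z) = t * a := by
            rw [← mul_assoc, h3, mul_assoc, hzc a, mul_assoc t, ← mul_assoc z, hz2, one_mul]
          rw [mul_assoc, ← h4, inv_mul_cancel_left] }
  refine ⟨H, ?_, fun g hg => hg⟩
  have hran : ∀ x : isoGroup (B.restrict P) × isoGroup (B.restrict N),
      isoProd hB hc horth x ∈ H := by
    intro x
    refine Or.inl ?_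
    rw [mul_inv_eq_iff_eq_mul]
    refine Subtype.ext (LinearEquiv.ext fun v => ?_)
    obtain ⟨u, w, rfl⟩ := IsCompl.exists_add hc v
    change (isoProd hB hc horth x).1 (t.1 (u + w)) = t.1 ((isoProd hB hc horth x).1 (u + w))
    have hneg := isoProd_apply hB hc horth x u (-w)
    rw [map_neg, Submodule.coe_neg, Submodule.coe_neg] at hneg
    rw [map_add t.1, (hmP _).1 u.2, (hmN _).1 w.2, isoProd_apply, map_add t.1,
      (hmP _).1 (x.1.1 u).2, (hmN _).1 (x.2.1 w).2, hneg]
  have hker : ∀ g : H, g.1 * t * g.1⁻¹ = t → g ∈ ((isoProd hB hc horth).codRestrict H hran).range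
      := by
    intro g hg
    have hgt : ∀ v, g.1.1 (t.1 v) = t.1 (g.1.1 v) := by
      rw [mul_inv_eq_iff_eq_mul] at hg
      exact fun v => congrArg (fun s : isoGroup B => s.1 v) hg
    obtain ⟨x, hx⟩ := mem_range_isoProd hB hc horth (g := g.1)
      (fun u hu => by rw [hmP, ← hgt, (hmP u).1 hu])
      (fun u hu => by rw [hmN, ← hgt, (hmN u).1 hu, map_neg])
    exact ⟨x, Subtype.ext hx⟩
  by_cases hk : ∃ k : H, k.1 * t * k.1⁻¹ = t * z
  · obtain ⟨k, hk⟩ := hk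
    refine NoAlt.of_index_two hNA hAR ((isoProd hB hc horth).codRestrict H hran) k fun g => ?_
    rcases g.2 with hg | hg
    · exact Or.inl (hker g hg)
    · refine Or.inr (hker _ ?_)
      have h3 : k.1⁻¹ * (g.1 * t * g.1⁻¹) * k.1 = t := by
        rw [hg, ← hk]
        group
      refine Eq.trans ?_ h3
      change k.1⁻¹ * g.1 * t * (k.1⁻¹ * g.1)⁻¹ = _
      group
  · refine NoAlt.of_index_two hNA hAR ((isoProd hB hc horth).codRestrict H hran) 1 fun g => ?_
    rcases g.2 with hg | hg
    · exact Or.inl (hker g hg)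
    · exact absurd ⟨g, hg⟩ hk

end Isometry

end OrthSim

namespace OrthSim

open Representation

section Central

theorem NoAlt.of_central {K Z G : Type} [Group K] [CommGroup Z] [Group G] [Finite K]
    (hK : NoAlt K) (hr : AllReal K) (i : K →* G) (j : Z →* G) (hj : ∀ a g, j a * g = g * j a)
    (k : G) (hk : ∀ g, (∃ a b, g = i a * j b) ∨ ∃ a b, k⁻¹ * g = i a * j b) : NoAlt G := by
  intro V _ _ _ ρ hρ B hB hBalt
  by_contra hB0
  have hscal : ∀ a, ∃ c : ℂ, (∀ v, ρ (j a) v = c • v) ∧ c * c = 1 := by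
    intro a
    obtain ⟨c, hc⟩ := IsIrreducible.schur hρ (ρ (j a)) fun g v => by
      rw [← Module.End.mul_apply, ← map_mul, hj, map_mul, Module.End.mul_apply]
    refine ⟨c, hc, ?_⟩
    by_contra hcc
    apply hB0
    ext v w
    have h := hB (j a) v w
    rw [hc, hc, map_smul, LinearMap.map_smul₂, smul_eq_mul, smul_eq_mul,
      ← mul_assoc] at h
    have : (c * c - 1) * B v w = 0 := by rw [sub_mul, h, one_mul, sub_self]
    exact (mul_eq_zero.1 this).resolve_left (sub_ne_zero.2 hcc)
  let f : K × Z →* G := i.noncommCoprod j fun m n => (hj n (i m)).symm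
  have hran : ∀ {g}, (∃ a b, g = i a * j b) → g ∈ f.range := by
    rintro g ⟨a, b, rfl⟩
    exact ⟨(a, b), rfl⟩
  refine hB0 (isAlt_eq_zero_of_index_two f k (fun g => (hk g).imp hran hran) ρ hρ B hB hBalt
    fun W hW => ?_)
  have hz : ∀ b, ∃ c : ℂ, (∀ (a : K) (w : W.toSubmodule),
      W.toRepresentation (a, b) w = c • W.toRepresentation (a, 1) w) ∧ c * c = 1 := by
    intro b
    obtain ⟨c, hc, hcc⟩ := hscal b
    refine ⟨c, fun a w => Subtype.ext ?_, hcc⟩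
    change ρ (i a * j b) w = c • ρ (i a * j 1) w
    rw [map_one, mul_one, map_mul, Module.End.mul_apply, hc, map_smul]
  let σ : Representation ℂ K W.toSubmodule := W.toRepresentation.comp (MonoidHom.inl K Z)
  have hσ : IsIrreducible σ := by
    have := IsIrreducible.nontrivial hW
    refine isIrreducible_mk fun U hU => IsIrreducible.cases hW U fun g u hu => ?_
    obtain ⟨c, hc, -⟩ := hz g.2
    rw [show g = (g.1, g.2) from rfl, hc]
    exact U.smul_mem c (hU g.1 u hu)
  refine ⟨fun B' h1 h2 => hK _ σ hσ B' (fun g v w => h1 (g, 1) v w) h2, ?_⟩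
  obtain ⟨Q, hQ, hQ0⟩ := AllReal.exists_inv_form hr hσ
  refine ⟨Q, fun g v w => ?_, hQ0⟩
  obtain ⟨c, hc, hcc⟩ := hz g.2
  rw [show g = (g.1, g.2) from rfl, hc, hc, map_smul, LinearMap.map_smul₂,
    smul_eq_mul, smul_eq_mul, ← mul_assoc, hcc, one_mul]
  exact hQ g.1 v w

end Central

section Indicator

variable {G : Type} [Group G]

theorem InvForm.char_inv {V : Type} [AddCommGroup V] [Module ℂ V] [FiniteDimensional ℂ V]
    {ρ : Representation ℂ G V} (h : IsIrreducible ρ) {Q : LinearMap.BilinForm ℂ V}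
    (hQ : InvForm ρ Q) (h0 : Q ≠ 0) (g : G) : ρ.character g⁻¹ = ρ.character g := by
  let e := LinearEquiv.ofBijective Q (hQ.exists_repr h h0)
  have he : ρ.dual g = e.conj (ρ g) := by
    refine LinearMap.ext fun φ => ?_
    obtain ⟨v, rfl⟩ := e.surjective φ
    rw [LinearEquiv.conj_apply_apply, LinearEquiv.symm_apply_apply]
    ext w
    exact (hQ.apply_left g v w).symm
  rw [← Representation.char_dual, Representation.character, Representation.character, he,
    LinearMap.trace_conj']

theorem sum_char_sq_eq_card [Fintype G] (hG : NoAlt G) {V : Type} [AddCommGroup V] [Module ℂ V]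
    [FiniteDimensional ℂ V] {ρ : Representation ℂ G V} (h : IsIrreducible ρ)
    (hr : ∀ g, ∃ r : ℝ, ρ.character g = r) :
    ∑ g, ρ.character (g * g) = Fintype.card G := by
  rw [sum_char_sq ρ (hG V ρ h)]
  have hne : ∑ g, ρ.character g * ρ.character g ≠ 0 := by
    choose r hr using hr
    have := IsIrreducible.nontrivial h
    have h1 : r 1 ≠ 0 := by
      intro h1
      have h2 := hr 1
      rw [Representation.char_one, h1, Complex.ofReal_zero, Nat.cast_eq_zero] at h2
      exact Module.finrank_pos.ne' h2
    simp_rw [hr, ← Complex.ofReal_mul, ← Complex.ofReal_sum]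
    exact Complex.ofReal_ne_zero.2 (Finset.sum_pos' (fun g _ => mul_self_nonneg _)
      ⟨1, Finset.mem_univ _, mul_self_pos.2 h1⟩).ne'
  obtain ⟨Q, hQ, hQ0⟩ := OrthSim.exists_inv_form ρ hne
  have := IsIrreducible.sum_char_mul_char_inv h
  simp_rw [hQ.char_inv h hQ0] at this
  rw [this, Nat.card_eq_fintype_card]

theorem isIrreducible_of_simple (ρ : FDRep ℂ G) (hρ : Simple ρ) :
    IsIrreducible (ρ.ρ : Representation ℂ G ρ) := by
  have : Nontrivial ρ := by
    by_contra hV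
    rw [not_nontrivial_iff_subsingleton] at hV
    apply id_nonzero ρ
    ext v
    exact Subsingleton.elim _ _
  refine isIrreducible_mk fun U hU => ?_
  let σ : Subrepresentation (ρ.ρ : Representation ℂ G ρ) := ⟨U, fun g _ hu => hU g _ hu⟩
  let f : FDRep.of σ.toRepresentation ⟶ ρ := ⟨FGModuleCat.ofHom U.subtype, fun g => rfl⟩
  have hmono : Mono f := by
    refine ⟨fun a b hab => ?_⟩
    ext v
    have := congrArg (fun t => t.hom v) hab
    exact this
  by_cases hf : f = 0
  · left
    refine (Submodule.eq_bot_iff _).2 fun u hu => ?_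
    exact congrArg (fun t => t.hom (⟨u, hu⟩ : U)) hf
  · right
    have := isIso_of_mono_of_nonzero hf
    refine (Submodule.eq_top_iff').2 fun v => ?_
    have h1 := congrArg (fun t => t.hom v) (IsIso.inv_hom_id f)
    have h2 : (((inv f).hom v : U) : ρ) = v := h1
    rw [← h2]
    exact Subtype.property _

end Indicator

section Similitude

variable {N F : Type} [Fintype N] [DecidableEq N] [Field F]

/-- Linear automorphisms of a coordinate space as invertible matrices. -/
def autEquivGL : ((N → F) ≃ₗ[F] (N → F)) ≃* GL N F :=
  (Matrix.GeneralLinearGroup.toLin.trans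
    (LinearMap.GeneralLinearGroup.generalLinearEquiv F (N → F))).symm

theorem autEquivGL_symm_apply (g : GL N F) (v : N → F) :
    autEquivGL.symm g v = (g : Matrix N N F) *ᵥ v := rfl

theorem transpose_mul_mul_eq_smul_iff {J : Matrix N N F} (g : GL N F) (c : F) :
    (g : Matrix N N F)ᵀ * J * (g : Matrix N N F) = c • J ↔
      ∀ u v, Matrix.toBilin' J (autEquivGL.symm g u) (autEquivGL.symm g v) =
        c * Matrix.toBilin' J u v := by
  rw [← (Matrix.toBilin' (n := N) (R₁ := F)).injective.eq_iff, LinearMap.ext_iff₂]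
  refine forall₂_congr fun u v => ?_
  rw [map_smul, LinearMap.smul_apply, LinearMap.smul_apply, smul_eq_mul]
  simp only [Matrix.toBilin'_apply', autEquivGL_symm_apply, ← Matrix.mulVec_mulVec,
    Matrix.dotProduct_mulVec, Matrix.vecMul_transpose]

/-- Isometries as similitudes. -/
def isoGroupHom (J : Matrix N N F) : isoGroup (Matrix.toBilin' J) →* similitudeGroup J :=
  (autEquivGL.toMonoidHom.comp (Subgroup.subtype _)).codRestrict _ fun g =>
    ⟨1, (transpose_mul_mul_eq_smul_iff _ _).2 fun u v => by
      rw [Units.val_one, one_mul]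
      change Matrix.toBilin' J (autEquivGL.symm (autEquivGL g.1) u)
        (autEquivGL.symm (autEquivGL g.1) v) = _
      rw [MulEquiv.symm_apply_apply]
      exact g.2 u v⟩

theorem mem_range_isoGroupHom {J : Matrix N N F} (g : similitudeGroup J)
    (hg : ((g : GL N F) : Matrix N N F)ᵀ * J * ((g : GL N F) : Matrix N N F) = J) :
    ∃ a, isoGroupHom J a = g :=
  ⟨⟨autEquivGL.symm g.1, fun u v => by
    rw [(transpose_mul_mul_eq_smul_iff g.1 1).1 (hg.trans (one_smul F J).symm), one_mul]⟩,
    Subtype.ext (autEquivGL.apply_symm_apply g.1)⟩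

/-- Scalar matrices as similitudes. -/
def scalarHom (J : Matrix N N F) : Fˣ →* similitudeGroup J :=
  (Units.map (algebraMap F (Matrix N N F)).toMonoidHom).codRestrict _ fun a =>
    ⟨a * a, by
      change (algebraMap F (Matrix N N F) a)ᵀ * J * algebraMap F (Matrix N N F) a = _
      rw [Algebra.algebraMap_eq_smul_one, transpose_smul, transpose_one, smul_mul, one_mul,
        mul_smul_comm, mul_one, smul_smul, Units.val_mul]⟩

theorem coe_scalarHom (J : Matrix N N F) (a : Fˣ) :
    (((scalarHom J a : similitudeGroup J) : GL N F) : Matrix N N F) =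
      algebraMap F (Matrix N N F) a := rfl

theorem scalarHom_comm (J : Matrix N N F) (a : Fˣ) (g : similitudeGroup J) :
    scalarHom J a * g = g * scalarHom J a :=
  Subtype.ext (Units.ext (Algebra.commutes (a : F) ((g : GL N F) : Matrix N N F)))

theorem exists_eq_isoGroupHom_mul_scalarHom {J : Matrix N N F} (g : similitudeGroup J) {a : F}
    (ha : a ≠ 0)
    (hg : ((g : GL N F) : Matrix N N F)ᵀ * J * ((g : GL N F) : Matrix N N F) = (a * a) • J) :
    ∃ x z, g = isoGroupHom J x * scalarHom J z := by
  obtain ⟨x, hx⟩ := mem_range_isoGroupHom (g * (scalarHom J (Units.mk0 a ha))⁻¹) (by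
    rw [← map_inv]
    have := sim_mul (J := J) g.1 (scalarHom J (Units.mk0 a ha)⁻¹).1 (Units.mk0 a ha * Units.mk0 a
      ha)
      ((Units.mk0 a ha)⁻¹ * (Units.mk0 a ha)⁻¹) hg (by
        rw [coe_scalarHom, Algebra.algebraMap_eq_smul_one, transpose_smul, transpose_one, smul_mul,
          one_mul, mul_smul_comm, mul_one, smul_smul, Units.val_mul])
    refine this.trans ?_
    rw [show Units.mk0 a ha * Units.mk0 a ha * ((Units.mk0 a ha)⁻¹ * (Units.mk0 a ha)⁻¹) = 1 by
      group, Units.val_one, one_smul])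
  exact ⟨x, Units.mk0 a ha, by rw [hx, inv_mul_cancel_right]⟩

theorem isSquare_mul_of_not_isSquare [Finite F] {a b : F} (ha : ¬IsSquare a) (hb : ¬IsSquare b) :
    IsSquare (a * b) := by
  have := Fintype.ofFinite F
  by_cases h2 : ringChar F = 2
  · exact FiniteField.isSquare_of_char_two h2 _
  have h0 : a * b ≠ 0 := mul_ne_zero (fun e => ha (e ▸ IsSquare.zero)) (fun e => hb (e ▸
    IsSquare.zero))
  rw [← quadraticChar_one_iff_isSquare h0, map_mul,
    quadraticChar_neg_one_iff_not_isSquare.2 ha, quadraticChar_neg_one_iff_not_isSquare.2 hb]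
  rfl

theorem noAlt_similitudeGroup [Finite F] (h2 : (2 : F) ≠ 0) {J : Matrix N N F} (hJ : IsUnit J)
    (hJs : Jᵀ = J) : NoAlt (similitudeGroup J) := by
  have hB : ∀ u v, Matrix.toBilin' J u v = Matrix.toBilin' J v u := fun u v => by
    rw [Matrix.toBilin'_apply', Matrix.toBilin'_apply', Matrix.dotProduct_mulVec, dotProduct_comm,
      ← Matrix.mulVec_transpose, hJs]
  have hnd : ∀ u, (∀ w, Matrix.toBilin' J u w = 0) → u = 0 := fun u hu =>
    Matrix.vecMul_injective_iff_isUnit.2 hJ <| by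
      change u ᵥ* J = 0 ᵥ* J
      rw [Matrix.zero_vecMul]
      refine dotProduct_eq_zero _ fun w => ?_
      rw [← Matrix.dotProduct_mulVec, ← Matrix.toBilin'_apply', hu]
  have hsq : ∀ (g : similitudeGroup J) (c : Fˣ), IsSquare (c : F) →
      ((g : GL N F) : Matrix N N F)ᵀ * J * ((g : GL N F) : Matrix N N F) = (c : F) • J →
      ∃ x z, g = isoGroupHom J x * scalarHom J z := by
    rintro g c ⟨a, ha⟩ hg
    exact exists_eq_isoGroupHom_mul_scalarHom g (a := a) (fun e => c.ne_zero (by rw [ha, e,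
      zero_mul]))
      (ha ▸ hg)
  suffices h : ∃ k : similitudeGroup J, ∀ g, (∃ x z, g = isoGroupHom J x * scalarHom J z) ∨
      ∃ x z, k⁻¹ * g = isoGroupHom J x * scalarHom J z from
    h.elim fun k hk => NoAlt.of_central (noAlt_isoGroup hB h2 hnd) (allReal_isoGroup hB h2 hnd)
      (isoGroupHom J) (scalarHom J) (scalarHom_comm J) k hk
  by_cases hk : ∃ (k : similitudeGroup J) (c : Fˣ), ¬IsSquare (c : F) ∧
      ((k : GL N F) : Matrix N N F)ᵀ * J * ((k : GL N F) : Matrix N N F) = (c : F) • J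
  · obtain ⟨k, c, hc, hkc⟩ := hk
    refine ⟨k, fun g => ?_⟩
    obtain ⟨d, hd⟩ := g.2
    by_cases hds : IsSquare (d : F)
    · exact Or.inl (hsq g d hds hd)
    · refine Or.inr (hsq _ (c⁻¹ * d) ?_ (sim_mul _ _ _ _ (sim_inv _ _ hkc) hd))
      rw [Units.val_mul]
      refine isSquare_mul_of_not_isSquare (fun h => hc ?_) hds
      rw [Units.val_inv_eq_inv_val] at h
      exact isSquare_inv.1 h
  · push Not at hk
    refine ⟨1, fun g => ?_⟩
    obtain ⟨d, hd⟩ := g.2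
    exact Or.inl (hsq g d (by_contra fun h => hk g d h hd) hd)

end Similitude

end OrthSim

theorem stmt_3 (n : ℕ) (q : ℕ) (hq : ∃ p r : ℕ, p.Prime ∧ Odd p ∧ 0 < r ∧ q = p ^ r)
    (F : Type) [Field F] [Fintype F] [DecidableEq F] (hF : Fintype.card F = q)
    (J : Matrix (Fin (2 * n)) (Fin (2 * n)) F) (hJunit : IsUnit J) (hJsymm : Jᵀ = J)
    (ρ : FDRep ℂ ↥(similitudeGroup J)) (hρ : Simple ρ)
    (hreal : IsRealValued ρ.character) :
    fsIndicator ↥(similitudeGroup J) ρ.character = 1 := by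
  have h2 : (2 : F) ≠ 0 := by
    refine Ring.two_ne_zero fun h => ?_
    obtain ⟨p, r, -, hp, -, rfl⟩ := hq
    rw [FiniteField.even_card_iff_char_two, hF] at h
    have := Nat.odd_iff.1 (hp.pow (n := r))
    omega
  have h := OrthSim.sum_char_sq_eq_card (OrthSim.noAlt_similitudeGroup h2 hJunit hJsymm)
    (OrthSim.isIrreducible_of_simple ρ hρ) hreal
  exact (inv_mul_eq_one₀ (Nat.cast_ne_zero.2 Fintype.card_ne_zero)).2 h.symm

end
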